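/- arXiv:1509.05783 — 5 statements merged into one kernel-verified Lean document; each statement's English description precedes it below -/
import Mathlib

section
/- There exist absolute constants α > 1 and C > 0 with the following property: for every n ≥ 1 and every family {P_i : i ∈ I} of closed half-spaces P_i = {x ∈ ℝⁿ : ⟨x,v_i⟩ ≤ 1} in ℝⁿ such that P = ⋂_{i∈I} P_i has positive volume, there exist s ≤ αn and indices i_1, …, i_s ∈ I such that |P_{i_1} ∩ ⋯ ∩ P_{i_s}| ≤ (Cn)ⁿ |P|. -/
open MeasureTheory
open scoped RealInnerProductSpace

section Position

open Module Filter Topology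

variable {E ι : Type*} [NormedAddCommGroup E] [InnerProductSpace ℝ E]

/-- The vectors `u i` lie in the unit ball, and no ellipsoid contained in
`⋂ i, {x | ⟪x, u i⟫ ≤ 1}` has larger volume than the unit ball. -/
structure IsJohnPosition (u : ι → E) : Prop where
  norm_le_one : ∀ i, ‖u i‖ ≤ 1
  det_le_one : ∀ (A : E →ₗ[ℝ] E) (z : E), (∀ i, ‖A (u i)‖ + ⟪z, u i⟫ ≤ 1) → LinearMap.det A ≤ 1

variable [FiniteDimensional ℝ E]

theorem eventually_one_lt_det_one_add_smul {M : E →ₗ[ℝ] E} (hM : 0 < LinearMap.trace ℝ E M) :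
    ∀ᶠ ε : ℝ in 𝓝[>] 0, 1 < LinearMap.det (1 + ε • M) := by
  classical
  let b := finBasis ℝ E
  let N := LinearMap.toMatrix b b M
  let p : Polynomial ℝ :=
    ((Matrix.det (1 + (Polynomial.X : Polynomial ℝ) • N.map Polynomial.C)).divX).divX
  have hdet (ε : ℝ) :
      LinearMap.det (1 + ε • M) = 1 + ε * (LinearMap.trace ℝ E M + p.eval ε * ε) := by
    rw [← LinearMap.det_toMatrix b]
    simp only [map_add, map_smul, LinearMap.toMatrix_one]
    rw [Matrix.det_one_add_smul ε (LinearMap.toMatrix b b M),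
      ← LinearMap.trace_eq_matrix_trace ℝ b]
    ring
  have hcont : Continuous fun ε : ℝ ↦ LinearMap.trace ℝ E M + p.eval ε * ε := by fun_prop
  have hpos : ∀ᶠ ε : ℝ in 𝓝 0, 0 < LinearMap.trace ℝ E M + p.eval ε * ε := by
    apply (hcont.tendsto 0).eventually_const_lt
    simpa using hM
  filter_upwards [nhdsWithin_le_nhds hpos, self_mem_nhdsWithin] with ε h1 h2
  rw [hdet]
  have := mul_pos (Set.mem_Ioi.1 h2) h1
  linarith

/-- First-order optimality: a trace-increasing perturbation is blocked by a contact point. -/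
theorem IsJohnPosition.exists_contact [Finite ι] {u : ι → E} (hu : IsJohnPosition u)
    {M : E →ₗ[ℝ] E} (hM : 0 < LinearMap.trace ℝ E M) (z : E) :
    ∃ i, ‖u i‖ = 1 ∧ 0 ≤ ⟪M (u i), u i⟫ + ⟪z, u i⟫ := by
  by_contra! hcon
  have key (i : ι) : ∀ᶠ ε : ℝ in 𝓝[>] 0, ‖(1 + ε • M) (u i)‖ + ⟪ε • z, u i⟫ ≤ 1 := by
    rcases (hu.norm_le_one i).lt_or_eq with hi | hi
    · have hcont : Continuous fun ε : ℝ ↦ ‖u i + ε • M (u i)‖ + ε * ⟪z, u i⟫ := by fun_prop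
      have : ∀ᶠ ε : ℝ in 𝓝 0, ‖u i + ε • M (u i)‖ + ε * ⟪z, u i⟫ < 1 := by
        apply (hcont.tendsto 0).eventually_lt_const
        simpa using hi
      filter_upwards [nhdsWithin_le_nhds this] with ε h
      simpa [inner_smul_left] using h.le
    · have hneg := hcon i hi
      have h1 : ∀ᶠ ε : ℝ in 𝓝 0, 2 * (⟪M (u i), u i⟫ + ⟪z, u i⟫) +
          ε * (‖M (u i)‖ ^ 2 - ⟪z, u i⟫ ^ 2) < 0 := by
        have hcont : Continuous fun ε : ℝ ↦ 2 * (⟪M (u i), u i⟫ + ⟪z, u i⟫) +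
          ε * (‖M (u i)‖ ^ 2 - ⟪z, u i⟫ ^ 2) := by fun_prop
        apply (hcont.tendsto 0).eventually_lt_const
        linarith
      have h2 : ∀ᶠ ε : ℝ in 𝓝 0, ε * ⟪z, u i⟫ < 1 := by
        have hcont : Continuous fun ε : ℝ ↦ ε * ⟪z, u i⟫ := by fun_prop
        apply (hcont.tendsto 0).eventually_lt_const
        simp
      filter_upwards [nhdsWithin_le_nhds h1, nhdsWithin_le_nhds h2, self_mem_nhdsWithin]
        with ε h1 h2 h3
      have h4 : ‖u i + ε • M (u i)‖ ^ 2 ≤ (1 - ε * ⟪z, u i⟫) ^ 2 := by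
        rw [norm_add_sq_real, hi, norm_smul, inner_smul_right, mul_pow, Real.norm_eq_abs, sq_abs,
          real_inner_comm]
        nlinarith [mul_pos_of_neg_of_neg (neg_lt_zero.2 (Set.mem_Ioi.1 h3)) h1]
      have h5 := abs_le_of_sq_le_sq' h4 (by linarith)
      simp only [LinearMap.add_apply, Module.End.one_apply, LinearMap.smul_apply, inner_smul_left,
        conj_trivial]
      linarith [h5.2]
  obtain ⟨ε, h1, h2⟩ :=
    ((eventually_one_lt_det_one_add_smul hM).and (eventually_all.2 key)).exists
  exact (hu.det_le_one _ _ h2).not_gt h1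

theorem trace_rankOne_self (x : E) :
    LinearMap.trace ℝ E (InnerProductSpace.rankOne ℝ x x).toLinearMap = ‖x‖ ^ 2 := by
  rw [InnerProductSpace.trace_rankOne, real_inner_self_eq_norm_sq]

theorem IsJohnPosition.norm_le_finrank [Finite ι] {u : ι → E} (hu : IsJohnPosition u) {x : E}
    (hx : ∀ i, ⟪x, u i⟫ ≤ 1) : ‖x‖ ≤ finrank ℝ E := by
  by_contra! hlt
  set d : ℝ := (finrank ℝ E : ℝ)
  have hd : 0 ≤ d := Nat.cast_nonneg _
  obtain ⟨δ, hδ, hδ'⟩ : ∃ δ > 0, d * (‖x‖ + δ) < ‖x‖ ^ 2 := by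
    refine ⟨(‖x‖ - d) / 2, by linarith, by nlinarith⟩
  obtain ⟨i, hi, h⟩ := hu.exists_contact
    (M := (InnerProductSpace.rankOne ℝ x x).toLinearMap - (‖x‖ + δ) • 1) (by
      rw [map_sub, map_smul, trace_rankOne_self, LinearMap.trace_one, smul_eq_mul]
      linarith) ((‖x‖ - 1) • x)
  have h1 := hx i
  have h2 := (abs_le.1 (abs_real_inner_le_norm x (u i))).1
  simp only [LinearMap.sub_apply, LinearMap.smul_apply, Module.End.one_apply, inner_sub_left,
    inner_smul_left, conj_trivial, ContinuousLinearMap.coe_coe, InnerProductSpace.rankOne_apply,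
    real_inner_self_eq_norm_sq, hi] at h
  rw [hi] at h2
  nlinarith

theorem IsJohnPosition.mem_convexHull [Finite ι] [Nonempty ι] {u : ι → E}
    (hu : IsJohnPosition u) {w : E}
    (hw : ‖w‖ * finrank ℝ E < 1) : w ∈ convexHull ℝ (Set.range u) := by
  by_contra hmem
  obtain ⟨f, c, hf, hc⟩ := geometric_hahn_banach_closed_point (convex_convexHull ℝ _)
    ((Set.finite_range u).isClosed_convexHull ℝ) hmem
  set x := (InnerProductSpace.toDual ℝ E).symm f
  have hfx (y : E) : f y = ⟪x, y⟫ := by simp [x]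
  have hux (i : ι) : ⟪x, u i⟫ < c := by
    rw [← hfx]; exact hf _ (subset_convexHull ℝ _ ⟨i, rfl⟩)
  have hbound (t : ℝ) (ht : 0 ≤ t) (htc : t * c ≤ 1) : t * ‖x‖ ≤ finrank ℝ E := by
    have := hu.norm_le_finrank (x := t • x) fun i ↦ by
      rw [inner_smul_left, conj_trivial]
      exact (mul_le_mul_of_nonneg_left (hux i).le ht).trans htc
    rwa [norm_smul, Real.norm_of_nonneg ht] at this
  have hcw : c < ‖x‖ * ‖w‖ := by
    rw [hfx] at hc
    exact hc.trans_le (real_inner_le_norm _ _)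
  rcases le_or_gt c 0 with hc0 | hc0
  · have hx : x ≠ 0 := by
      intro hx
      have := hux (Classical.arbitrary ι)
      rw [hx, inner_zero_left] at this
      exact this.not_ge hc0
    have h1 := hbound ((finrank ℝ E + 1) / ‖x‖) (by positivity)
      ((mul_nonpos_of_nonneg_of_nonpos (by positivity) hc0).trans zero_le_one)
    rw [div_mul_cancel₀ _ (norm_ne_zero_iff.2 hx)] at h1
    linarith
  · have h1 := hbound c⁻¹ (by positivity) (inv_mul_cancel₀ hc0.ne').le
    rw [inv_mul_le_iff₀ hc0] at h1
    have hd : (0 : ℝ) ≤ finrank ℝ E := Nat.cast_nonneg _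
    nlinarith [norm_nonneg w, mul_le_mul_of_nonneg_right h1 (norm_nonneg w)]

end Position

section Selection

open Module Submodule InnerProductSpace

variable {E ι : Type*} [NormedAddCommGroup E] [InnerProductSpace ℝ E] [FiniteDimensional ℝ E]

theorem inner_starProjection_self (K : Submodule ℝ E) (x : E) :
    ⟪K.starProjection x, x⟫ = ‖K.starProjection x‖ ^ 2 := by
  have := starProjection_inner_eq_zero x _ (starProjection_apply_mem K x)
  rw [inner_sub_left, real_inner_self_eq_norm_sq, real_inner_comm] at this
  linarith

theorem trace_starProjection_eq_finrank (K : Submodule ℝ E) :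
    LinearMap.trace ℝ E K.starProjection.toLinearMap = finrank ℝ K := by
  apply LinearMap.IsProj.trace
  exact ⟨fun x ↦ starProjection_apply_mem K x, fun x hx ↦ starProjection_eq_self_iff.2 hx⟩

theorem IsJohnPosition.exists_far_from_subspace [Finite ι] {u : ι → E} (hu : IsJohnPosition u)
    (W : Submodule ℝ E) {k : ℕ} (hW : finrank ℝ W ≤ k) (hk : k < finrank ℝ E) {s : E}
    (hs : ‖s‖ ^ 2 ≤ 16 * finrank ℝ E) :
    ∃ i, (1 - k / finrank ℝ E : ℝ) / 2 ≤ ‖Wᗮ.starProjection (u i)‖ ^ 2 ∧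
      √(1 - k / finrank ℝ E) * ⟪s, u i⟫ ≤ 7 := by
  set d : ℝ := (finrank ℝ E : ℝ) with hd
  have hkd : (k : ℝ) < d := Nat.cast_lt.2 hk
  have hd0 : 0 < d := (Nat.cast_nonneg k).trans_lt hkd
  set r : ℝ := 1 - k / d with hr
  have hrd : r * d = d - k := by rw [hr]; field_simp
  have hr0 : 0 < r := by
    rw [hr, sub_pos, div_lt_one hd0]; exact hkd
  have hWperp : d - k ≤ finrank ℝ Wᗮ := by
    have h1 := finrank_add_finrank_orthogonal W
    have h2 : (finrank ℝ W : ℝ) + finrank ℝ Wᗮ = d := by rw [hd, ← h1]; push_cast; ring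
    have h3 : (finrank ℝ W : ℝ) ≤ k := by exact_mod_cast hW
    linarith
  obtain ⟨i, hi, h⟩ := hu.exists_contact (M := Wᗮ.starProjection.toLinearMap -
    (r / 48) • (rankOne ℝ s s).toLinearMap - (r / 2) • 1) (by
      rw [map_sub, map_sub, map_smul, map_smul, trace_rankOne_self, LinearMap.trace_one,
        trace_starProjection_eq_finrank, smul_eq_mul, smul_eq_mul, ← hd]
      nlinarith) 0
  simp only [LinearMap.sub_apply, LinearMap.smul_apply, Module.End.one_apply, inner_sub_left,
    inner_smul_left, conj_trivial, ContinuousLinearMap.coe_coe, rankOne_apply,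
    real_inner_self_eq_norm_sq, hi, inner_starProjection_self, inner_zero_left] at h
  have hle : ‖Wᗮ.starProjection (u i)‖ ≤ 1 := hi ▸ norm_starProjection_apply_le _ _
  have hle' : ‖Wᗮ.starProjection (u i)‖ ^ 2 ≤ 1 := pow_le_one₀ (norm_nonneg _) hle
  refine ⟨i, by nlinarith [mul_nonneg hr0.le (sq_nonneg ⟪s, u i⟫)], ?_⟩
  refine (abs_le_of_sq_le_sq' ?_ (by norm_num)).2
  rw [mul_pow, Real.sq_sqrt hr0.le]
  linarith

/-- A greedy choice of vectors that are far from the span of the preceding ones and whose weighted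
sum is short. -/
theorem IsJohnPosition.exists_greedy [Finite ι] [Nonempty ι] {u : ι → E} (hu : IsJohnPosition u)
    (k : ℕ) (hk : k ≤ finrank ℝ E) :
    ∃ f : ℕ → ι, (∀ j < k, (1 - j / finrank ℝ E : ℝ) / 2 ≤
      ‖(span ℝ ((u ∘ f) '' Set.Iio j))ᗮ.starProjection (u (f j))‖ ^ 2) ∧
      ‖∑ j ∈ Finset.range k, √(1 - j / finrank ℝ E) • u (f j)‖ ^ 2 ≤ 16 * k := by
  induction k with
  | zero => exact ⟨fun _ ↦ Classical.arbitrary ι, by simp, by simp⟩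
  | succ k ih =>
    obtain ⟨f, hf, hsum⟩ := ih (Nat.le_of_succ_le hk)
    have hdim : finrank ℝ (span ℝ ((u ∘ f) '' Set.Iio k)) ≤ k := by
      classical
      have h1 := finrank_span_finset_le_card (R := ℝ) ((Finset.range k).image (u ∘ f))
      rw [Finset.coe_image, Finset.coe_range] at h1
      exact h1.trans (Finset.card_image_le.trans (Finset.card_range k).le)
    have hkd : (k : ℝ) ≤ finrank ℝ E := by exact_mod_cast Nat.le_of_succ_le hk
    obtain ⟨i, hi, his⟩ := hu.exists_far_from_subspace _ hdim hk (hsum.trans (by linarith))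
    have hupd {j : ℕ} (hj : j < k) : Function.update f k i j = f j :=
      Function.update_of_ne hj.ne _ _
    have himg {j : ℕ} (hj : j ≤ k) :
        (u ∘ Function.update f k i) '' Set.Iio j = (u ∘ f) '' Set.Iio j :=
      Set.image_congr fun m hm ↦ by
        simp only [Function.comp_apply, hupd ((Set.mem_Iio.1 hm).trans_le hj)]
    refine ⟨Function.update f k i, fun j hj ↦ ?_, ?_⟩
    · rw [himg (Nat.lt_succ_iff.1 hj)]
      rcases (Nat.lt_succ_iff.1 hj).lt_or_eq with hj | rfl
      · rw [hupd hj]; exact hf j hj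
      · rw [Function.update_self]; exact hi
    · rw [Finset.sum_range_succ, Finset.sum_congr rfl fun j hj ↦ by
        rw [hupd (Finset.mem_range.1 hj)], Function.update_self, norm_add_sq_real,
        inner_smul_right, norm_smul, mul_pow, Real.norm_eq_abs, sq_abs]
      have h1 : √(1 - k / finrank ℝ E : ℝ) ^ 2 ≤ 1 := by
        apply pow_le_one₀ (Real.sqrt_nonneg _)
        rw [Real.sqrt_le_one, sub_le_self_iff]
        positivity
      have h2 : ‖u i‖ ^ 2 ≤ 1 := pow_le_one₀ (norm_nonneg _) (hu.norm_le_one i)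
      have h3 := mul_le_one₀ h1 (sq_nonneg _) h2
      push_cast
      linarith

/-- The Gram–Schmidt lower bound for a determinant. -/
theorem prod_le_abs_det_of_le_norm_starProjection {n : ℕ} (b : OrthonormalBasis (Fin n) ℝ E)
    {v : Fin n → E} {c : Fin n → ℝ} (hc : ∀ j, 0 < c j)
    (h : ∀ j, c j ≤ ‖(span ℝ (v '' Set.Iio j))ᗮ.starProjection (v j)‖) :
    ∏ j, c j ≤ |b.toBasis.det v| := by
  have hcard : finrank ℝ E = Fintype.card (Fin n) := finrank_eq_card_basis b.toBasis
  let e := gramSchmidtOrthonormalBasis hcard v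
  have hproj (j : Fin n) : (span ℝ (v '' Set.Iio j))ᗮ.starProjection (v j) = gramSchmidt ℝ v j := by
    rw [← span_gramSchmidt_Iio]
    refine eq_starProjection_of_mem_orthogonal' ?_ ?_ (gramSchmidt_def' ℝ v j)
    · rw [mem_orthogonal']
      intro w hw
      induction hw using span_induction with
      | mem w hw =>
        obtain ⟨i, hi, rfl⟩ := hw
        exact gramSchmidt_orthogonal ℝ v (Set.mem_Iio.1 hi).ne'
      | zero => exact inner_zero_right _
      | add x y _ _ hx hy => rw [inner_add_right, hx, hy, add_zero]
      | smul a x _ hx => rw [inner_smul_right, hx, mul_zero]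
    · refine le_orthogonal_orthogonal _ (sum_mem fun i hi ↦ ?_)
      refine span_mono ?_ (starProjection_apply_mem _ _)
      simpa using ⟨i, Finset.mem_Iio.1 hi, rfl⟩
  have hnorm (j : Fin n) : c j ≤ ⟪e j, v j⟫ := by
    have hne : gramSchmidt ℝ v j ≠ 0 := by
      rw [← hproj, ← norm_pos_iff]
      exact (hc j).trans_le (h j)
    have hne' : gramSchmidtNormed ℝ v j ≠ 0 := by
      simp [gramSchmidtNormed, hne]
    have : ⟪gramSchmidt ℝ v j, v j⟫ = ‖gramSchmidt ℝ v j‖ ^ 2 := by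
      rw [← hproj, inner_starProjection_self]
    rw [gramSchmidtOrthonormalBasis_apply _ hne', gramSchmidtNormed, inner_smul_left, this,
      ← hproj]
    simp only [conj_trivial, RCLike.ofReal_real_eq_id, id]
    rw [sq, inv_mul_cancel_left₀ ((hc j).trans_le (h j)).ne']
    exact h j
  calc ∏ j, c j ≤ ∏ j, ⟪e j, v j⟫ := Finset.prod_le_prod (fun j _ ↦ (hc j).le) fun j _ ↦ hnorm j
    _ = e.toBasis.det v := (gramSchmidtOrthonormalBasis_det hcard v).symm
    _ ≤ |e.toBasis.det v| := le_abs_self _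
    _ = |b.toBasis.det v| := by
      rw [Module.Basis.det_apply, Basis.det_apply, ← e.toBasis.toMatrix_mul_toMatrix b.toBasis v,
        Matrix.det_mul, abs_mul]
      have := e.det_to_matrix_orthonormalBasis b
      rw [Module.Basis.det_apply, Real.norm_eq_abs] at this
      rw [OrthonormalBasis.coe_toBasis, this, one_mul]

end Selection

section Volume

variable {n : ℕ}

theorem volume_sum_abs_le [NeZero n] (R : ℝ) :
    volume {y : EuclideanSpace ℝ (Fin n) | ∑ j, |y j| ≤ R} =
      ENNReal.ofReal R ^ n * ENNReal.ofReal (2 ^ n / n.factorial) := by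
  have hclosed : IsClosed {x : Fin n → ℝ | ∑ j, |x j| ≤ R} :=
    isClosed_le (by fun_prop) continuous_const
  have h := volume_sum_rpow_le (Fin n) (p := 1) le_rfl R
  simp only [Real.rpow_one, div_one, Fintype.card_fin] at h
  norm_num [Real.Gamma_nat_eq_factorial] at h
  rw [← h]
  exact (PiLp.volume_preserving_ofLp (Fin n)).measure_preimage
    hclosed.measurableSet.nullMeasurableSet

theorem volume_weighted_sum_abs_le [NeZero n] {v : Fin n → EuclideanSpace ℝ (Fin n)}
    {q : Fin n → ℝ} (hq : ∀ j, 0 < q j)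
    (hv : 0 < |(EuclideanSpace.basisFun (Fin n) ℝ).toBasis.det v|) {R : ℝ} (hR : 0 ≤ R) :
    volume {x : EuclideanSpace ℝ (Fin n) | ∑ j, q j * |1 - ⟪x, v j⟫| ≤ R} =
      ENNReal.ofReal ((2 * R) ^ n / (n.factorial *
        ((∏ j, q j) * |(EuclideanSpace.basisFun (Fin n) ℝ).toBasis.det v|))) := by
  set b := (EuclideanSpace.basisFun (Fin n) ℝ).toBasis with hb
  let L : EuclideanSpace ℝ (Fin n) →ₗ[ℝ] EuclideanSpace ℝ (Fin n) :=
    Matrix.toLin b b (Matrix.diagonal q * (b.toMatrix v).transpose)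
  have hL (x : EuclideanSpace ℝ (Fin n)) (j : Fin n) : L x j = q j * ⟪x, v j⟫ := by
    have hrepr (y : EuclideanSpace ℝ (Fin n)) (j : Fin n) : b.repr y j = y j := by simp [hb]
    rw [← hrepr, Matrix.repr_toLin]
    simp [Matrix.mulVec, dotProduct, Module.Basis.toMatrix_apply, hrepr, PiLp.inner_apply,
      Finset.mul_sum,
      mul_assoc]
  have hprod : 0 < ∏ j, q j := Finset.prod_pos fun j _ ↦ hq j
  have hdet : LinearMap.det L = (∏ j, q j) * b.det v := by
    rw [LinearMap.det_toLin, Matrix.det_mul, Matrix.det_diagonal, Matrix.det_transpose,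
      Module.Basis.det_apply]
  have hset : {x : EuclideanSpace ℝ (Fin n) | ∑ j, q j * |1 - ⟪x, v j⟫| ≤ R} =
      L ⁻¹' ((fun y ↦ y + -WithLp.toLp 2 q) ⁻¹' {y | ∑ j, |y j| ≤ R}) := by
    ext x
    have (j : Fin n) : q j * |1 - ⟪x, v j⟫| = |q j * ⟪x, v j⟫ + -q j| := by
      rw [← sub_eq_add_neg, ← mul_sub_one, abs_mul, abs_of_pos (hq j), abs_sub_comm]
    simp only [Set.mem_ofPred_eq, Set.mem_preimage, PiLp.add_apply, PiLp.neg_apply, hL, this]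
  rw [hset, Measure.addHaar_preimage_linearMap, measure_preimage_add_right, volume_sum_abs_le,
    hdet, ← ENNReal.ofReal_pow hR, ← ENNReal.ofReal_mul (by positivity),
    ← ENNReal.ofReal_mul (by positivity), abs_inv, abs_mul, abs_of_pos hprod]
  · congr 1
    rw [mul_pow]
    field_simp
  · rw [hdet]
    exact mul_ne_zero hprod.ne' (abs_pos.1 hv)

theorem le_volume_closedBall [NeZero n] :
    ENNReal.ofReal ((2 / √n) ^ n) ≤
      volume (Metric.closedBall (0 : EuclideanSpace ℝ (Fin n)) 1) := by
  have hn : (0 : ℝ) < n := Nat.cast_pos.2 (NeZero.pos n)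
  have hbox := (PiLp.volume_preserving_ofLp (Fin n)).measure_preimage
    (s := Set.Icc (fun _ ↦ -(1 / √n)) (fun _ ↦ 1 / √n)) measurableSet_Icc.nullMeasurableSet
  rw [Real.volume_Icc_pi] at hbox
  simp only [Finset.prod_const, Finset.card_univ, Fintype.card_fin] at hbox
  rw [← ENNReal.ofReal_pow (by rw [sub_neg_eq_add]; positivity)] at hbox
  rw [show (2 / √n : ℝ) = 1 / √n - -(1 / √n) by ring, ← hbox]
  apply measure_mono
  intro x hx
  rw [mem_closedBall_zero_iff, EuclideanSpace.norm_eq, Real.sqrt_le_one]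
  calc ∑ i, ‖x i‖ ^ 2 ≤ ∑ _i : Fin n, (1 / √n : ℝ) ^ 2 := by
        gcongr with i
        exact abs_le.2 ⟨hx.1 i, hx.2 i⟩
    _ = 1 := by
        simp [Real.sq_sqrt hn.le, hn.ne']

end Volume

section NormalizedBound

variable {n : ℕ}

theorem pow_self_le_three_pow_mul_factorial (n : ℕ) : (n : ℝ) ^ n ≤ 3 ^ n * n.factorial := by
  have h1 := Real.pow_div_factorial_le_exp (x := n) (Nat.cast_nonneg n) n
  have h2 : Real.exp n ≤ 3 ^ n := by
    rw [← mul_one (n : ℝ), Real.exp_nat_mul]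
    exact pow_le_pow_left₀ (Real.exp_nonneg _) Real.exp_one_lt_three.le n
  rw [div_le_iff₀ (by positivity)] at h1
  exact h1.trans (by gcongr)

theorem prod_one_sub_div [NeZero n] :
    ∏ j : Fin n, (1 - (j : ℕ) / n : ℝ) = n.factorial / (n : ℝ) ^ n := by
  have hn : (n : ℝ) ≠ 0 := Nat.cast_ne_zero.2 (NeZero.ne n)
  rw [Fin.prod_univ_eq_prod_range (fun j : ℕ ↦ (1 - j / n : ℝ)) n, ← Nat.descFactorial_self,
    Nat.descFactorial_eq_prod_range, Nat.cast_prod, eq_div_iff (pow_ne_zero n hn)]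
  have hpow : (n : ℝ) ^ n = ∏ _j ∈ Finset.range n, (n : ℝ) := by simp
  rw [hpow, ← Finset.prod_mul_distrib]
  refine Finset.prod_congr rfl fun j hj ↦ ?_
  rw [Nat.cast_sub (Finset.mem_range.1 hj).le]
  field_simp

theorem simplex_volume_numeric_bound [NeZero n] {p : ℝ} (hp : n.factorial / (2 * n : ℝ) ^ n ≤ p) :
    (2 * (9 * n * √n)) ^ n / (n.factorial * p) ≤ (162 * n : ℝ) ^ n * (2 / √n) ^ n := by
  have hn : (0 : ℝ) < n := Nat.cast_pos.2 (NeZero.pos n)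
  have hfac : (0 : ℝ) < n.factorial := by positivity
  have hs : (n : ℝ) = √n * √n := (Real.mul_self_sqrt hn.le).symm
  have hs0 : 0 < √(n : ℝ) := Real.sqrt_pos.2 hn
  calc (2 * (9 * n * √n)) ^ n / (n.factorial * p)
      ≤ (2 * (9 * n * √n)) ^ n / (n.factorial * (n.factorial / (2 * n : ℝ) ^ n)) := by gcongr
    _ = (36 * √n) ^ n * ((n : ℝ) ^ n) ^ 2 / (n.factorial : ℝ) ^ 2 := by
      field_simp
      simp only [← mul_pow]
      rw [← pow_mul, mul_comm n 2, pow_mul, ← mul_pow]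
      ring_nf
    _ ≤ (36 * √n) ^ n * (3 ^ n * n.factorial) ^ 2 / (n.factorial : ℝ) ^ 2 := by
      gcongr
      exact pow_self_le_three_pow_mul_factorial n
    _ = (324 * √n) ^ n := by
      rw [mul_pow (3 ^ n : ℝ), ← pow_mul, mul_comm n 2, pow_mul, ← mul_assoc, ← mul_pow]
      field_simp
      norm_num
      ring
    _ = (162 * n : ℝ) ^ n * (2 / √n) ^ n := by
      rw [← mul_pow]
      congr 1
      field_simp
      rw [Real.sq_sqrt hn.le]
      ring

theorem exists_finset_mem_convexHull {ι : Type*} {u : ι → EuclideanSpace ℝ (Fin n)}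
    {w : EuclideanSpace ℝ (Fin n)} (hw : w ∈ convexHull ℝ (Set.range u)) :
    ∃ T : Finset ι, T.card ≤ n + 1 ∧ w ∈ convexHull ℝ (u '' T) := by
  classical
  rw [convexHull_eq_union] at hw
  simp only [Set.mem_iUnion] at hw
  obtain ⟨t, ht, hind, hwt⟩ := hw
  obtain ⟨T, rfl, hT⟩ : ∃ T : Finset ι, T.image u = t ∧ T.card ≤ t.card := by
    choose g hg using fun e : t ↦ ht e.2
    refine ⟨Finset.univ.image g, ?_, Finset.card_image_le.trans (by simp)⟩
    ext e
    simp [hg]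
  refine ⟨T, hT.trans ?_, by rwa [Finset.coe_image] at hwt⟩
  have := hind.card_le_finrank_succ
  simp only [Fintype.card_coe] at this
  refine this.trans (Nat.succ_le_succ ((Submodule.finrank_le _).trans ?_))
  rw [finrank_euclideanSpace_fin]

/-- In John's position at most `2 n + 1` of the half-spaces already cut out a set of volume at most
`(162 n)ⁿ` times that of the unit ball. -/
theorem IsJohnPosition.exists_finset_volume_le [NeZero n] {ι : Type*} [Finite ι]
    {u : ι → EuclideanSpace ℝ (Fin n)} (hu : IsJohnPosition u) :
    ∃ T : Finset ι, T.card ≤ 2 * n + 1 ∧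
      volume {x : EuclideanSpace ℝ (Fin n) | ∀ i ∈ T, ⟪x, u i⟫ ≤ 1} ≤
        ENNReal.ofReal ((162 * n) ^ n) *
          volume (Metric.closedBall (0 : EuclideanSpace ℝ (Fin n)) 1) := by
  classical
  have hn : (0 : ℝ) < n := Nat.cast_pos.2 (NeZero.pos n)
  have hn1 : (1 : ℝ) ≤ n := Nat.one_le_cast.2 (NeZero.pos n)
  have hsq : √(n : ℝ) ^ 2 = n := Real.sq_sqrt hn.le
  have hs1 : 1 ≤ √(n : ℝ) := Real.one_le_sqrt.2 hn1
  have : Nonempty ι := by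
    obtain ⟨i, -⟩ := hu.exists_contact (M := 1) (by simpa using NeZero.pos n) 0
    exact ⟨i⟩
  obtain ⟨f, hf, hsum⟩ := hu.exists_greedy n finrank_euclideanSpace_fin.ge
  rw [finrank_euclideanSpace_fin] at hf hsum
  set r : ℕ → ℝ := fun j ↦ 1 - j / n with hr
  have hr0 (j : Fin n) : 0 < r j := by
    simp only [hr, sub_pos]
    rw [div_lt_one hn]
    exact_mod_cast j.2
  have hr1 (j : Fin n) : √(r j) ≤ 1 := by
    rw [Real.sqrt_le_one, sub_le_self_iff]
    positivity
  set s := ∑ j ∈ Finset.range n, √(r j) • u (f j) with hs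
  have hs4 : ‖s‖ ≤ 4 * √n := by
    refine (abs_le_of_sq_le_sq' ?_ (by positivity)).2
    rw [mul_pow, hsq]
    linarith
  have hwmem : -((8 * n * √n)⁻¹ • s) ∈ convexHull ℝ (Set.range u) := by
    apply hu.mem_convexHull
    rw [norm_neg, norm_smul, norm_inv, finrank_euclideanSpace_fin,
      Real.norm_of_nonneg (by positivity), inv_mul_eq_div, div_mul_eq_mul_div,
      div_lt_one (by positivity)]
    nlinarith [mul_le_mul_of_nonneg_right hs4 hn.le, mul_pos hn (zero_lt_one.trans_le hs1)]
  obtain ⟨T, hT, hwT⟩ := exists_finset_mem_convexHull hwmem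
  let v : Fin n → EuclideanSpace ℝ (Fin n) := fun j ↦ u (f j)
  have hsv : s = ∑ j : Fin n, √(r j) • v j := by
    rw [hs, ← Fin.sum_univ_eq_sum_range (fun j ↦ √(r j) • u (f j))]
  have hdet : ∏ j : Fin n, √(r j / 2) ≤ |(EuclideanSpace.basisFun (Fin n) ℝ).toBasis.det v| := by
    apply prod_le_abs_det_of_le_norm_starProjection
    · intro j
      exact Real.sqrt_pos.2 (half_pos (hr0 j))
    · intro j
      refine Real.sqrt_le_iff.2 ⟨norm_nonneg _, ?_⟩
      have himg : v '' Set.Iio j = (u ∘ f) '' Set.Iio (j : ℕ) := by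
        ext x
        constructor
        · rintro ⟨i, hi, rfl⟩
          exact ⟨i, hi, rfl⟩
        · rintro ⟨i, hi, rfl⟩
          exact ⟨⟨i, (Set.mem_Iio.1 hi).trans j.2⟩, hi, rfl⟩
      rw [himg]
      exact hf j j.2
  have hdet0 : 0 < |(EuclideanSpace.basisFun (Fin n) ℝ).toBasis.det v| :=
    (Finset.prod_pos fun j _ ↦ Real.sqrt_pos.2 (half_pos (hr0 j))).trans_le hdet
  refine ⟨Finset.univ.image (fun j : Fin n ↦ f j) ∪ T, ?_, ?_⟩
  · refine (Finset.card_union_le _ _).trans ?_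
    have := Finset.card_image_le (s := Finset.univ) (f := fun j : Fin n ↦ f j)
    rw [Finset.card_univ, Fintype.card_fin] at this
    omega
  have hsub : {x : EuclideanSpace ℝ (Fin n) |
      ∀ i ∈ Finset.univ.image (fun j : Fin n ↦ f j) ∪ T, ⟪x, u i⟫ ≤ 1} ⊆
      {x | ∑ j : Fin n, √(r j) * |1 - ⟪x, v j⟫| ≤ 9 * n * √n} := by
    intro x hx
    have hxv (j : Fin n) : ⟪x, v j⟫ ≤ 1 := hx _ (by simp)
    have hxw : ⟪x, -((8 * n * √n)⁻¹ • s)⟫ ≤ 1 := by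
      have hconv : Convex ℝ {y : EuclideanSpace ℝ (Fin n) | ⟪x, y⟫ ≤ 1} :=
        convex_halfSpace_le (innerSL ℝ x).toLinearMap.isLinear 1
      refine convexHull_min ?_ hconv hwT
      rintro _ ⟨i, hi, rfl⟩
      exact hx i (Finset.mem_union_right _ hi)
    have hxs : -⟪x, s⟫ ≤ 8 * n * √n := by
      rw [inner_neg_right, inner_smul_right, ← mul_neg, inv_mul_le_iff₀ (by positivity)] at hxw
      linarith
    have hsqrt : ∑ j : Fin n, √(r j) ≤ n := by
      simpa using Finset.sum_le_sum fun j (_ : j ∈ Finset.univ) ↦ hr1 j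
    calc ∑ j : Fin n, √(r j) * |1 - ⟪x, v j⟫| = ∑ j : Fin n, √(r j) - ⟪x, s⟫ := by
          rw [hsv, inner_sum, ← Finset.sum_sub_distrib]
          refine Finset.sum_congr rfl fun j _ ↦ ?_
          rw [abs_of_nonneg (sub_nonneg.2 (hxv j)), inner_smul_right]
          ring
      _ ≤ 9 * n * √n := by nlinarith
  refine (measure_mono hsub).trans ?_
  rw [volume_weighted_sum_abs_le (fun j ↦ Real.sqrt_pos.2 (hr0 j)) hdet0 (by positivity)]
  calc _ ≤ ENNReal.ofReal ((162 * n : ℝ) ^ n * (2 / √n) ^ n) := by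
        refine ENNReal.ofReal_le_ofReal (simplex_volume_numeric_bound ?_)
        calc (n.factorial / (2 * n : ℝ) ^ n) = ∏ j : Fin n, r j / 2 := by
              rw [Finset.prod_div_distrib, prod_one_sub_div, Finset.prod_const, Finset.card_univ,
                Fintype.card_fin, mul_pow, div_div, mul_comm]
          _ ≤ ∏ j : Fin n, √(r j) * √(r j / 2) := by
              refine Finset.prod_le_prod (fun j _ ↦ (half_pos (hr0 j)).le) fun j _ ↦ ?_
              rw [← Real.sqrt_mul (hr0 j).le]
              apply Real.le_sqrt_of_sq_le
              nlinarith [hr0 j]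
          _ ≤ _ := by
              rw [Finset.prod_mul_distrib]
              gcongr
    _ ≤ _ := by
        rw [ENNReal.ofReal_mul (by positivity)]
        gcongr
        exact le_volume_closedBall

end NormalizedBound

section Existence

open Metric

theorem Convex.isBounded_of_measure_ne_top {E : Type*} [NormedAddCommGroup E] [NormedSpace ℝ E]
    [MeasurableSpace E] [BorelSpace E] {μ : Measure E} [μ.IsOpenPosMeasure] {s : Set E}
    (hs : Convex ℝ s) (hint : (interior s).Nonempty) (hμ : μ s ≠ ⊤) [μ.IsAddLeftInvariant] :
    Bornology.IsBounded s := by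
  obtain ⟨p, hp⟩ := hint
  obtain ⟨r, hr, hball⟩ := Metric.isOpen_iff.1 isOpen_interior p hp
  replace hball : ball p r ⊆ s := hball.trans interior_subset
  have hm0 : 0 < μ (ball (0 : E) (r / 2)) := measure_ball_pos μ 0 (half_pos hr)
  obtain ⟨N, hN⟩ := ENNReal.exists_nat_mul_gt hm0.ne' hμ
  refine (Metric.isBounded_closedBall (x := p) (r := 2 * N * r + r)).subset fun x hx ↦ ?_
  by_contra hfar
  rw [mem_closedBall, dist_eq_norm, not_le] at hfar
  set d := ‖x - p‖
  have hd : 0 < d := lt_of_le_of_lt (by positivity) hfar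
  let q : ℕ → E := fun k ↦ p + (k * r / d) • (x - p)
  have hdist (j k : ℕ) : dist (q j) (q k) = |(j : ℝ) - k| * r := by
    rw [dist_eq_norm, show q j - q k = (((j : ℝ) - k) * r / d) • (x - p) by
      simp only [q]; module, norm_smul, Real.norm_eq_abs, abs_div, abs_mul, abs_of_pos hr,
      abs_of_pos hd, div_mul_cancel₀ _ hd.ne']
  have hsub : ⋃ k ∈ Finset.range N, ball (q k) (r / 2) ⊆ s := by
    refine Set.iUnion₂_subset fun k hk y hy ↦ ?_
    set t : ℝ := k * r / d
    have ht0 : 0 ≤ t := by positivity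
    have ht : t ≤ 1 / 2 := by
      rw [div_le_iff₀ hd]
      have : (k : ℝ) ≤ N := by exact_mod_cast (Finset.mem_range.1 hk).le
      nlinarith
    have hy' : p + (1 - t)⁻¹ • (y - q k) ∈ s := by
      apply hball
      rw [mem_ball, dist_eq_norm] at hy ⊢
      rw [add_sub_cancel_left, norm_smul, Real.norm_eq_abs, abs_of_pos (inv_pos.2 (by linarith)),
        inv_mul_lt_iff₀ (by linarith)]
      nlinarith
    have := hs hy' hx (by linarith : 0 ≤ 1 - t) ht0 (by ring)
    convert this using 1
    rw [smul_add, smul_smul, mul_inv_cancel₀ (by linarith : 1 - t ≠ 0)]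
    simp only [q]
    module
  have hdisj : (Finset.range N : Set ℕ).PairwiseDisjoint fun k ↦ ball (q k) (r / 2) := by
    intro j _ k _ hjk
    apply ball_disjoint_ball
    rw [hdist]
    have : (1 : ℝ) ≤ |(j : ℝ) - k| := by
      have h : (1 : ℤ) ≤ |(j : ℤ) - k| := Int.one_le_abs (sub_ne_zero.2 (by exact_mod_cast hjk))
      exact_mod_cast h
    nlinarith
  have hvol := measure_mono (μ := μ) hsub
  rw [measure_biUnion_finset hdisj fun _ _ ↦ measurableSet_ball] at hvol
  have hconst (k : ℕ) : μ (ball (q k) (r / 2)) = μ (ball 0 (r / 2)) := by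
    rw [← measure_preimage_add μ (q k) (ball (q k) (r / 2))]
    congr 1
    ext z
    simp
  simp only [hconst, Finset.sum_const, Finset.card_range, nsmul_eq_mul] at hvol
  exact hvol.not_gt hN

theorem Convex.interior_nonempty_of_measure_pos {E : Type*} [NormedAddCommGroup E]
    [NormedSpace ℝ E] [FiniteDimensional ℝ E] [MeasurableSpace E] [BorelSpace E] {μ : Measure E}
    [μ.IsAddHaarMeasure] {s : Set E} (hs : Convex ℝ s) (hμ : 0 < μ s) : (interior s).Nonempty := by
  by_contra h
  have hle := measure_mono (μ := μ) (subset_closure (s := s))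
  rw [← Set.sdiff_empty (s := closure s), ← Set.not_nonempty_iff_eq_empty.1 h] at hle
  exact (hμ.trans_le hle).ne' (hs.addHaar_frontier μ)

variable {E : Type*} [NormedAddCommGroup E] [InnerProductSpace ℝ E] {ι : Type*}

theorem convex_setOf_forall_inner_le_one (v : ι → E) : Convex ℝ {x : E | ∀ i, ⟪x, v i⟫ ≤ 1} := by
  rw [Set.ofPred_forall]
  exact convex_iInter fun i ↦ by
    simpa only [innerₛₗ_apply_apply, real_inner_comm] using
      convex_halfSpace_le (innerₛₗ ℝ (v i)).isLinear (1 : ℝ)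

variable [FiniteDimensional ℝ E]

theorem isCompact_setOf_norm_add_inner_le_one {v : ι → E}
    (hb : Bornology.IsBounded {x : E | ∀ i, ⟪x, v i⟫ ≤ 1}) :
    IsCompact {y : (E →L[ℝ] E) × E | ∀ i, ‖y.1 (v i)‖ + ⟪y.2, v i⟫ ≤ 1} := by
  have : ProperSpace ((E →L[ℝ] E) × E) := FiniteDimensional.proper ℝ _
  apply Metric.isCompact_of_isClosed_isBounded
  · rw [Set.ofPred_forall]
    exact isClosed_iInter fun i ↦ isClosed_le (by fun_prop) continuous_const
  · obtain ⟨R, hR⟩ := hb.subset_closedBall 0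
    refine (Metric.isBounded_closedBall (x := 0) (r := max (2 * R) R)).subset ?_
    rintro ⟨A, p⟩ h
    have hmem (y : E) (hy : ‖y‖ ≤ 1) : ‖p + A.adjoint y‖ ≤ R := by
      refine mem_closedBall_zero_iff.1 (hR fun i ↦ ?_)
      rw [inner_add_left, ContinuousLinearMap.adjoint_inner_left]
      have h1 := real_inner_le_norm y (A (v i))
      have h2 := h i
      simp only at h2
      nlinarith [norm_nonneg (A (v i))]
    have hp : ‖p‖ ≤ R := by simpa using hmem 0 (by simp)
    have hR0 : 0 ≤ R := (norm_nonneg p).trans hp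
    have hA : ‖A‖ ≤ 2 * R := by
      rw [← LinearIsometryEquiv.norm_map ContinuousLinearMap.adjoint A]
      refine ContinuousLinearMap.opNorm_le_of_unit_norm (by positivity) fun y hy ↦ ?_
      have := norm_sub_le (p + A.adjoint y) p
      rw [add_sub_cancel_left] at this
      linarith [hmem y hy.le]
    rw [mem_closedBall_zero_iff, Prod.norm_def]
    exact max_le_max hA hp

/-- Every bounded polytope with nonempty interior is an affine image of one in John position. -/
theorem exists_isJohnPosition {v : ι → E}
    (hb : Bornology.IsBounded {x : E | ∀ i, ⟪x, v i⟫ ≤ 1})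
    (hint : (interior {x : E | ∀ i, ⟪x, v i⟫ ≤ 1}).Nonempty) :
    ∃ (u : ι → E) (A : E →L[ℝ] E) (p : E), IsJohnPosition u ∧ A.det ≠ 0 ∧
      ∀ y i, ⟪p + A y, v i⟫ ≤ 1 ↔ ⟪y, u i⟫ ≤ 1 := by
  obtain ⟨x₀, hx₀⟩ := hint
  obtain ⟨r, hr, hball⟩ := Metric.nhds_basis_closedBall.mem_iff.1 (mem_interior_iff_mem_nhds.1 hx₀)
  have hmem : ((r • 1 : E →L[ℝ] E), x₀) ∈
      {y : (E →L[ℝ] E) × E | ∀ i, ‖y.1 (v i)‖ + ⟪y.2, v i⟫ ≤ 1} := by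
    intro i
    by_cases hv : v i = 0
    · simp [hv]
    have hv' : 0 < ‖v i‖ := norm_pos_iff.2 hv
    have h : x₀ + (r / ‖v i‖) • v i ∈ closedBall x₀ r := by
      rw [mem_closedBall, dist_eq_norm, add_sub_cancel_left, norm_smul, Real.norm_eq_abs,
        abs_of_pos (by positivity), div_mul_cancel₀ _ hv'.ne']
    have := hball h i
    rw [inner_add_left, inner_smul_left, real_inner_self_eq_norm_sq] at this
    simp only [smul_apply, one_apply_eq_self, norm_smul,
      Real.norm_eq_abs, abs_of_pos hr]
    have h2 : r / ‖v i‖ * ‖v i‖ ^ 2 = r * ‖v i‖ := by field_simp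
    simp only [conj_trivial, h2] at this
    linarith
  obtain ⟨⟨A, p⟩, hAp, hmax⟩ := (isCompact_setOf_norm_add_inner_le_one hb).exists_isMaxOn
    ⟨_, hmem⟩ (f := fun y ↦ y.1.det)
    (ContinuousLinearMap.continuous_det.comp continuous_fst).continuousOn
  have hdet : 0 < A.det := by
    refine lt_of_lt_of_le ?_ (hmax hmem)
    simp only [ContinuousLinearMap.det, ContinuousLinearMap.toLinearMap_smul, LinearMap.det_smul,
      ContinuousLinearMap.toLinearMap_one, map_one, mul_one]
    positivity
  have hunit := (LinearMap.isUnit_iff_isUnit_det (A : E →ₗ[ℝ] E)).2 hdet.ne'.isUnit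
  have hinj : Function.Injective A :=
    LinearMap.ker_eq_bot.1 ((LinearMap.isUnit_iff_ker_eq_bot _).1 hunit)
  have hpos (i : ι) : 0 < 1 - ⟪p, v i⟫ := by
    by_cases hv : v i = 0
    · simp [hv]
    have h1 : 0 < ‖A (v i)‖ := norm_pos_iff.2 ((map_ne_zero_iff A hinj).2 hv)
    have h2 := hAp i
    simp only at h2
    linarith
  refine ⟨fun i ↦ (1 - ⟪p, v i⟫)⁻¹ • A (v i), A.adjoint, p, ⟨fun i ↦ ?_, fun B z hB ↦ ?_⟩, ?_,
    fun y i ↦ ?_⟩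
  · rw [norm_smul, norm_inv, Real.norm_eq_abs, abs_of_pos (hpos i), inv_mul_le_iff₀ (hpos i)]
    have h2 := hAp i
    simp only at h2
    linarith
  · have h : (B.toContinuousLinearMap ∘L A, p + A.adjoint z) ∈
        {y : (E →L[ℝ] E) × E | ∀ i, ‖y.1 (v i)‖ + ⟪y.2, v i⟫ ≤ 1} := by
      intro i
      have h1 := hB i
      rw [map_smul, norm_smul, norm_inv, Real.norm_eq_abs, abs_of_pos (hpos i), inner_smul_right,
        ← mul_add, inv_mul_le_iff₀ (hpos i)] at h1
      simp only [ContinuousLinearMap.comp_apply, inner_add_left,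
        ContinuousLinearMap.adjoint_inner_left, LinearMap.coe_toContinuousLinearMap']
      linarith
    have h1 : LinearMap.det B * A.det ≤ A.det := by
      have := hmax h
      simpa [ContinuousLinearMap.det, LinearMap.det_comp] using this
    exact le_of_mul_le_mul_right (by simpa using h1) hdet
  · refine ((LinearMap.isUnit_iff_isUnit_det (A.adjoint : E →ₗ[ℝ] E)).1
      ((LinearMap.isUnit_iff_ker_eq_bot _).2 (LinearMap.ker_eq_bot'.2 fun y hy ↦ ?_))).ne_zero
    obtain ⟨x, rfl⟩ := LinearMap.range_eq_top.1 ((LinearMap.isUnit_iff_range_eq_top _).1 hunit) y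
    rw [← inner_self_eq_zero (𝕜 := ℝ)]
    have h := congrArg (inner ℝ · x) hy
    simpa only [ContinuousLinearMap.coe_coe, ContinuousLinearMap.adjoint_inner_left,
      inner_zero_left] using h
  · rw [inner_add_left, ContinuousLinearMap.adjoint_inner_left, inner_smul_right,
      inv_mul_le_iff₀ (hpos i)]
    constructor <;> intro h <;> linarith

end Existence

section FiniteReduction

/-- A closed convex family whose intersection lies in an open set with compact frontier has a
finite subfamily with the same property. -/
theorem exists_finset_iInter_subset {E ι : Type*} [NormedAddCommGroup E] [NormedSpace ℝ E]
    {s : ι → Set E} (hconv : ∀ i, Convex ℝ (s i)) (hclosed : ∀ i, IsClosed (s i))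
    {U : Set E} (hU : IsOpen U) (hfr : IsCompact (frontier U))
    (hne : (⋂ i, s i).Nonempty) (hsub : ⋂ i, s i ⊆ U) :
    ∃ F : Finset ι, ⋂ i ∈ F, s i ⊆ U := by
  obtain ⟨F, hF⟩ := hfr.elim_finite_subfamily_closed s hclosed <| by
    rw [← Set.disjoint_iff_inter_eq_empty, hU.frontier_eq]
    exact Set.disjoint_sdiff_left.mono_right hsub
  refine ⟨F, ?_⟩
  obtain ⟨x, hx⟩ := hne
  have hpre : IsPreconnected (⋂ i ∈ F, s i) :=
    (convex_iInter₂ fun i _ ↦ hconv i).isPreconnected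
  refine hpre.subset_left_of_subset_union hU isClosed_closure.isOpen_compl
    (disjoint_compl_right.mono_left subset_closure) (fun z hz ↦ ?_)
    ⟨x, Set.mem_iInter₂.2 fun i _ ↦ Set.mem_iInter.1 hx i, hsub hx⟩
  by_contra h
  rw [Set.mem_union, not_or, Set.notMem_compl_iff] at h
  have hmem : z ∈ frontier U ∩ ⋂ i ∈ F, s i := ⟨by rw [hU.frontier_eq]; exact ⟨h.2, h.1⟩, hz⟩
  rwa [hF] at hmem

end FiniteReduction

section MainBound

variable {n : ℕ}

theorem exists_finset_volume_le_of_finite [NeZero n] {ι : Type*} [Finite ι]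
    {v : ι → EuclideanSpace ℝ (Fin n)}
    (hb : Bornology.IsBounded {x | ∀ i, ⟪x, v i⟫ ≤ 1})
    (hint : (interior {x | ∀ i, ⟪x, v i⟫ ≤ 1}).Nonempty) :
    ∃ T : Finset ι, T.card ≤ 2 * n + 1 ∧
      volume {x | ∀ i ∈ T, ⟪x, v i⟫ ≤ 1} ≤
        ENNReal.ofReal ((162 * n) ^ n) * volume {x | ∀ i, ⟪x, v i⟫ ≤ 1} := by
  obtain ⟨u, A, p, hu, hdet, hiff⟩ := exists_isJohnPosition hb hint
  obtain ⟨T, hcard, hT⟩ := hu.exists_finset_volume_le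
  refine ⟨T, hcard, ?_⟩
  have hvol (s : Set (EuclideanSpace ℝ (Fin n))) :
      volume ((fun y ↦ p + A y) ⁻¹' s) = ENNReal.ofReal |A.det⁻¹| * volume s := by
    rw [show (fun y ↦ p + A y) ⁻¹' s = A ⁻¹' ((fun y ↦ p + y) ⁻¹' s) from rfl,
      ← measure_preimage_add volume p s]
    exact Measure.addHaar_preimage_linearMap volume hdet _
  have hball : Metric.closedBall 0 1 ⊆ (fun y ↦ p + A y) ⁻¹' {x | ∀ i, ⟪x, v i⟫ ≤ 1} := by
    intro y hy i
    rw [hiff]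
    refine (real_inner_le_norm _ _).trans (mul_le_one₀ ?_ (norm_nonneg _) (hu.norm_le_one i))
    simpa using hy
  have hc : ENNReal.ofReal |A.det⁻¹| ≠ 0 := by simpa using hdet
  rw [← ENNReal.mul_le_mul_iff_right hc ENNReal.ofReal_ne_top, mul_left_comm, ← hvol, ← hvol]
  have hTeq : (fun y ↦ p + A y) ⁻¹' {x | ∀ i ∈ T, ⟪x, v i⟫ ≤ 1} =
      {y | ∀ i ∈ T, ⟪y, u i⟫ ≤ 1} := by
    ext y
    simp [hiff]
  rw [hTeq]
  exact hT.trans (by gcongr)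

theorem exists_finset_volume_le [NeZero n] {ι : Type*} {v : ι → EuclideanSpace ℝ (Fin n)}
    (hpos : 0 < volume {x | ∀ i, ⟪x, v i⟫ ≤ 1}) :
    ∃ T : Finset ι, T.card ≤ 3 * n ∧
      volume {x | ∀ i ∈ T, ⟪x, v i⟫ ≤ 1} ≤
        ENNReal.ofReal ((324 * n) ^ n) * volume {x | ∀ i, ⟪x, v i⟫ ≤ 1} := by
  classical
  have hn : 1 ≤ n := NeZero.one_le
  set P := {x | ∀ i, ⟪x, v i⟫ ≤ 1} with hP
  by_cases htop : volume P = ⊤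
  · refine ⟨∅, by simp, ?_⟩
    rw [htop, ENNReal.mul_top]
    · exact le_top
    · rw [ne_eq, ENNReal.ofReal_eq_zero, not_le]
      positivity
  have hconv : Convex ℝ P := convex_setOf_forall_inner_le_one v
  obtain ⟨p, hp⟩ := hconv.interior_nonempty_of_measure_pos hpos
  have hbP := hconv.isBounded_of_measure_ne_top ⟨p, hp⟩ htop
  set D := AffineMap.homothety p (2 : ℝ) '' P
  have hbD : Bornology.IsBounded D := by
    obtain ⟨R, hR⟩ := hbP.subset_closedBall p
    refine (Metric.isBounded_closedBall (x := p) (r := 2 * R)).subset ?_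
    rintro _ ⟨x, hx, rfl⟩
    have := hR hx
    rw [Metric.mem_closedBall] at this ⊢
    rw [dist_homothety_center, dist_comm]
    norm_num [this]
  obtain ⟨F, hF⟩ := exists_finset_iInter_subset (s := fun i ↦ {x | ⟪x, v i⟫ ≤ 1})
    (U := interior D) (fun i ↦ by simpa using convex_setOf_forall_inner_le_one fun _ : Unit ↦ v i)
    (fun i ↦ isClosed_le (by fun_prop) continuous_const) isOpen_interior
    (Metric.isCompact_of_isClosed_isBounded isClosed_frontier
      ((hbD.subset interior_subset).closure.subset frontier_subset_closure))
    ⟨p, by simpa [hP] using interior_subset hp⟩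
    (by
      rw [← Set.ofPred_forall]
      exact hconv.subset_interior_image_homothety_of_one_lt hp 2 one_lt_two)
  have hF' : {x | ∀ i : F, ⟪x, v i⟫ ≤ 1} ⊆ D := by
    refine subset_trans (fun x hx ↦ ?_) (hF.trans interior_subset)
    simpa using hx
  have hPF : P ⊆ {x | ∀ i : F, ⟪x, v i⟫ ≤ 1} := fun x hx i ↦ hx i
  obtain ⟨T, hcard, hT⟩ := exists_finset_volume_le_of_finite (v := fun i : F ↦ v i)
    (hbD.subset hF') ⟨p, interior_mono hPF hp⟩
  refine ⟨T.map (Function.Embedding.subtype _), by rw [Finset.card_map]; omega, ?_⟩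
  calc volume {x | ∀ i ∈ T.map (Function.Embedding.subtype _), ⟪x, v i⟫ ≤ 1}
      = volume {x | ∀ i ∈ T, ⟪x, v i⟫ ≤ 1} := by
        congr 1
        ext x
        simp
    _ ≤ ENNReal.ofReal ((162 * n) ^ n) * volume D := hT.trans (by gcongr)
    _ = ENNReal.ofReal ((324 * n) ^ n) * volume P := by
        rw [Measure.addHaar_image_homothety, finrank_euclideanSpace_fin, ← mul_assoc,
          abs_of_pos (by positivity), ← ENNReal.ofReal_mul (by positivity), ← mul_pow]
        ring_nf

end MainBound

/-- There exist absolute constants `α > 1` and `C > 0` such that for every `n ≥ 1` and every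
family of half-spaces `Pᵢ = {x : ⟪x, vᵢ⟫ ≤ 1}` in `ℝⁿ` with `P = ⋂ᵢ Pᵢ` of positive volume,
there are `s ≤ α n` of them whose intersection has volume at most `(C n)ⁿ |P|`. -/
theorem quantitative_helly_linear :
    ∃ α C : ℝ, 1 < α ∧ 0 < C ∧
      ∀ (n : ℕ), 1 ≤ n →
      ∀ (I : Type) (v : I → EuclideanSpace ℝ (Fin n)),
        0 < volume (⋂ i, {x : EuclideanSpace ℝ (Fin n) | ⟪x, v i⟫ ≤ 1}) →
        ∃ (s : ℕ) (idx : Fin s → I), (s : ℝ) ≤ α * n ∧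
          volume (⋂ j, {x : EuclideanSpace ℝ (Fin n) | ⟪x, v (idx j)⟫ ≤ 1}) ≤
            ENNReal.ofReal ((C * n) ^ n) *
              volume (⋂ i, {x : EuclideanSpace ℝ (Fin n) | ⟪x, v i⟫ ≤ 1}) := by
  refine ⟨3, 324, by norm_num, by norm_num, fun n hn I v hpos ↦ ?_⟩
  have : NeZero n := ⟨by omega⟩
  rw [← Set.ofPred_forall] at hpos ⊢
  obtain ⟨T, hcard, hT⟩ := exists_finset_volume_le hpos
  refine ⟨T.card, fun j ↦ T.equivFin.symm j, by exact_mod_cast hcard, ?_⟩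
  convert hT using 2
  ext x
  simp only [Set.mem_iInter, Set.mem_ofPred_eq]
  rw [T.equivFin.symm.forall_congr_left]
  simp
end

section
/- Let γ > 1, let u_1, …, u_s be unit vectors in ℝⁿ and c_1, …, c_s > 0 satisfy I_n ⪯ A := Σ_{j=1}^s c_j u_j ⊗ u_j ⪯ γ I_n, and set κ_j = c_j ⟨A^{-1} u_j, u_j⟩ > 0 for 1 ≤ j ≤ s. Then for all integrable functions f_1, …, f_s : ℝ → [0,∞) one has ∫_{ℝⁿ} Π_{j=1}^s f_j^{κ_j}(⟨x, u_j⟩) dx ≤ γ^{n/2} Π_{j=1}^s (∫_ℝ f_j(t) dt)^{κ_j}. -/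
open MeasureTheory
open scoped Matrix

section Auxiliary

open ProbabilityTheory Filter Set Topology

section OneDim

lemma Monotone.lt_of_hasDerivAt_pos_left {F : ℝ → ℝ} (hF : Monotone F) {d t s : ℝ}
    (hd : HasDerivAt F d t) (h0 : 0 < d) (hts : t < s) : F t < F s := by
  have h := (hasDerivAt_iff_tendsto_slope.1 hd).eventually (lt_mem_nhds h0)
  have h2 : ∀ᶠ x in 𝓝[>] t, 0 < slope F t x :=
    h.filter_mono (nhdsWithin_mono _ fun x hx => ne_of_gt hx)
  obtain ⟨x, hx, hx2⟩ := (h2.and (Ioo_mem_nhdsGT hts)).exists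
  have : F t < F x := (slope_pos_iff_of_le hx2.1.le).1 hx
  exact this.trans_le (hF hx2.2.le)

lemma Monotone.lt_of_hasDerivAt_pos_right {F : ℝ → ℝ} (hF : Monotone F) {d t s : ℝ}
    (hd : HasDerivAt F d t) (h0 : 0 < d) (hts : s < t) : F s < F t := by
  have h := (hasDerivAt_iff_tendsto_slope.1 hd).eventually (lt_mem_nhds h0)
  have h2 : ∀ᶠ x in 𝓝[<] t, 0 < slope F t x :=
    h.filter_mono (nhdsWithin_mono _ fun x hx => ne_of_lt hx)
  obtain ⟨x, hx, hx2⟩ := (h2.and (Ioo_mem_nhdsLT hts)).exists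
  rw [slope_comm] at hx
  have : F x < F t := (slope_pos_iff_of_le hx2.2.le).1 hx
  exact (hF hx2.1.le).trans_lt this

lemma isProbabilityMeasure_withDensity_ofReal {g : ℝ → ℝ} (h0 : ∀ t, 0 ≤ g t)
    (hi : Integrable g) (h1 : ∫ t, g t = 1) :
    IsProbabilityMeasure (volume.withDensity fun t => ENNReal.ofReal (g t)) := by
  refine ⟨?_⟩
  rw [withDensity_apply _ MeasurableSet.univ, Measure.restrict_univ,
    ← ofReal_integral_eq_lintegral_ofReal hi (ae_of_all _ h0), h1, ENNReal.ofReal_one]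

lemma cdf_withDensity_ofReal {g : ℝ → ℝ} (h0 : ∀ t, 0 ≤ g t)
    (hi : Integrable g) (h1 : ∫ t, g t = 1) (t : ℝ) :
    cdf (volume.withDensity fun t => ENNReal.ofReal (g t)) t =
      cdf (volume.withDensity fun t => ENNReal.ofReal (g t)) 0 + ∫ x in (0 : ℝ)..t, g x := by
  have := isProbabilityMeasure_withDensity_ofReal h0 hi h1
  have key : ∀ t, cdf (volume.withDensity fun t => ENNReal.ofReal (g t)) t =
      ∫ x in Iic t, g x := by
    intro t
    rw [cdf_eq_real, measureReal_def, withDensity_apply _ measurableSet_Iic,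
      ← ofReal_integral_eq_lintegral_ofReal hi.integrableOn (ae_of_all _ h0),
      ENNReal.toReal_ofReal (integral_nonneg h0)]
  rw [key, key, ← intervalIntegral.integral_Iic_sub_Iic hi.integrableOn hi.integrableOn]
  ring

/-- The monotone transport of a probability density to the standard Gaussian, on a measurable
set carrying all of the mass. -/
lemma exists_gaussian_transport {g : ℝ → ℝ} (hm : Measurable g) (h0 : ∀ t, 0 ≤ g t)
    (hi : Integrable g) (h1 : ∫ t, g t = 1) :
    ∃ (E : Set ℝ) (T T' : ℝ → ℝ), MeasurableSet E ∧ StrictMonoOn T E ∧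
      (∀ t ∈ E, HasDerivAt T (T' t) t) ∧ (∀ t ∈ E, 0 < T' t) ∧
      (∀ t ∈ E, g t = T' t * gaussianPDFReal 0 1 (T t)) ∧ ∀ᵐ t, t ∉ E → g t = 0 := by
  have := isProbabilityMeasure_withDensity_ofReal h0 hi h1
  set F : ℝ → ℝ := ⇑(cdf (volume.withDensity fun t => ENNReal.ofReal (g t))) with hF
  have hFmono : Monotone F := monotone_cdf _
  have hFeq := cdf_withDensity_ofReal h0 hi h1
  rw [← hF] at hFeq
  have hφ0 := gaussianPDFReal_nonneg 0 1
  have hφpos : ∀ x, 0 < gaussianPDFReal 0 1 x := fun x => gaussianPDFReal_pos 0 1 x one_ne_zero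
  have hφi := integrable_gaussianPDFReal 0 1
  have hφ1 := integral_gaussianPDFReal_eq_one 0 (one_ne_zero (α := NNReal))
  have hφc : Continuous (gaussianPDFReal 0 1) := by unfold gaussianPDFReal; fun_prop
  have := isProbabilityMeasure_withDensity_ofReal hφ0 hφi hφ1
  set Φ : ℝ → ℝ :=
    ⇑(cdf (volume.withDensity fun t => ENNReal.ofReal (gaussianPDFReal 0 1 t))) with hΦ
  have hΦeq := cdf_withDensity_ofReal hφ0 hφi hφ1
  rw [← hΦ] at hΦeq
  have hΦd : ∀ t, HasStrictDerivAt Φ (gaussianPDFReal 0 1 t) t := by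
    intro t
    rw [funext hΦeq]
    exact (hφc.integral_hasStrictDerivAt 0 t).const_add _
  have hΦmono : StrictMono Φ := fun a b hab =>
    (monotone_cdf _).lt_of_hasDerivAt_pos_left (hΦd a).hasDerivAt (hφpos a) hab
  have hΦc : Continuous Φ := continuous_iff_continuousAt.2 fun t => (hΦd t).hasDerivAt.continuousAt
  have hΦsurj : ∀ y, 0 < y → y < 1 → ∃ a, Φ a = y := by
    intro y hy0 hy1
    obtain ⟨a, ha⟩ := ((tendsto_cdf_atBot
      (volume.withDensity fun t => ENNReal.ofReal (gaussianPDFReal 0 1 t))).eventually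
      (gt_mem_nhds hy0)).exists
    obtain ⟨b, hb⟩ := ((tendsto_cdf_atTop
      (volume.withDensity fun t => ENNReal.ofReal (gaussianPDFReal 0 1 t))).eventually
      (lt_mem_nhds hy1)).exists
    exact mem_range_of_exists_le_of_exists_ge hΦc ⟨a, ha.le⟩ ⟨b, hb.le⟩
  set q := Function.invFun Φ
  have hq : ∀ x, q (Φ x) = x := Function.leftInverse_invFun hΦmono.injective
  have hFd : ∀ᵐ t, HasDerivAt F (g t) t := by
    filter_upwards [LocallyIntegrable.ae_hasDerivAt_integral hi.locallyIntegrable] with t ht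
    rw [funext hFeq]
    exact (ht 0).const_add _
  set N := toMeasurable volume {t | ¬ HasDerivAt F (g t) t}
  have hN : volume N = 0 := by rw [measure_toMeasurable]; exact hFd
  have hNF : ∀ t, t ∉ N → HasDerivAt F (g t) t := fun t ht => by
    by_contra h
    exact ht (subset_toMeasurable _ _ h)
  have hFa : ∀ t, t ∉ N → 0 < g t → ∃ a, Φ a = F t := by
    intro t ht hg
    refine hΦsurj _ ?_ ?_
    · exact (cdf_nonneg _ (t - 1)).trans_lt
        (hFmono.lt_of_hasDerivAt_pos_right (hNF t ht) hg (by linarith))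
    · exact (hFmono.lt_of_hasDerivAt_pos_left (hNF t ht) hg (by linarith : t < t + 1)).trans_le
        (cdf_le_one _ _)
  refine ⟨{t | 0 < g t} \ N, fun t => q (F t),
    fun t => (gaussianPDFReal 0 1 (q (F t)))⁻¹ * g t,
    (measurableSet_lt measurable_const hm).diff (measurableSet_toMeasurable _ _), ?_, ?_, ?_, ?_, ?_⟩
  · rintro a ⟨ha, haN⟩ b ⟨hb, hbN⟩ hab
    obtain ⟨a', ha'⟩ := hFa a haN ha
    obtain ⟨b', hb'⟩ := hFa b hbN hb
    have := hFmono.lt_of_hasDerivAt_pos_left (hNF a haN) ha hab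
    simp only [← ha', ← hb', hq] at this ⊢
    exact hΦmono.lt_iff_lt.1 this
  · rintro a ⟨ha, haN⟩
    obtain ⟨a', ha'⟩ := hFa a haN ha
    have h := ((hΦd a').to_local_left_inverse (hφpos a').ne' (Eventually.of_forall hq)).hasDerivAt
    rw [ha'] at h
    have h2 := h.comp a (hNF a haN)
    have : q (F a) = a' := by rw [← ha', hq]
    simp only [this]
    exact h2
  · rintro a ⟨ha, -⟩
    exact mul_pos (inv_pos.2 (hφpos _)) ha
  · rintro a -
    field_simp [(hφpos (q (F a))).ne']
  · filter_upwards [measure_eq_zero_iff_ae_notMem.1 hN] with t ht hE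
    by_contra h
    exact hE ⟨lt_of_le_of_ne (h0 t) (Ne.symm h), ht⟩

end OneDim

section Algebra

lemma Matrix.isHermitian_sum_smul_vecMulVec {ι σ : Type*} [Fintype σ]
    (a : σ → ℝ) (v : σ → ι → ℝ) :
    (∑ j, a j • Matrix.vecMulVec (v j) (v j)).IsHermitian := by
  rw [Matrix.IsHermitian, Matrix.conjTranspose_sum]
  refine Finset.sum_congr rfl fun j _ => ?_
  rw [Matrix.conjTranspose_smul, Matrix.conjTranspose_vecMulVec]
  simp

variable {ι σ : Type*} [Fintype ι] [Fintype σ]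

lemma Matrix.sum_smul_vecMulVec_mulVec (a : σ → ℝ) (v : σ → ι → ℝ) (w : ι → ℝ) :
    (∑ j, a j • Matrix.vecMulVec (v j) (v j)) *ᵥ w = ∑ j, (a j * (v j ⬝ᵥ w)) • v j := by
  rw [Matrix.sum_mulVec]
  refine Finset.sum_congr rfl fun j _ => ?_
  rw [Matrix.smul_mulVec, Matrix.vecMulVec_mulVec, mul_smul]
  simp

lemma Matrix.dotProduct_sum_smul_vecMulVec_mulVec (a : σ → ℝ) (v : σ → ι → ℝ) (w : ι → ℝ) :
    w ⬝ᵥ (∑ j, a j • Matrix.vecMulVec (v j) (v j)) *ᵥ w = ∑ j, a j * (v j ⬝ᵥ w) ^ 2 := by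
  rw [Matrix.sum_smul_vecMulVec_mulVec, dotProduct_sum]
  refine Finset.sum_congr rfl fun j _ => ?_
  rw [dotProduct_smul, dotProduct_comm w, smul_eq_mul]
  ring

variable [DecidableEq ι]

/-- Ball's determinant inequality. -/
lemma Matrix.prod_rpow_le_det_sum_smul_vecMulVec {κ t : σ → ℝ} {v : σ → ι → ℝ}
    (hκ : ∀ j, 0 ≤ κ j) (ht : ∀ j, 0 < t j) (hv : ∀ j, v j ⬝ᵥ v j = 1)
    (hI : ∑ j, κ j • Matrix.vecMulVec (v j) (v j) = 1) :
    ∏ j, t j ^ κ j ≤ (∑ j, (κ j * t j) • Matrix.vecMulVec (v j) (v j)).det := by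
  have hM := Matrix.isHermitian_sum_smul_vecMulVec (fun j => κ j * t j) v
  set M := ∑ j, (κ j * t j) • Matrix.vecMulVec (v j) (v j) with hMdef
  set e : ι → ι → ℝ := fun i => (hM.eigenvectorBasis i).ofLp with he
  have hdot : ∀ x y : EuclideanSpace ℝ ι, inner ℝ x y = y.ofLp ⬝ᵥ x.ofLp := fun x y => by
    rw [EuclideanSpace.inner_eq_star_dotProduct]; simp
  have hee : ∀ i, e i ⬝ᵥ e i = 1 := by
    intro i
    rw [he]
    simp only
    rw [← hdot, real_inner_self_eq_norm_sq, hM.eigenvectorBasis.norm_eq_one]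
    norm_num
  have hsum : ∀ j, ∑ i, (v j ⬝ᵥ e i) ^ 2 = 1 := by
    intro j
    have := hM.eigenvectorBasis.sum_sq_norm_inner_right (WithLp.toLp 2 (v j))
    rw [← real_inner_self_eq_norm_sq, hdot, hv j] at this
    rw [← this]
    refine Finset.sum_congr rfl fun i _ => ?_
    rw [hdot, Real.norm_eq_abs, sq_abs]
  have hwt : ∀ i, ∑ j, κ j * (v j ⬝ᵥ e i) ^ 2 = 1 := by
    intro i
    rw [← Matrix.dotProduct_sum_smul_vecMulVec_mulVec, hI, Matrix.one_mulVec, hee]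
  have heig : ∀ i, hM.eigenvalues i = ∑ j, κ j * (v j ⬝ᵥ e i) ^ 2 * t j := by
    intro i
    have := hM.eigenvalues_eq i
    rw [this]
    simp only [star_trivial, RCLike.re_to_real]
    refine (Matrix.dotProduct_sum_smul_vecMulVec_mulVec _ v (e i)).trans ?_
    exact Finset.sum_congr rfl fun j _ => by ring
  rw [hM.det_eq_prod_eigenvalues]
  simp only [RCLike.ofReal_real_eq_id, id]
  calc ∏ j, t j ^ κ j = ∏ i, ∏ j, t j ^ (κ j * (v j ⬝ᵥ e i) ^ 2) := by
        rw [Finset.prod_comm]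
        refine Finset.prod_congr rfl fun j _ => ?_
        rw [← Real.rpow_sum_of_pos (ht j), ← Finset.mul_sum, hsum, mul_one]
    _ ≤ ∏ i, hM.eigenvalues i := by
        refine Finset.prod_le_prod
          (fun i _ => Finset.prod_nonneg fun j _ => Real.rpow_nonneg (ht j).le _) fun i _ => ?_
        rw [heig]
        exact Real.geom_mean_le_arith_mean_weighted _ _ _
          (fun j _ => mul_nonneg (hκ j) (sq_nonneg _)) (hwt i) fun j _ => (ht j).le

lemma sum_eq_card_of_sum_smul_vecMulVec_eq_one {κ : σ → ℝ} {v : σ → ι → ℝ}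
    (hv : ∀ j, v j ⬝ᵥ v j = 1) (hI : ∑ j, κ j • Matrix.vecMulVec (v j) (v j) = 1) :
    ∑ j, κ j = Fintype.card ι := by
  have := congrArg Matrix.trace hI
  simpa [Matrix.trace_sum, Matrix.trace_smul, Matrix.trace_vecMulVec, hv] using this

lemma dotProduct_self_sum_smul_le {κ : σ → ℝ} {v : σ → ι → ℝ} (hκ : ∀ j, 0 ≤ κ j)
    (hI : ∑ j, κ j • Matrix.vecMulVec (v j) (v j) = 1) (a : σ → ℝ) :
    (∑ j, (κ j * a j) • v j) ⬝ᵥ (∑ j, (κ j * a j) • v j) ≤ ∑ j, κ j * a j ^ 2 := by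
  set w := ∑ j, (κ j * a j) • v j with hw
  have h1 : w ⬝ᵥ w = ∑ j, κ j * (v j ⬝ᵥ w) ^ 2 := by
    rw [← Matrix.dotProduct_sum_smul_vecMulVec_mulVec, hI, Matrix.one_mulVec]
  have h2 : w ⬝ᵥ w = ∑ j, κ j * a j * (v j ⬝ᵥ w) := by
    nth_rewrite 1 [hw]
    rw [sum_dotProduct]
    exact Finset.sum_congr rfl fun j _ => by rw [smul_dotProduct, smul_eq_mul]
  have h3 : 0 ≤ ∑ j, κ j * (a j - v j ⬝ᵥ w) ^ 2 :=
    Finset.sum_nonneg fun j _ => mul_nonneg (hκ j) (sq_nonneg _)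
  have h4 : ∑ j, κ j * (a j - v j ⬝ᵥ w) ^ 2 = ∑ j, κ j * a j ^ 2
      - 2 * ∑ j, κ j * a j * (v j ⬝ᵥ w) + ∑ j, κ j * (v j ⬝ᵥ w) ^ 2 := by
    rw [Finset.mul_sum, ← Finset.sum_sub_distrib, ← Finset.sum_add_distrib]
    exact Finset.sum_congr rfl fun j _ => by ring
  linarith

end Algebra

section BrascampLieb

variable {ι σ : Type*} [Fintype ι] [Fintype σ]

lemma ae_dotProduct [DecidableEq ι] {u : ι → ℝ} (hu : u ≠ 0) {p : ℝ → Prop} (hp : ∀ᵐ t, p t) :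
    ∀ᵐ x : ι → ℝ, p (u ⬝ᵥ x) := by
  set N := toMeasurable (volume : Measure ℝ) {t | ¬ p t}
  have hN : volume N = 0 := by rw [measure_toMeasurable]; exact hp
  have hsurj : Function.Surjective (dotProductEquiv ℝ ι u) := by
    refine LinearMap.surjective ?_
    simpa using hu
  have := (ae_comp_linearMap_mem_iff (dotProductEquiv ℝ ι u) (volume : Measure (ι → ℝ))
    (volume : Measure ℝ) hsurj (measurableSet_toMeasurable volume {t | ¬ p t}).compl).2
    (measure_eq_zero_iff_ae_notMem.1 hN)
  filter_upwards [this] with x hx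
  by_contra h
  exact hx (subset_toMeasurable _ _ h)

lemma lintegral_prod_gaussianPDFReal :
    ∫⁻ x : ι → ℝ, ENNReal.ofReal (∏ i, gaussianPDFReal 0 1 (x i)) = 1 := by
  have hi : Integrable (fun x : ι → ℝ => ∏ i, gaussianPDFReal 0 1 (x i)) :=
    Integrable.fintype_prod fun _ => integrable_gaussianPDFReal 0 1
  rw [← ofReal_integral_eq_lintegral_ofReal hi
    (ae_of_all _ fun x => Finset.prod_nonneg fun i _ => gaussianPDFReal_nonneg 0 1 _),
    integral_fintype_prod_volume_eq_prod]
  simp [integral_gaussianPDFReal_eq_one 0 (one_ne_zero (α := NNReal))]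

variable [DecidableEq ι]

lemma prod_gaussianPDFReal_rpow_le {κ : σ → ℝ} {v : σ → ι → ℝ} (hκ : ∀ j, 0 ≤ κ j)
    (hv : ∀ j, v j ⬝ᵥ v j = 1)
    (hI : ∑ j, κ j • Matrix.vecMulVec (v j) (v j) = 1) (a : σ → ℝ) :
    ∏ j, gaussianPDFReal 0 1 (a j) ^ κ j ≤
      ∏ i, gaussianPDFReal 0 1 ((∑ j, (κ j * a j) • v j) i) := by
  have hC : 0 < (√(2 * Real.pi))⁻¹ := by positivity
  have hφ : ∀ x, gaussianPDFReal 0 1 x = (√(2 * Real.pi))⁻¹ * Real.exp (-(x ^ 2) / 2) := by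
    intro x; simp [gaussianPDFReal]
  simp only [hφ]
  rw [Finset.prod_mul_distrib, Finset.prod_const, ← Real.exp_sum]
  have h1 : ∀ j, ((√(2 * Real.pi))⁻¹ * Real.exp (-(a j ^ 2) / 2)) ^ κ j =
      (√(2 * Real.pi))⁻¹ ^ κ j * Real.exp (-(κ j * a j ^ 2) / 2) := by
    intro j
    rw [Real.mul_rpow hC.le (Real.exp_pos _).le, ← Real.exp_mul]
    ring_nf
  simp only [h1]
  rw [Finset.prod_mul_distrib, ← Real.exp_sum, ← Real.rpow_sum_of_pos hC,
    sum_eq_card_of_sum_smul_vecMulVec_eq_one hv hI, Real.rpow_natCast, Finset.card_univ]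
  refine mul_le_mul_of_nonneg_left (Real.exp_le_exp.2 ?_) (by positivity)
  have := dotProduct_self_sum_smul_le hκ hI a
  rw [← Finset.sum_div, ← Finset.sum_div, Finset.sum_neg_distrib, Finset.sum_neg_distrib]
  have h2 : ∀ w : ι → ℝ, w ⬝ᵥ w = ∑ i, w i ^ 2 := fun w => by
    simp [dotProduct, sq]
  rw [h2] at this
  linarith

/-- The geometric Brascamp–Lieb inequality for probability densities. -/
lemma lintegral_prod_rpow_dotProduct_le_one {κ : σ → ℝ} {v : σ → ι → ℝ} (hκ : ∀ j, 0 < κ j)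
    (hv : ∀ j, v j ⬝ᵥ v j = 1) (hI : ∑ j, κ j • Matrix.vecMulVec (v j) (v j) = 1)
    {g : σ → ℝ → ℝ} (hm : ∀ j, Measurable (g j)) (h0 : ∀ j t, 0 ≤ g j t)
    (hi : ∀ j, Integrable (g j)) (h1 : ∀ j, ∫ t, g j t = 1) :
    ∫⁻ x : ι → ℝ, ENNReal.ofReal (∏ j, g j (v j ⬝ᵥ x) ^ κ j) ≤ 1 := by
  choose E T T' hE hmono hder hpos hdens hae using
    fun j => exists_gaussian_transport (hm j) (h0 j) (hi j) (h1 j)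
  set S : Set (ι → ℝ) := ⋂ j, {x | v j ⬝ᵥ x ∈ E j} with hS
  have hSm : MeasurableSet S := MeasurableSet.iInter fun j =>
    (hE j).preimage (by unfold dotProduct; fun_prop)
  have hSE : ∀ x ∈ S, ∀ j, v j ⬝ᵥ x ∈ E j := fun x hx j => mem_iInter.1 hx j
  have hv0 : ∀ j, v j ≠ 0 := fun j h => by simpa [h] using hv j
  set Θ : (ι → ℝ) → ι → ℝ := fun x => ∑ j, (κ j * T j (v j ⬝ᵥ x)) • v j with hΘ
  set M : (ι → ℝ) → Matrix ι ι ℝ :=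
    fun x => ∑ j, (κ j * T' j (v j ⬝ᵥ x)) • Matrix.vecMulVec (v j) (v j) with hM
  have hΘd : ∀ x ∈ S, HasFDerivWithinAt Θ (Matrix.toLin' (M x)).toContinuousLinearMap S x := by
    intro x hx
    refine HasFDerivAt.hasFDerivWithinAt ?_
    have h : ∀ j, HasFDerivAt (fun x => (κ j * T j (v j ⬝ᵥ x)) • v j) _ x := fun j =>
      (((hder j _ (hSE x hx j)).comp_hasFDerivAt x
        (dotProductEquiv ℝ ι (v j)).toContinuousLinearMap.hasFDerivAt).const_mul (κ j)).smul_const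
          (v j)
    refine (HasFDerivAt.fun_sum fun j _ => h j).congr_fderiv ?_
    refine ContinuousLinearMap.ext fun w => ?_
    simp only [LinearMap.coe_toContinuousLinearMap', Matrix.toLin'_apply, hM,
      Matrix.sum_smul_vecMulVec_mulVec, _root_.sum_apply]
    refine Finset.sum_congr rfl fun j _ => ?_
    simp [mul_assoc]
  have hΘinj : InjOn Θ S := by
    intro x hx y hy hxy
    have hz : ∑ j, κ j * ((T j (v j ⬝ᵥ x) - T j (v j ⬝ᵥ y)) * (v j ⬝ᵥ x - v j ⬝ᵥ y)) = 0 := by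
      have : (Θ x - Θ y) ⬝ᵥ (x - y) = 0 := by rw [hxy, sub_self, zero_dotProduct]
      rw [← this, hΘ]
      simp only [← Finset.sum_sub_distrib, sum_dotProduct, ← sub_smul, smul_dotProduct,
        dotProduct_sub, smul_eq_mul]
      exact Finset.sum_congr rfl fun j _ => by ring
    have hnn : ∀ j, 0 ≤ κ j * ((T j (v j ⬝ᵥ x) - T j (v j ⬝ᵥ y)) * (v j ⬝ᵥ x - v j ⬝ᵥ y)) := by
      intro j
      refine mul_nonneg (hκ j).le ?_
      rcases le_total (v j ⬝ᵥ x) (v j ⬝ᵥ y) with h | h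
      · exact mul_nonneg_of_nonpos_of_nonpos
          (sub_nonpos.2 ((hmono j).monotoneOn (hSE x hx j) (hSE y hy j) h)) (sub_nonpos.2 h)
      · exact mul_nonneg
          (sub_nonneg.2 ((hmono j).monotoneOn (hSE y hy j) (hSE x hx j) h)) (sub_nonneg.2 h)
    have heq : ∀ j, v j ⬝ᵥ x = v j ⬝ᵥ y := by
      intro j
      have := (Finset.sum_eq_zero_iff_of_nonneg fun j _ => hnn j).1 hz j (Finset.mem_univ j)
      rcases mul_eq_zero.1 this with h | h
      · exact absurd h (hκ j).ne'
      rcases mul_eq_zero.1 h with h | h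
      · exact (hmono j).injOn (hSE x hx j) (hSE y hy j) (sub_eq_zero.1 h)
      · exact sub_eq_zero.1 h
    have hid : ∀ w : ι → ℝ, w = ∑ j, (κ j * (v j ⬝ᵥ w)) • v j := fun w => by
      rw [← Matrix.sum_smul_vecMulVec_mulVec, hI, Matrix.one_mulVec]
    rw [hid x, hid y]
    simp only [heq]
  have hzero : ∀ᵐ x : ι → ℝ, x ∉ S → ENNReal.ofReal (∏ j, g j (v j ⬝ᵥ x) ^ κ j) = 0 := by
    have := ae_all_iff.2 fun j => ae_dotProduct (hv0 j) (hae j)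
    filter_upwards [this] with x hx hxS
    simp only [hS, mem_iInter, not_forall] at hxS
    obtain ⟨j, hj⟩ := hxS
    rw [Finset.prod_eq_zero (Finset.mem_univ j), ENNReal.ofReal_zero]
    rw [hx j hj, Real.zero_rpow (hκ j).ne']
  have hpt : ∀ x ∈ S, ENNReal.ofReal (∏ j, g j (v j ⬝ᵥ x) ^ κ j) ≤
      ENNReal.ofReal |(Matrix.toLin' (M x)).toContinuousLinearMap.det| *
        ENNReal.ofReal (∏ i, gaussianPDFReal 0 1 (Θ x i)) := by
    intro x hx
    have hx' := hSE x hx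
    have hdet : (Matrix.toLin' (M x)).toContinuousLinearMap.det = (M x).det := by
      rw [ContinuousLinearMap.det, LinearMap.coe_toContinuousLinearMap, LinearMap.det_toLin']
    rw [hdet, ← ENNReal.ofReal_mul (abs_nonneg _)]
    refine ENNReal.ofReal_le_ofReal ?_
    have h2 : ∏ j, g j (v j ⬝ᵥ x) ^ κ j = (∏ j, T' j (v j ⬝ᵥ x) ^ κ j) *
        ∏ j, gaussianPDFReal 0 1 (T j (v j ⬝ᵥ x)) ^ κ j := by
      rw [← Finset.prod_mul_distrib]
      refine Finset.prod_congr rfl fun j _ => ?_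
      rw [hdens j _ (hx' j),
        Real.mul_rpow (hpos j _ (hx' j)).le (gaussianPDFReal_nonneg 0 1 _)]
    rw [h2]
    refine mul_le_mul ?_ (prod_gaussianPDFReal_rpow_le (fun j => (hκ j).le) hv hI _)
      (Finset.prod_nonneg fun j _ => Real.rpow_nonneg (gaussianPDFReal_nonneg 0 1 _) _)
      (abs_nonneg _)
    exact (Matrix.prod_rpow_le_det_sum_smul_vecMulVec (fun j => (hκ j).le)
      (fun j => hpos j _ (hx' j)) hv hI).trans (le_abs_self _)
  calc ∫⁻ x : ι → ℝ, ENNReal.ofReal (∏ j, g j (v j ⬝ᵥ x) ^ κ j)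
      = ∫⁻ x in S, ENNReal.ofReal (∏ j, g j (v j ⬝ᵥ x) ^ κ j) := by
        rw [← lintegral_indicator hSm]
        refine lintegral_congr_ae ?_
        filter_upwards [hzero] with x hx
        by_cases h : x ∈ S
        · rw [indicator_of_mem h]
        · rw [indicator_of_notMem h, hx h]
    _ ≤ ∫⁻ x in S, ENNReal.ofReal |(Matrix.toLin' (M x)).toContinuousLinearMap.det| *
        ENNReal.ofReal (∏ i, gaussianPDFReal 0 1 (Θ x i)) := setLIntegral_mono' hSm hpt
    _ = ∫⁻ y in Θ '' S, ENNReal.ofReal (∏ i, gaussianPDFReal 0 1 (y i)) :=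
        (lintegral_image_eq_lintegral_abs_det_fderiv_mul volume hSm hΘd hΘinj
          fun y => ENNReal.ofReal (∏ i, gaussianPDFReal 0 1 (y i))).symm
    _ ≤ ∫⁻ y : ι → ℝ, ENNReal.ofReal (∏ i, gaussianPDFReal 0 1 (y i)) :=
        setLIntegral_le_lintegral _ _
    _ = 1 := lintegral_prod_gaussianPDFReal

end BrascampLieb

section Rescaling

variable {ι σ : Type*} [Fintype ι] [Fintype σ] [DecidableEq ι]

lemma lintegral_prod_rpow_mul_dotProduct_le {κ : σ → ℝ} {v : σ → ι → ℝ} (hκ : ∀ j, 0 < κ j)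
    (hv : ∀ j, v j ⬝ᵥ v j = 1) (hI : ∑ j, κ j • Matrix.vecMulVec (v j) (v j) = 1)
    {r : σ → ℝ} (hr : ∀ j, 0 < r j)
    {h : σ → ℝ → ℝ} (hm : ∀ j, Measurable (h j)) (h0 : ∀ j t, 0 ≤ h j t)
    (hi : ∀ j, Integrable (h j)) (hpos : ∀ j, 0 < ∫ t, h j t) :
    ∫⁻ x : ι → ℝ, ENNReal.ofReal (∏ j, h j (r j * (v j ⬝ᵥ x)) ^ κ j) ≤
      ENNReal.ofReal (∏ j, ((∫ t, h j t) / r j) ^ κ j) := by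
  set F : σ → ℝ := fun j => ∫ t, h j t with hF
  have hFr : ∀ j, 0 < F j / r j := fun j => div_pos (hpos j) (hr j)
  have key := lintegral_prod_rpow_dotProduct_le_one hκ hv hI
    (g := fun j t => (F j / r j)⁻¹ * h j (r j * t))
    (fun j => ((hm j).comp (measurable_const_mul (r j))).const_mul _)
    (fun j t => mul_nonneg (inv_pos.2 (hFr j)).le (h0 j _))
    (fun j => ((hi j).comp_mul_left' (hr j).ne').const_mul _)
    (fun j => by
      rw [integral_const_mul, Measure.integral_comp_mul_left, abs_of_pos (inv_pos.2 (hr j)),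
        smul_eq_mul]
      have := (hpos j).ne'
      have := (hr j).ne'
      simp only [hF]
      field_simp)
  have heq : ∀ x : ι → ℝ, ENNReal.ofReal (∏ j, h j (r j * (v j ⬝ᵥ x)) ^ κ j) =
      ENNReal.ofReal (∏ j, (F j / r j) ^ κ j) *
        ENNReal.ofReal (∏ j, ((F j / r j)⁻¹ * h j (r j * (v j ⬝ᵥ x))) ^ κ j) := by
    intro x
    rw [← ENNReal.ofReal_mul (Finset.prod_nonneg fun j _ => Real.rpow_nonneg (hFr j).le _),
      ← Finset.prod_mul_distrib]
    congr 1
    refine Finset.prod_congr rfl fun j _ => ?_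
    rw [← Real.mul_rpow (hFr j).le (mul_nonneg (inv_pos.2 (hFr j)).le (h0 j _)),
      mul_inv_cancel_left₀ (hFr j).ne']
  simp only [heq]
  rw [lintegral_const_mul' _ _ ENNReal.ofReal_ne_top]
  exact mul_le_of_le_one_right' key

lemma Matrix.one_le_det_of_dotProduct_le {A : Matrix ι ι ℝ} (hH : A.IsHermitian)
    (hA : ∀ x : ι → ℝ, x ⬝ᵥ x ≤ x ⬝ᵥ A *ᵥ x) : 1 ≤ A.det := by
  rw [hH.det_eq_prod_eigenvalues]
  simp only [RCLike.ofReal_real_eq_id, id]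
  refine Finset.one_le_prod fun i _ => ?_
  rw [hH.eigenvalues_eq]
  simp only [star_trivial, RCLike.re_to_real]
  refine le_trans (le_of_eq ?_) (hA _)
  have h := hH.eigenvectorBasis.norm_eq_one i
  have h2 := real_inner_self_eq_norm_sq (hH.eigenvectorBasis i)
  rw [EuclideanSpace.inner_eq_star_dotProduct, h] at h2
  simpa using h2.symm

lemma Matrix.PosDef.exists_transpose_mul_self {A : Matrix ι ι ℝ} (hA : A.PosDef) :
    ∃ B : Matrix ι ι ℝ, A = Bᵀ * B := by
  open scoped MatrixOrder in
  obtain ⟨B, hB⟩ := CStarAlgebra.nonneg_iff_eq_star_mul_self.1 hA.posSemidef.nonneg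
  exact ⟨B, hB⟩

/-- A lower bound for the inverse quadratic form at a unit vector. -/
lemma Matrix.inv_le_inv_mulVec_dotProduct {A : Matrix ι ι ℝ} (hA : A.PosDef) {γ : ℝ} (hγ : 0 < γ)
    {u : ι → ℝ} (hu : u ⬝ᵥ u = 1) (hA2 : u ⬝ᵥ A *ᵥ u ≤ γ) : γ⁻¹ ≤ A⁻¹ *ᵥ u ⬝ᵥ u := by
  have hdet : IsUnit A.det := hA.det_pos.ne'.isUnit
  set w := A⁻¹ *ᵥ u with hw
  have hAw : A *ᵥ w = u := by rw [hw, Matrix.mulVec_mulVec, Matrix.mul_nonsing_inv _ hdet,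
    Matrix.one_mulVec]
  have hsymm : w ⬝ᵥ A *ᵥ u = 1 := by
    have hT : Aᵀ = A := hA.isHermitian
    rw [Matrix.dotProduct_mulVec, ← Matrix.mulVec_transpose, hT, hAw, hu]
  have h := hA.posSemidef.dotProduct_mulVec_nonneg (γ⁻¹ • u - w)
  simp only [star_trivial, Matrix.mulVec_sub, Matrix.mulVec_smul, sub_dotProduct, dotProduct_sub,
    smul_dotProduct, dotProduct_smul, hAw, hu, hsymm, smul_eq_mul] at h
  have h2 : γ⁻¹ * (γ⁻¹ * (u ⬝ᵥ A *ᵥ u)) ≤ γ⁻¹ * (γ⁻¹ * γ) := by gcongr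
  rw [inv_mul_cancel₀ hγ.ne'] at h2
  linarith

end Rescaling

end Auxiliary

/-- Brascamp–Lieb inequality for an approximate John decomposition: if unit vectors `uⱼ`
and weights `cⱼ > 0` satisfy `I_n ⪯ A := Σ cⱼ uⱼ ⊗ uⱼ ⪯ γ I_n` and
`κⱼ = cⱼ ⟨A⁻¹ uⱼ, uⱼ⟩`, then for all nonnegative integrable `fⱼ : ℝ → ℝ` one has
`∫_{ℝⁿ} Π fⱼ(⟨x,uⱼ⟩)^{κⱼ} dx ≤ γ^{n/2} Π (∫ fⱼ)^{κⱼ}`. -/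
theorem brascamp_lieb_approx_john (n s : ℕ) (γ : ℝ) (hγ : 1 < γ)
    (u : Fin s → Fin n → ℝ) (hu : ∀ j, u j ⬝ᵥ u j = 1)
    (c : Fin s → ℝ) (hc : ∀ j, 0 < c j)
    (A : Matrix (Fin n) (Fin n) ℝ)
    (hA : A = ∑ j, c j • Matrix.vecMulVec (u j) (u j))
    (hA1 : ∀ x : Fin n → ℝ, x ⬝ᵥ x ≤ x ⬝ᵥ A.mulVec x)
    (hA2 : ∀ x : Fin n → ℝ, x ⬝ᵥ A.mulVec x ≤ γ * (x ⬝ᵥ x))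
    (κ : Fin s → ℝ) (hκ : ∀ j, κ j = c j * (A⁻¹.mulVec (u j) ⬝ᵥ u j))
    (f : Fin s → ℝ → ℝ) (hf0 : ∀ j t, 0 ≤ f j t) (hf : ∀ j, Integrable (f j)) :
    (∫ x : Fin n → ℝ, ∏ j, f j (x ⬝ᵥ u j) ^ κ j) ≤
      γ ^ ((n : ℝ) / 2) * ∏ j, (∫ t : ℝ, f j t) ^ κ j := by
  have hγ0 : 0 < γ := one_pos.trans hγ
  have hH : A.IsHermitian := hA ▸ Matrix.isHermitian_sum_smul_vecMulVec c u
  have hPD : A.PosDef := by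
    refine Matrix.PosDef.of_dotProduct_mulVec_pos hH fun x hx => ?_
    rw [star_trivial]
    have h : 0 < x ⬝ᵥ star x := Matrix.dotProduct_self_star_pos_iff.2 hx
    rw [star_trivial] at h
    exact h.trans_le (hA1 x)
  have hu0 : ∀ j, u j ≠ 0 := fun j h => by simpa [h] using hu j
  have hq : ∀ j, γ⁻¹ ≤ A⁻¹ *ᵥ u j ⬝ᵥ u j := fun j =>
    Matrix.inv_le_inv_mulVec_dotProduct hPD hγ0 (hu j) (by simpa [hu j] using hA2 (u j))
  have hq0 : ∀ j, 0 < A⁻¹ *ᵥ u j ⬝ᵥ u j := fun j => (inv_pos.2 hγ0).trans_le (hq j)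
  have hκ0 : ∀ j, 0 < κ j := fun j => hκ j ▸ mul_pos (hc j) (hq0 j)
  have hF0 : ∀ j, 0 ≤ ∫ t, f j t := fun j => integral_nonneg (hf0 j)
  have hR0 : 0 ≤ γ ^ ((n : ℝ) / 2) * ∏ j, (∫ t : ℝ, f j t) ^ κ j :=
    mul_nonneg (Real.rpow_nonneg hγ0.le _)
      (Finset.prod_nonneg fun j _ => Real.rpow_nonneg (hF0 j) _)
  by_cases hF : ∃ j, ∫ t, f j t = 0
  · obtain ⟨j, hj⟩ := hF
    have hfj := (integral_eq_zero_iff_of_nonneg (hf0 j) (hf j)).1 hj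
    refine le_of_eq_of_le (integral_eq_zero_of_ae ?_) hR0
    filter_upwards [ae_dotProduct (hu0 j) hfj] with x hx
    refine Finset.prod_eq_zero (Finset.mem_univ j) ?_
    rw [dotProduct_comm, hx, Pi.zero_apply, Real.zero_rpow (hκ0 j).ne']
  have hFpos : ∀ j, 0 < ∫ t, f j t := fun j =>
    lt_of_le_of_ne (hF0 j) fun h => hF ⟨j, h.symm⟩
  -- measurable representatives
  set h : Fin s → ℝ → ℝ := fun j t => max ((hf j).aestronglyMeasurable.mk (f j) t) 0
  have hm : ∀ j, Measurable (h j) := fun j =>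
    (hf j).aestronglyMeasurable.stronglyMeasurable_mk.measurable.max measurable_const
  have hh0 : ∀ j t, 0 ≤ h j t := fun j t => le_max_right _ _
  have hfh : ∀ j, f j =ᵐ[volume] h j := by
    intro j
    filter_upwards [(hf j).aestronglyMeasurable.ae_eq_mk] with t ht
    simp only [h, ← ht, max_eq_left (hf0 j t)]
  have hhi : ∀ j, Integrable (h j) := fun j => (hf j).congr (hfh j)
  have hhF : ∀ j, ∫ t, h j t = ∫ t, f j t := fun j => integral_congr_ae (hfh j).symm
  -- reduction to a decomposition of the identity
  obtain ⟨B, hB⟩ := hPD.exists_transpose_mul_self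
  have hdetA : A.det = B.det ^ 2 := by rw [hB, Matrix.det_mul, Matrix.det_transpose, sq]
  have hdetA1 : 1 ≤ A.det := Matrix.one_le_det_of_dotProduct_le hH hA1
  have hBabs : 1 ≤ |B.det| := by
    rw [← one_le_sq_iff_one_le_abs, ← hdetA]
    exact hdetA1
  have hB0 : IsUnit B.det := (abs_pos.1 (one_pos.trans_le hBabs)).isUnit
  have hAinv : A⁻¹ = B⁻¹ * B⁻¹ᵀ := by
    rw [hB, Matrix.mul_inv_rev, Matrix.transpose_nonsing_inv]
  set r : Fin s → ℝ := fun j => √(A⁻¹ *ᵥ u j ⬝ᵥ u j) with hr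
  have hr0 : ∀ j, 0 < r j := fun j => Real.sqrt_pos.2 (hq0 j)
  have hrsq : ∀ j, r j * r j = A⁻¹ *ᵥ u j ⬝ᵥ u j := fun j => Real.mul_self_sqrt (hq0 j).le
  set w : Fin s → Fin n → ℝ := fun j => B⁻¹ᵀ *ᵥ u j with hw
  have hww : ∀ j, w j ⬝ᵥ w j = r j * r j := by
    intro j
    rw [hrsq, hAinv, ← Matrix.mulVec_mulVec, dotProduct_comm, dotProduct_comm _ (u j),
      Matrix.dotProduct_mulVec (u j), ← Matrix.mulVec_transpose]
  set v : Fin s → Fin n → ℝ := fun j => (r j)⁻¹ • w j with hvdef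
  have hv : ∀ j, v j ⬝ᵥ v j = 1 := by
    intro j
    simp only [hvdef, smul_dotProduct, dotProduct_smul, hww, smul_eq_mul]
    have := (hr0 j).ne'
    field_simp
  have hI : ∑ j, κ j • Matrix.vecMulVec (v j) (v j) = 1 := by
    have h1 : ∀ j, κ j • Matrix.vecMulVec (v j) (v j) =
        B⁻¹ᵀ * (c j • Matrix.vecMulVec (u j) (u j)) * B⁻¹ := by
      intro j
      have : Matrix.vecMulVec (w j) (w j) = B⁻¹ᵀ * Matrix.vecMulVec (u j) (u j) * B⁻¹ := by
        rw [Matrix.mul_vecMulVec, Matrix.vecMulVec_mul, ← Matrix.mulVec_transpose]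
      rw [Matrix.mul_smul, Matrix.smul_mul, ← this, hκ, ← hrsq]
      simp only [hvdef, Matrix.smul_vecMulVec, Matrix.vecMulVec_smul, smul_smul]
      congr 1
      have := (hr0 j).ne'
      field_simp
    simp only [h1]
    rw [← Matrix.sum_mul, ← Matrix.mul_sum, ← hA, hB, ← Matrix.mul_assoc, ← Matrix.transpose_mul,
      Matrix.mul_nonsing_inv _ hB0, Matrix.transpose_one, Matrix.one_mul,
      Matrix.mul_nonsing_inv _ hB0]
  have hdetC : B⁻¹.det ≠ 0 := (Matrix.isUnit_nonsing_inv_det _ hB0).ne_zero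
  have hmap := Real.map_matrix_volume_pi_eq_smul_volume_pi hdetC
  have hcomp : ∀ (x : Fin n → ℝ) (j : Fin s), B⁻¹ *ᵥ x ⬝ᵥ u j = r j * (v j ⬝ᵥ x) := by
    intro x j
    simp only [hvdef, hw, smul_dotProduct, smul_eq_mul]
    rw [mul_inv_cancel_left₀ (hr0 j).ne', dotProduct_comm, Matrix.dotProduct_mulVec,
      ← Matrix.mulVec_transpose]
  have hmeas : Measurable fun x : Fin n → ℝ => ENNReal.ofReal (∏ j, h j (x ⬝ᵥ u j) ^ κ j) := by
    refine ENNReal.measurable_ofReal.comp (Finset.measurable_prod _ fun j _ => ?_)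
    exact ((hm j).comp (by unfold dotProduct; fun_prop)).pow_const _
  have hle : ∫⁻ x : Fin n → ℝ, ENNReal.ofReal (∏ j, h j (x ⬝ᵥ u j) ^ κ j) ≤
      ENNReal.ofReal (∏ j, ((∫ t, f j t) / r j) ^ κ j) := by
    calc ∫⁻ x : Fin n → ℝ, ENNReal.ofReal (∏ j, h j (x ⬝ᵥ u j) ^ κ j)
        ≤ ENNReal.ofReal |B⁻¹.det⁻¹| *
          ∫⁻ x : Fin n → ℝ, ENNReal.ofReal (∏ j, h j (x ⬝ᵥ u j) ^ κ j) := by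
          refine le_mul_of_one_le_left' ?_
          rw [Matrix.det_nonsing_inv, Ring.inverse_eq_inv', inv_inv]
          exact ENNReal.one_le_ofReal.2 hBabs
      _ = ∫⁻ x : Fin n → ℝ, ENNReal.ofReal (∏ j, h j (r j * (v j ⬝ᵥ x)) ^ κ j) := by
          rw [← smul_eq_mul, ← lintegral_smul_measure, ← hmap, lintegral_map hmeas
            (LinearMap.continuous_of_finiteDimensional _).measurable]
          simp only [Matrix.toLin'_apply, hcomp]
      _ ≤ _ := by
          simpa only [hhF] using lintegral_prod_rpow_mul_dotProduct_le hκ0 hv hI hr0 hm hh0 hhi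
            fun j => (hhF j).symm ▸ hFpos j
  have hbound : ∏ j, ((∫ t, f j t) / r j) ^ κ j ≤
      γ ^ ((n : ℝ) / 2) * ∏ j, (∫ t : ℝ, f j t) ^ κ j := by
    have h1 : γ ^ ((n : ℝ) / 2) = ∏ j, √γ ^ κ j := by
      rw [← Real.rpow_sum_of_pos (Real.sqrt_pos.2 hγ0),
        sum_eq_card_of_sum_smul_vecMulVec_eq_one hv hI, Fintype.card_fin, Real.sqrt_eq_rpow,
        ← Real.rpow_mul hγ0.le]
      ring_nf
    rw [h1, ← Finset.prod_mul_distrib]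
    refine Finset.prod_le_prod
      (fun j _ => Real.rpow_nonneg (div_pos (hFpos j) (hr0 j)).le _) fun j _ => ?_
    rw [← Real.mul_rpow (Real.sqrt_nonneg _) (hF0 j)]
    refine Real.rpow_le_rpow (div_pos (hFpos j) (hr0 j)).le ?_ (hκ0 j).le
    rw [div_eq_inv_mul]
    refine mul_le_mul_of_nonneg_right ?_ (hF0 j)
    rw [hr]
    simp only
    rw [← Real.sqrt_inv]
    exact Real.sqrt_le_sqrt (inv_le_of_inv_le₀ hγ0 (hq j))
  have hae : ∀ᵐ x : Fin n → ℝ, ENNReal.ofReal ‖∏ j, f j (x ⬝ᵥ u j) ^ κ j‖ =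
      ENNReal.ofReal (∏ j, h j (x ⬝ᵥ u j) ^ κ j) := by
    filter_upwards [ae_all_iff.2 fun j => ae_dotProduct (hu0 j) (hfh j)] with x hx
    rw [Real.norm_of_nonneg (Finset.prod_nonneg fun j _ => Real.rpow_nonneg (hf0 j _) _)]
    simp only [dotProduct_comm x, hx]
  calc (∫ x : Fin n → ℝ, ∏ j, f j (x ⬝ᵥ u j) ^ κ j)
      ≤ ENNReal.toReal (∫⁻ x : Fin n → ℝ, ENNReal.ofReal ‖∏ j, f j (x ⬝ᵥ u j) ^ κ j‖) :=
        (Real.le_norm_self _).trans (norm_integral_le_lintegral_norm _)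
    _ = ENNReal.toReal (∫⁻ x : Fin n → ℝ, ENNReal.ofReal (∏ j, h j (x ⬝ᵥ u j) ^ κ j)) := by
        rw [lintegral_congr_ae hae]
    _ ≤ _ := ENNReal.toReal_le_of_le_ofReal hR0 (hle.trans (ENNReal.ofReal_le_ofReal hbound))
end

section
/- Let u_1, …, u_s be unit vectors in ℝⁿ and c_1, …, c_s > 0 be such that A := Σ_{j=1}^s c_j u_j ⊗ u_j is invertible, and set κ_j = c_j ⟨A^{-1} u_j, u_j⟩. Then for all λ_1, …, λ_s > 0 one has det(Σ_{j=1}^s c_j λ_j u_j ⊗ u_j) / det(A) ≥ Π_{j=1}^s λ_j^{κ_j}. -/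
open scoped Matrix

open scoped MatrixOrder Matrix.Norms.L2Operator in
/-- Simultaneous diagonalization: a congruence carrying a positive definite matrix to the identity
can be chosen to also diagonalize a given symmetric matrix. -/
theorem Matrix.PosDef.exists_congruence_one_diagonal {n : Type*} [Fintype n] [DecidableEq n]
    {A B : Matrix n n ℝ} (hA : A.PosDef) (hB : B.IsHermitian) :
    ∃ (S : Matrix n n ℝ) (d : n → ℝ), S * A * Sᵀ = 1 ∧ S * B * Sᵀ = Matrix.diagonal d := by
  obtain ⟨R, hR, rfl⟩ : ∃ R : Matrix n n ℝ, IsUnit R ∧ A = Rᵀ * R := by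
    exact CStarAlgebra.isStrictlyPositive_iff_eq_star_mul_self.mp hA.isStrictlyPositive
  have hdet : IsUnit R.det := (Matrix.isUnit_iff_isUnit_det R).1 hR
  have hdet' : IsUnit Rᵀ.det := by rwa [Matrix.det_transpose]
  have hM : (R⁻¹ᵀ * B * R⁻¹).IsHermitian :=
    Matrix.isHermitian_conjTranspose_mul_mul R⁻¹ hB
  set U : Matrix n n ℝ := (hM.eigenvectorUnitary).1
  have hUU : Uᵀ * U = 1 := Unitary.coe_star_mul_self hM.eigenvectorUnitary
  have hdiag : Uᵀ * (R⁻¹ᵀ * B * R⁻¹) * U = Matrix.diagonal hM.eigenvalues := by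
    have h := hM.conjStarAlgAut_star_eigenvectorUnitary
    rw [Unitary.conjStarAlgAut_star_apply] at h
    exact h
  refine ⟨Uᵀ * R⁻¹ᵀ, hM.eigenvalues, ?_, ?_⟩
  · calc Uᵀ * R⁻¹ᵀ * (Rᵀ * R) * (Uᵀ * R⁻¹ᵀ)ᵀ
        = Uᵀ * ((R * R⁻¹)ᵀ * (R * R⁻¹)) * U := by
          simp only [Matrix.transpose_mul, Matrix.transpose_transpose, Matrix.mul_assoc]
      _ = 1 := by simp [Matrix.mul_nonsing_inv _ hdet, hUU]
  · rw [← hdiag]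
    simp only [Matrix.transpose_mul, Matrix.transpose_transpose, Matrix.mul_assoc]

/-- Congruence acts on a weighted sum of rank-one matrices by moving the vectors. -/
theorem Matrix.mul_sum_smul_vecMulVec_mul_transpose {ι m n R : Type*} [Fintype ι] [Fintype n]
    [CommSemiring R] (S : Matrix m n R) (a : ι → R) (u : ι → n → R) :
    S * (∑ j, a j • Matrix.vecMulVec (u j) (u j)) * Sᵀ =
      ∑ j, a j • Matrix.vecMulVec (S *ᵥ u j) (S *ᵥ u j) := by
  simp [Matrix.mul_sum, Matrix.sum_mul, Matrix.mul_vecMulVec, Matrix.vecMulVec_mul,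
    Matrix.vecMul_transpose]

/-- A sum of rank-one matrices `u ⊗ u` with nonnegative weights is positive semidefinite. -/
theorem Matrix.posSemidef_sum_smul_vecMulVec_self {ι n : Type*} [Fintype ι] [Fintype n]
    {a : ι → ℝ} (ha : ∀ j, 0 ≤ a j) (u : ι → n → ℝ) :
    (∑ j, a j • Matrix.vecMulVec (u j) (u j)).PosSemidef :=
  Matrix.posSemidef_sum _ fun j _ => (Matrix.posSemidef_vecMulVec_self_star (u j)).smul (ha j)

/-- If unit vectors `uⱼ` and weights `cⱼ > 0` are such that `A := Σ cⱼ uⱼ ⊗ uⱼ` is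
invertible and `κⱼ = cⱼ ⟨A⁻¹ uⱼ, uⱼ⟩`, then for all `λⱼ > 0` one has
`det(Σ cⱼ λⱼ uⱼ ⊗ uⱼ) / det(A) ≥ Π λⱼ^{κⱼ}`. -/
theorem det_ratio_lower_bound (n s : ℕ)
    (u : Fin s → Fin n → ℝ) (hu : ∀ j, u j ⬝ᵥ u j = 1)
    (c : Fin s → ℝ) (hc : ∀ j, 0 < c j)
    (A : Matrix (Fin n) (Fin n) ℝ)
    (hA : A = ∑ j, c j • Matrix.vecMulVec (u j) (u j))
    (hAinv : IsUnit A.det)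
    (κ : Fin s → ℝ) (hκ : ∀ j, κ j = c j * (A⁻¹.mulVec (u j) ⬝ᵥ u j))
    (lam : Fin s → ℝ) (hlam : ∀ j, 0 < lam j) :
    ∏ j, lam j ^ κ j ≤
      (∑ j, (c j * lam j) • Matrix.vecMulVec (u j) (u j)).det / A.det := by
  have hApos : A.PosDef := by
    have h : A.PosSemidef :=
      hA ▸ Matrix.posSemidef_sum_smul_vecMulVec_self (fun j => (hc j).le) u
    exact h.posDef_iff_det_ne_zero.2 hAinv.ne_zero
  set B := ∑ j, (c j * lam j) • Matrix.vecMulVec (u j) (u j) with hB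
  have hBherm : B.IsHermitian :=
    (Matrix.posSemidef_sum_smul_vecMulVec_self
      (fun j => (mul_pos (hc j) (hlam j)).le) u).isHermitian
  obtain ⟨S, d, hSA, hSB⟩ := hApos.exists_congruence_one_diagonal hBherm
  have hAS : A⁻¹ = Sᵀ * S := by
    apply Matrix.inv_eq_left_inv
    rw [Matrix.mul_assoc]
    exact mul_eq_one_comm.1 hSA
  have hdet : B.det / A.det = ∏ i, d i := by
    have h1 := congrArg Matrix.det hSA
    have h2 := congrArg Matrix.det hSB
    simp only [Matrix.det_mul, Matrix.det_transpose, Matrix.det_one, Matrix.det_diagonal] at h1 h2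
    rw [← h2, div_eq_iff hAinv.ne_zero]
    linear_combination -B.det * h1
  have hκS : ∀ j, κ j = ∑ i, c j * (S *ᵥ u j) i ^ 2 := fun j => by
    rw [hκ, hAS, ← Matrix.mulVec_mulVec, Matrix.mulVec_transpose, ← Matrix.dotProduct_mulVec,
      dotProduct, Finset.mul_sum]
    simp only [sq]
  have hweights : ∀ i, ∑ j, c j * (S *ᵥ u j) i ^ 2 = 1 := fun i => by
    rw [hA, Matrix.mul_sum_smul_vecMulVec_mul_transpose] at hSA
    simpa [Matrix.sum_apply, Matrix.vecMulVec_apply, sq] using congrFun₂ hSA i i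
  have hd : ∀ i, ∑ j, c j * (S *ᵥ u j) i ^ 2 * lam j = d i := fun i => by
    rw [hB, Matrix.mul_sum_smul_vecMulVec_mul_transpose] at hSB
    simpa [Matrix.sum_apply, Matrix.vecMulVec_apply, sq, mul_right_comm] using congrFun₂ hSB i i
  calc ∏ j, lam j ^ κ j = ∏ i, ∏ j, lam j ^ (c j * (S *ᵥ u j) i ^ 2) := by
        rw [Finset.prod_comm]
        exact Finset.prod_congr rfl fun j _ => by
          rw [hκS, Real.rpow_sum_of_pos (hlam j)]
    _ ≤ ∏ i, d i := by
        refine Finset.prod_le_prod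
          (fun i _ => Finset.prod_nonneg fun j _ => Real.rpow_nonneg (hlam j).le _) fun i _ => ?_
        rw [← hd i]
        exact Real.geom_mean_le_arith_mean_weighted _ _ _
          (fun j _ => mul_nonneg (hc j).le (sq_nonneg _)) (hweights i) fun j _ => (hlam j).le
    _ = B.det / A.det := hdet.symm
end

section
/- (Batson–Spielman–Srivastava) Let v_1, …, v_m be unit vectors in ℝⁿ and a_1, …, a_m > 0 satisfy I_n = Σ_{j=1}^m a_j v_j ⊗ v_j. Then for every d > 1 there exists a subset σ ⊆ {1, …, m} with |σ| ≤ dn and scalars b_j > 0 for j ∈ σ such that I_n ⪯ Σ_{j∈σ} b_j a_j v_j ⊗ v_j ⪯ γ_d I_n, where γ_d := ((√d + 1)/(√d − 1))². -/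
open scoped Matrix

namespace BarrierPotential

open Finset Matrix

section Scalar

variable {ι κ : Type*} [Fintype ι] [Fintype κ]

/-- The upper barrier can be shifted by `δ` at an average cost of at most `1 / δ + ∑ 1 / p`. -/
theorem upper_shift_cost_le [Nonempty ι] {p : ι → ℝ} (hp : ∀ i, 0 < p i) {δ : ℝ} (hδ : 0 < δ) :
    0 < ∑ i, (p i)⁻¹ - ∑ i, (p i + δ)⁻¹ ∧
      (∑ i, ((p i + δ)⁻¹) ^ 2) / (∑ i, (p i)⁻¹ - ∑ i, (p i + δ)⁻¹) + ∑ i, (p i + δ)⁻¹ ≤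
        1 / δ + ∑ i, (p i)⁻¹ := by
  have key : δ * ∑ i, ((p i + δ)⁻¹) ^ 2 ≤ ∑ i, (p i)⁻¹ - ∑ i, (p i + δ)⁻¹ := by
    rw [mul_sum, ← sum_sub_distrib]
    refine sum_le_sum fun i _ ↦ ?_
    have h := hp i
    have h' : 0 < p i + δ := by positivity
    have : (p i)⁻¹ - (p i + δ)⁻¹ = δ * ((p i)⁻¹ * (p i + δ)⁻¹) := by field_simp; ring
    rw [this, sq]
    gcongr
    linarith
  have hpos : 0 < ∑ i, ((p i + δ)⁻¹) ^ 2 := by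
    refine sum_pos (fun i _ ↦ ?_) univ_nonempty
    have := hp i
    positivity
  have hD : 0 < ∑ i, (p i)⁻¹ - ∑ i, (p i + δ)⁻¹ := lt_of_lt_of_le (by positivity) key
  refine ⟨hD, add_le_add ?_ (by linarith)⟩
  rw [div_le_div_iff₀ hD hδ]
  linarith

/-- The lower barrier can be shifted by `δ` with an average gain of at least `1 / δ - ∑ 1 / q`. -/
theorem le_lower_shift_gain [Nonempty ι] {q : ι → ℝ} {δ : ℝ} (hδ : 0 < δ) (hq : ∀ i, δ < q i)
    (hsum : δ * ∑ i, (q i)⁻¹ ≤ 1) :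
    0 < ∑ i, (q i - δ)⁻¹ - ∑ i, (q i)⁻¹ ∧
      1 / δ - ∑ i, (q i)⁻¹ ≤
        (∑ i, ((q i - δ)⁻¹) ^ 2) / (∑ i, (q i - δ)⁻¹ - ∑ i, (q i)⁻¹) - ∑ i, (q i - δ)⁻¹ := by
  have hx : ∀ i, 0 < (q i - δ)⁻¹ := fun i ↦ inv_pos.2 (sub_pos.2 (hq i))
  have hy : ∀ i, 0 < (q i)⁻¹ := fun i ↦ inv_pos.2 (hδ.trans (hq i))
  have hxy : ∀ i, (q i - δ)⁻¹ - (q i)⁻¹ = δ * ((q i - δ)⁻¹ * (q i)⁻¹) := fun i ↦ by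
    have h1 : q i - δ ≠ 0 := (sub_pos.2 (hq i)).ne'
    have h2 : q i ≠ 0 := (hδ.trans (hq i)).ne'
    field_simp
    ring
  generalize hxd : (fun i ↦ (q i - δ)⁻¹) = x at *
  generalize hyd : (fun i ↦ (q i)⁻¹) = y at *
  have ex : ∀ i, (q i - δ)⁻¹ = x i := fun i ↦ congrFun hxd i
  have ey : ∀ i, (q i)⁻¹ = y i := fun i ↦ congrFun hyd i
  simp only [ex, ey] at *
  have h1 : ∑ i, x i - ∑ i, y i = δ * ∑ i, x i * y i := by
    rw [mul_sum, ← sum_sub_distrib]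
    exact sum_congr rfl fun i _ ↦ hxy i
  have hX : 0 < ∑ i, x i * y i := sum_pos (fun i _ ↦ mul_pos (hx i) (hy i)) univ_nonempty
  have h2 : ∑ i, x i ^ 2 - ∑ i, x i * y i = δ * ∑ i, x i ^ 2 * y i := by
    rw [mul_sum, ← sum_sub_distrib]
    refine sum_congr rfl fun i _ ↦ ?_
    linear_combination x i * hxy i
  have h3 : (∑ i, x i * y i) ^ 2 ≤ (∑ i, x i ^ 2 * y i) * ∑ i, y i := by
    refine sum_sq_le_sum_mul_sum_of_sq_le_mul _ (fun i _ ↦ ?_) (fun i _ ↦ (hy i).le)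
      fun i _ ↦ le_of_eq (by ring)
    exact mul_nonneg (sq_nonneg _) (hy i).le
  have h4 : 0 ≤ ∑ i, x i ^ 2 * y i := sum_nonneg fun i _ ↦ mul_nonneg (sq_nonneg _) (hy i).le
  have h5 : δ ^ 2 * (∑ i, x i * y i) ^ 2 ≤ δ * ∑ i, x i ^ 2 * y i := by
    calc _ ≤ δ ^ 2 * ((∑ i, x i ^ 2 * y i) * ∑ i, y i) := by gcongr
      _ = δ * (∑ i, x i ^ 2 * y i) * (δ * ∑ i, y i) := by ring
      _ ≤ δ * (∑ i, x i ^ 2 * y i) * 1 := by gcongr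
      _ = _ := mul_one _
  refine ⟨by rw [h1]; positivity, ?_⟩
  have h6 : 1 / δ + (∑ i, x i - ∑ i, y i) ≤ (∑ i, x i ^ 2) / (∑ i, x i - ∑ i, y i) := by
    rw [h1, le_div_iff₀ (by positivity)]
    have : (1 / δ + δ * ∑ i, x i * y i) * (δ * ∑ i, x i * y i) =
        ∑ i, x i * y i + δ ^ 2 * (∑ i, x i * y i) ^ 2 := by field_simp
    rw [this]
    linarith
  linarith

theorem sum_sum_mul_eq {c : κ → ι → ℝ} (hc : ∀ i, ∑ j, c j i = 1) (f : ι → ℝ) :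
    ∑ j, ∑ i, c j i * f i = ∑ i, f i := by
  rw [sum_comm]
  exact sum_congr rfl fun i _ ↦ by rw [← sum_mul, hc, one_mul]

/-- Some rank-one update keeps both barrier potentials, written in an eigenbasis, from growing. -/
theorem exists_scalar_update [Nonempty ι] [Nonempty κ] {p q : ι → ℝ} {δ η : ℝ}
    (hp : ∀ i, 0 < p i) (hδ : 0 < δ) (hη : 0 < η) (hq : ∀ i, η < q i)
    (hsum : η * ∑ i, (q i)⁻¹ ≤ 1)
    (hbal : 1 / δ + ∑ i, (p i)⁻¹ ≤ 1 / η - ∑ i, (q i)⁻¹)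
    {c : κ → ι → ℝ} (hc0 : ∀ j i, 0 ≤ c j i) (hcpos : ∀ j, ∃ i, 0 < c j i)
    (hc : ∀ i, ∑ j, c j i = 1) :
    ∃ j, ∃ t, 0 < t ∧ t * ∑ i, c j i * (p i + δ)⁻¹ < 1 ∧
      ∑ i, (p i + δ)⁻¹ + t * (∑ i, c j i * ((p i + δ)⁻¹) ^ 2) /
        (1 - t * ∑ i, c j i * (p i + δ)⁻¹) ≤ ∑ i, (p i)⁻¹ ∧
      ∑ i, (q i - η)⁻¹ - t * (∑ i, c j i * ((q i - η)⁻¹) ^ 2) /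
        (1 + t * ∑ i, c j i * (q i - η)⁻¹) ≤ ∑ i, (q i)⁻¹ := by
  obtain ⟨hD, hU⟩ := upper_shift_cost_le hp hδ
  obtain ⟨hE, hL⟩ := le_lower_shift_gain hη hq hsum
  set D := ∑ i, (p i)⁻¹ - ∑ i, (p i + δ)⁻¹ with hDdef
  set E := ∑ i, (q i - η)⁻¹ - ∑ i, (q i)⁻¹ with hEdef
  have hsumle : ∑ j, ((∑ i, c j i * ((p i + δ)⁻¹) ^ 2) / D + ∑ i, c j i * (p i + δ)⁻¹) ≤
      ∑ j, ((∑ i, c j i * ((q i - η)⁻¹) ^ 2) / E - ∑ i, c j i * (q i - η)⁻¹) := by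
    rw [sum_add_distrib, sum_sub_distrib, ← sum_div, ← sum_div]
    simp only [sum_sum_mul_eq hc]
    linarith
  obtain ⟨j, -, hj⟩ := exists_le_of_sum_le univ_nonempty hsumle
  have hp' : ∀ i, 0 < (p i + δ)⁻¹ := fun i ↦ inv_pos.2 (add_pos (hp i) hδ)
  have hq' : ∀ i, 0 < (q i - η)⁻¹ := fun i ↦ inv_pos.2 (sub_pos.2 (hq i))
  obtain ⟨i₀, hi₀⟩ := hcpos j
  have hA2 : 0 < ∑ i, c j i * ((p i + δ)⁻¹) ^ 2 :=
    sum_pos' (fun i _ ↦ mul_nonneg (hc0 j i) (sq_nonneg _))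
      ⟨i₀, mem_univ _, mul_pos hi₀ (pow_pos (hp' i₀) 2)⟩
  have hA1 : 0 < ∑ i, c j i * (p i + δ)⁻¹ :=
    sum_pos' (fun i _ ↦ mul_nonneg (hc0 j i) (hp' i).le)
      ⟨i₀, mem_univ _, mul_pos hi₀ (hp' i₀)⟩
  have hB1 : 0 ≤ ∑ i, c j i * (q i - η)⁻¹ :=
    sum_nonneg fun i _ ↦ mul_nonneg (hc0 j i) (hq' i).le
  refine ⟨j, ((∑ i, c j i * ((p i + δ)⁻¹) ^ 2) / D + ∑ i, c j i * (p i + δ)⁻¹)⁻¹, ?_⟩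
  generalize ∑ i, c j i * ((p i + δ)⁻¹) ^ 2 = A2 at *
  generalize ∑ i, c j i * (p i + δ)⁻¹ = A1 at *
  generalize ∑ i, c j i * ((q i - η)⁻¹) ^ 2 = B2 at *
  generalize ∑ i, c j i * (q i - η)⁻¹ = B1 at *
  have hs : 0 < A2 / D + A1 := by positivity
  refine ⟨inv_pos.2 hs, ?_, ?_, ?_⟩
  · rw [inv_mul_lt_iff₀ hs]
    have : 0 < A2 / D := by positivity
    linarith
  · have : (A2 / D + A1)⁻¹ * A2 / (1 - (A2 / D + A1)⁻¹ * A1) = D := by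
      have h1 : 1 - (A2 / D + A1)⁻¹ * A1 = (A2 / D + A1)⁻¹ * (A2 / D) := by
        field_simp; ring
      rw [h1, mul_div_mul_left _ _ (inv_ne_zero hs.ne')]
      field_simp
    rw [this, hDdef]
    linarith
  · have : E ≤ (A2 / D + A1)⁻¹ * B2 / (1 + (A2 / D + A1)⁻¹ * B1) := by
      rw [le_div_iff₀ (by positivity)]
      have h1 : E * (1 + (A2 / D + A1)⁻¹ * B1) =
          (A2 / D + A1)⁻¹ * (E * ((A2 / D + A1) + B1)) := by
        field_simp
      rw [h1]
      refine mul_le_mul_of_nonneg_left ?_ (inv_pos.2 hs).le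
      rw [mul_comm, ← le_div_iff₀ hE]
      linarith
    linarith

end Scalar

section Rank

variable {ι : Type*} [Fintype ι] [DecidableEq ι]

/-- Rank-one updates of a positive diagonal matrix: positivity and the Sherman–Morrison formula. -/
theorem posDef_diagonal_add_rankOne {p : ι → ℝ} (hp : ∀ i, 0 < p i) (w : ι → ℝ) (s : ℝ)
    (hs : 0 < 1 + s * ∑ i, w i ^ 2 * (p i)⁻¹) :
    (diagonal p + s • vecMulVec w w).PosDef ∧
      ((diagonal p + s • vecMulVec w w)⁻¹).trace = ∑ i, (p i)⁻¹ -
        s * (∑ i, w i ^ 2 * ((p i)⁻¹) ^ 2) / (1 + s * ∑ i, w i ^ 2 * (p i)⁻¹) := by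
  constructor
  · refine PosDef.of_dotProduct_mulVec_pos ?_ fun x hx ↦ ?_
    · ext i j
      simp [vecMulVec_apply, diagonal_apply, mul_comm (w i), eq_comm (a := i)]
      grind
    · have hquad : star x ⬝ᵥ (diagonal p + s • vecMulVec w w) *ᵥ x =
          ∑ i, p i * x i ^ 2 + s * (∑ i, w i * x i) ^ 2 := by
        rw [add_mulVec, smul_mulVec, vecMulVec_mulVec, dotProduct_add, dotProduct_smul]
        simp only [dotProduct, mulVec_diagonal, star_trivial, smul_eq_mul, Pi.smul_apply,
          MulOpposite.smul_eq_mul_unop, MulOpposite.unop_op]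
        congr 1
        · exact sum_congr rfl fun i _ ↦ by ring
        · rw [sq, sum_mul (f := fun i ↦ w i * x i)]
          congr 1
          exact sum_congr rfl fun i _ ↦ by ring
      rw [hquad]
      have hpos : 0 < ∑ i, p i * x i ^ 2 := by
        obtain ⟨i, hi⟩ := Function.ne_iff.1 hx
        refine sum_pos' (fun i _ ↦ mul_nonneg (hp i).le (sq_nonneg _)) ⟨i, mem_univ _, ?_⟩
        have : x i ≠ 0 := hi
        have := hp i
        positivity
      have hcs : (∑ i, w i * x i) ^ 2 ≤ (∑ i, w i ^ 2 * (p i)⁻¹) * ∑ i, p i * x i ^ 2 := by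
        refine sum_sq_le_sum_mul_sum_of_sq_le_mul _
          (fun i _ ↦ mul_nonneg (sq_nonneg _) (inv_pos.2 (hp i)).le)
          (fun i _ ↦ mul_nonneg (hp i).le (sq_nonneg _)) fun i _ ↦ le_of_eq ?_
        have := (hp i).ne'
        field_simp
      rcases le_or_gt 0 s with h | h
      · positivity
      · nlinarith [mul_le_mul_of_nonpos_left hcs h.le, mul_pos hs hpos]
  · set k := 1 + s * ∑ i, w i ^ 2 * (p i)⁻¹ with hk
    have hinv : (diagonal p + s • vecMulVec w w)⁻¹ =
        diagonal (fun i ↦ (p i)⁻¹) -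
          (s / k) • vecMulVec (fun i ↦ w i * (p i)⁻¹) (fun i ↦ w i * (p i)⁻¹) := by
      refine inv_eq_right_inv ?_
      have h1 : diagonal p * diagonal (fun i ↦ (p i)⁻¹) = 1 := by
        rw [diagonal_mul_diagonal, ← diagonal_one]
        congr 1
        ext i
        exact mul_inv_cancel₀ (hp i).ne'
      have h2 : diagonal p *ᵥ (fun i ↦ w i * (p i)⁻¹) = w := by
        ext i
        rw [mulVec_diagonal]
        have := (hp i).ne'
        field_simp
      have h3 : w ᵥ* diagonal (fun i ↦ (p i)⁻¹) = fun i ↦ w i * (p i)⁻¹ := by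
        ext i
        rw [vecMul_diagonal]
      have h4 : w ⬝ᵥ (fun i ↦ w i * (p i)⁻¹) = ∑ i, w i ^ 2 * (p i)⁻¹ :=
        sum_congr rfl fun i _ ↦ by ring
      simp only [add_mul, mul_sub, Matrix.mul_smul, Matrix.smul_mul, mul_vecMulVec, vecMulVec_mul,
        h1, h2, h3, smul_mulVec, vecMulVec_mulVec, h4]
      ext i j
      simp [vecMulVec_apply]
      field_simp
      rw [hk]
      ring_nf
    rw [hinv, trace_sub, trace_diagonal, trace_smul, trace_vecMulVec]
    have : (fun i ↦ w i * (p i)⁻¹) ⬝ᵥ (fun i ↦ w i * (p i)⁻¹) = ∑ i, w i ^ 2 * ((p i)⁻¹) ^ 2 :=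
      sum_congr rfl fun i _ ↦ by ring
    rw [this, smul_eq_mul]
    ring

end Rank

section Potential

variable {ι κ : Type*} [Fintype ι] [DecidableEq ι] [Fintype κ]

/-- `M` is positive definite and the barrier potential `tr M⁻¹` is at most `ε`. -/
def PotentialLE (M : Matrix ι ι ℝ) (ε : ℝ) : Prop :=
  M.PosDef ∧ M⁻¹.trace ≤ ε

theorem PotentialLE.conj {M V : Matrix ι ι ℝ} {ε : ℝ} (h : PotentialLE M ε) (hV : Vᵀ * V = 1) :
    PotentialLE (V * M * Vᵀ) ε := by
  have hV' : V * Vᵀ = 1 := mul_eq_one_comm.1 hV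
  have hdet : IsUnit M.det := (isUnit_iff_isUnit_det M).1 h.1.isUnit
  constructor
  · rw [← conjTranspose_eq_transpose_of_trivial]
    refine h.1.mul_mul_conjTranspose_same ?_
    intro x y hxy
    simpa [vecMul_vecMul, hV'] using congrArg (· ᵥ* Vᵀ) hxy
  · have : (V * M * Vᵀ)⁻¹ = V * M⁻¹ * Vᵀ := by
      refine inv_eq_right_inv ?_
      calc V * M * Vᵀ * (V * M⁻¹ * Vᵀ) = V * M * (Vᵀ * V) * M⁻¹ * Vᵀ := by
            simp only [Matrix.mul_assoc]
        _ = V * (M * M⁻¹) * Vᵀ := by rw [hV, Matrix.mul_one]; simp only [Matrix.mul_assoc]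
        _ = 1 := by rw [mul_nonsing_inv _ hdet, Matrix.mul_one, hV']
    rw [this, trace_mul_comm, ← Matrix.mul_assoc, hV, Matrix.one_mul]
    exact h.2

theorem potentialLE_conj_iff {M V : Matrix ι ι ℝ} {ε : ℝ} (hV : Vᵀ * V = 1) :
    PotentialLE (V * M * Vᵀ) ε ↔ PotentialLE M ε := by
  refine ⟨fun h ↦ ?_, fun h ↦ h.conj hV⟩
  have hM : Vᵀ * (V * M * Vᵀ) * Vᵀᵀ = M := by
    calc _ = (Vᵀ * V) * M * (Vᵀ * V) := by simp only [Matrix.mul_assoc, transpose_transpose]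
      _ = M := by simp [hV]
  rw [← hM]
  exact h.conj (by rw [transpose_transpose]; exact mul_eq_one_comm.1 hV)

theorem potentialLE_diagonal_iff {p : ι → ℝ} {ε : ℝ} :
    PotentialLE (diagonal p) ε ↔ (∀ i, 0 < p i) ∧ ∑ i, (p i)⁻¹ ≤ ε := by
  unfold PotentialLE
  rw [posDef_diagonal_iff]
  refine and_congr_right fun hp ↦ ?_
  have : (diagonal p)⁻¹ = diagonal fun i ↦ (p i)⁻¹ := by
    refine inv_eq_right_inv ?_
    rw [diagonal_mul_diagonal, ← diagonal_one]
    congr 1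
    ext i
    exact mul_inv_cancel₀ (hp i).ne'
  rw [this, trace_diagonal]

theorem exists_orthogonal_diagonalization {A : Matrix ι ι ℝ} (hA : A.IsHermitian) :
    ∃ (V : Matrix ι ι ℝ) (p : ι → ℝ), Vᵀ * V = 1 ∧ A = V * diagonal p * Vᵀ := by
  refine ⟨hA.eigenvectorUnitary, hA.eigenvalues, ?_, ?_⟩
  · rw [← conjTranspose_eq_transpose_of_trivial, ← star_eq_conjTranspose]
    exact Unitary.coe_star_mul_self _
  · conv_lhs => rw [hA.spectral_theorem]
    rw [Unitary.conjStarAlgAut_apply, star_eq_conjTranspose, conjTranspose_eq_transpose_of_trivial]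
    rfl

theorem PotentialLE.dotProduct_self_le {M : Matrix ι ι ℝ} {ε : ℝ} (h : PotentialLE M ε)
    (x : ι → ℝ) : x ⬝ᵥ x ≤ ε * (x ⬝ᵥ M *ᵥ x) := by
  obtain ⟨V, p, hV, rfl⟩ := exists_orthogonal_diagonalization h.1.isHermitian
  obtain ⟨hp, hε⟩ := potentialLE_diagonal_iff.1 ((potentialLE_conj_iff hV).1 h)
  have hV' : V * Vᵀ = 1 := mul_eq_one_comm.1 hV
  have h1 : x ⬝ᵥ (V * diagonal p * Vᵀ) *ᵥ x = (Vᵀ *ᵥ x) ⬝ᵥ diagonal p *ᵥ (Vᵀ *ᵥ x) := by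
    rw [← mulVec_mulVec, ← mulVec_mulVec, dotProduct_mulVec x V, ← mulVec_transpose]
  have h2 : x ⬝ᵥ x = (Vᵀ *ᵥ x) ⬝ᵥ (Vᵀ *ᵥ x) := by
    rw [mulVec_transpose, ← dotProduct_mulVec, ← mulVec_transpose, mulVec_mulVec, hV', one_mulVec]
  rw [h1, h2]
  simp only [dotProduct, mulVec_diagonal, mul_sum]
  refine sum_le_sum fun i _ ↦ ?_
  have h3 : (p i)⁻¹ ≤ ε :=
    (single_le_sum (f := fun i ↦ (p i)⁻¹) (fun j _ ↦ (inv_pos.2 (hp j)).le) (mem_univ i)).trans hε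
  have h4 : 1 ≤ ε * p i := by rwa [← inv_le_iff_one_le_mul₀ (hp i)]
  nlinarith [mul_self_nonneg ((Vᵀ *ᵥ x) i)]

theorem potentialLE_diagonal_add_rankOne {p : ι → ℝ} (hp : ∀ i, 0 < p i) {w : ι → ℝ} {s ε : ℝ}
    (hs : 0 < 1 + s * ∑ i, w i ^ 2 * (p i)⁻¹)
    (hε : ∑ i, (p i)⁻¹ - s * (∑ i, w i ^ 2 * ((p i)⁻¹) ^ 2) /
      (1 + s * ∑ i, w i ^ 2 * (p i)⁻¹) ≤ ε) :
    PotentialLE (diagonal p + s • vecMulVec w w) ε := by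
  obtain ⟨h1, h2⟩ := posDef_diagonal_add_rankOne hp w s hs
  exact ⟨h1, h2.trans_le hε⟩

/-- The barrier step for a diagonal matrix. -/
theorem exists_rankOne_update_diagonal [Nonempty ι] {lam : ι → ℝ} {u l εU εL δ η : ℝ}
    (hU : PotentialLE (u • 1 - diagonal lam) εU) (hL : PotentialLE (diagonal lam - l • 1) εL)
    (hδ : 0 < δ) (hη : 0 < η) (hbal : 1 / δ + εU ≤ 1 / η - εL)
    {w : κ → ι → ℝ} (hw0 : ∀ j, w j ≠ 0) (hw : ∑ j, vecMulVec (w j) (w j) = 1) :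
    ∃ j, ∃ t : ℝ, 0 < t ∧
      PotentialLE ((u + δ) • 1 - (diagonal lam + t • vecMulVec (w j) (w j))) εU ∧
      PotentialLE (diagonal lam + t • vecMulVec (w j) (w j) - (l + η) • 1) εL := by
  rw [smul_one_eq_diagonal, diagonal_sub, potentialLE_diagonal_iff] at hU hL
  obtain ⟨hp, hpε⟩ := hU
  obtain ⟨hq, hqε⟩ := hL
  have hc : ∀ i, ∑ j, w j i ^ 2 = 1 := fun i ↦ by
    simpa [Matrix.sum_apply, vecMulVec_apply, ← sq] using congrFun (congrFun hw i) i
  have : Nonempty κ := by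
    by_contra h
    rw [not_nonempty_iff] at h
    simpa using hc (Classical.arbitrary ι)
  have hεL : εL < 1 / η := by
    have : 0 < ∑ i, (u - lam i)⁻¹ := sum_pos (fun i _ ↦ inv_pos.2 (hp i)) univ_nonempty
    have : 0 < 1 / δ := by positivity
    linarith
  have hqη : ∀ i, η < lam i - l := fun i ↦ by
    have h : (lam i - l)⁻¹ ≤ εL :=
      (single_le_sum (f := fun i ↦ (lam i - l)⁻¹) (fun j _ ↦ (inv_pos.2 (hq j)).le)
        (mem_univ i)).trans hqε
    have h' := h.trans_lt hεL
    rw [one_div] at h'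
    exact (inv_lt_inv₀ (hq i) hη).1 h'
  have hsum : η * ∑ i, (lam i - l)⁻¹ ≤ 1 := by
    rw [mul_comm, ← le_div_iff₀ hη]
    linarith
  obtain ⟨j, t, ht, h1, h2, h3⟩ := exists_scalar_update (c := fun j i ↦ w j i ^ 2) hp hδ hη hqη hsum
    (by linarith) (fun j i ↦ sq_nonneg _)
    (fun j ↦ (Function.ne_iff.1 (hw0 j)).imp fun i hi ↦ sq_pos_of_ne_zero hi) hc
  refine ⟨j, t, ht, ?_, ?_⟩
  · have : (u + δ) • 1 - (diagonal lam + t • vecMulVec (w j) (w j)) =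
        diagonal (fun i ↦ u - lam i + δ) + (-t) • vecMulVec (w j) (w j) := by
      rw [smul_one_eq_diagonal, ← sub_sub, diagonal_sub, neg_smul, ← sub_eq_add_neg]
      congr 2
      ext i
      ring
    rw [this]
    refine potentialLE_diagonal_add_rankOne (fun i ↦ add_pos (hp i) hδ) (by linarith) ?_
    rw [neg_mul, neg_div, sub_neg_eq_add, neg_mul, ← sub_eq_add_neg]
    exact h2.trans hpε
  · have : diagonal lam + t • vecMulVec (w j) (w j) - (l + η) • 1 =
        diagonal (fun i ↦ lam i - l - η) + t • vecMulVec (w j) (w j) := by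
      rw [smul_one_eq_diagonal, add_sub_right_comm, diagonal_sub]
      congr 2
      ext i
      ring
    rw [this]
    have hpos : 0 ≤ ∑ i, w j i ^ 2 * (lam i - l - η)⁻¹ := sum_nonneg fun i _ ↦
      mul_nonneg (sq_nonneg _) (inv_pos.2 (sub_pos.2 (hqη i))).le
    exact potentialLE_diagonal_add_rankOne (fun i ↦ sub_pos.2 (hqη i)) (by positivity)
      (h3.trans hqε)

/-- The barrier step: if the potentials are balanced, some rank-one update allows both barriers to
be shifted without increasing either potential. -/
theorem exists_rankOne_update [Nonempty ι] {A : Matrix ι ι ℝ} (hA : A.IsHermitian)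
    {u l εU εL δ η : ℝ} (hU : PotentialLE (u • 1 - A) εU) (hL : PotentialLE (A - l • 1) εL)
    (hδ : 0 < δ) (hη : 0 < η) (hbal : 1 / δ + εU ≤ 1 / η - εL)
    {w : κ → ι → ℝ} (hw0 : ∀ j, w j ≠ 0) (hw : ∑ j, vecMulVec (w j) (w j) = 1) :
    ∃ j, ∃ t : ℝ, 0 < t ∧
      PotentialLE ((u + δ) • 1 - (A + t • vecMulVec (w j) (w j))) εU ∧
      PotentialLE (A + t • vecMulVec (w j) (w j) - (l + η) • 1) εL := by
  obtain ⟨V, p, hV, rfl⟩ := exists_orthogonal_diagonalization hA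
  have hV' : V * Vᵀ = 1 := mul_eq_one_comm.1 hV
  have hone (r : ℝ) : r • (1 : Matrix ι ι ℝ) = V * (r • 1) * Vᵀ := by
    rw [Matrix.mul_smul, Matrix.mul_one, Matrix.smul_mul, hV']
  have hvec (j : κ) : vecMulVec (w j) (w j) =
      V * vecMulVec (Vᵀ *ᵥ w j) (Vᵀ *ᵥ w j) * Vᵀ := by
    rw [mul_vecMulVec, vecMulVec_mul, mulVec_mulVec, hV', one_mulVec, vecMul_transpose,
      mulVec_mulVec, hV', one_mulVec]
  have hvec' (j : κ) : vecMulVec (Vᵀ *ᵥ w j) (Vᵀ *ᵥ w j) = Vᵀ * vecMulVec (w j) (w j) * V := by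
    rw [mul_vecMulVec, vecMulVec_mul, mulVec_transpose]
  rw [hone, ← Matrix.sub_mul, ← Matrix.mul_sub, potentialLE_conj_iff hV] at hU hL
  have hw0' (j : κ) : Vᵀ *ᵥ w j ≠ 0 := fun h ↦ hw0 j <| by
    simpa [mulVec_mulVec, hV'] using congrArg (V *ᵥ ·) h
  have hw' : ∑ j, vecMulVec (Vᵀ *ᵥ w j) (Vᵀ *ᵥ w j) = 1 := by
    simp only [hvec', ← Matrix.mul_sum, ← Matrix.sum_mul, hw, Matrix.mul_one, hV]
  obtain ⟨j, t, ht, h1, h2⟩ := exists_rankOne_update_diagonal hU hL hδ hη hbal hw0' hw'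
  refine ⟨j, t, ht, ?_, ?_⟩ <;>
  rw [hone, hvec, ← Matrix.smul_mul, ← Matrix.mul_smul, ← Matrix.add_mul, ← Matrix.mul_add,
    ← Matrix.sub_mul, ← Matrix.mul_sub, potentialLE_conj_iff hV] <;>
  assumption

theorem potentialLE_smul_one {u ε : ℝ} (hu : 0 < u) (h : Fintype.card ι * u⁻¹ ≤ ε) :
    PotentialLE (u • (1 : Matrix ι ι ℝ)) ε := by
  rw [smul_one_eq_diagonal, potentialLE_diagonal_iff]
  exact ⟨fun _ ↦ hu, by simpa using h⟩

/-- Iterating the barrier step `k` times uses at most `k` of the vectors. -/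
theorem exists_sparse_weights [Nonempty ι] {u l εU εL δ η : ℝ}
    (hU : PotentialLE (u • (1 : Matrix ι ι ℝ)) εU)
    (hL : PotentialLE ((-l) • (1 : Matrix ι ι ℝ)) εL)
    (hδ : 0 < δ) (hη : 0 < η) (hbal : 1 / δ + εU ≤ 1 / η - εL)
    {w : κ → ι → ℝ} (hw0 : ∀ j, w j ≠ 0) (hw : ∑ j, vecMulVec (w j) (w j) = 1) (k : ℕ) :
    ∃ s : κ → ℝ, (∀ j, 0 ≤ s j) ∧ #{j | s j ≠ 0} ≤ k ∧
      PotentialLE ((u + k * δ) • 1 - ∑ j, s j • vecMulVec (w j) (w j)) εU ∧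
      PotentialLE (∑ j, s j • vecMulVec (w j) (w j) - (l + k * η) • 1) εL := by
  classical
  induction k with
  | zero => exact ⟨0, by simp, by simp, by simpa using hU, by simpa using hL⟩
  | succ k ih =>
    obtain ⟨s, hs0, hcard, h1, h2⟩ := ih
    have hA : (∑ j, s j • vecMulVec (w j) (w j)).IsHermitian := by
      simp [IsHermitian, transpose_sum, transpose_vecMulVec]
    obtain ⟨j, t, ht, h3, h4⟩ := exists_rankOne_update hA h1 h2 hδ hη hbal hw0 hw
    have hsum : ∑ i, (s + Pi.single j t : κ → ℝ) i • vecMulVec (w i) (w i) =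
        ∑ i, s i • vecMulVec (w i) (w i) + t • vecMulVec (w j) (w j) := by
      simp [add_smul, sum_add_distrib, Pi.single_apply, ite_smul]
    refine ⟨s + Pi.single j t, fun i ↦ ?_, ?_, ?_, ?_⟩
    · have h : (0 : κ → ℝ) ≤ Pi.single j t := Pi.single_nonneg.2 ht.le
      exact add_nonneg (hs0 i) (h i)
    · calc #{i | (s + Pi.single j t : κ → ℝ) i ≠ 0} ≤ #(insert j ({i | s i ≠ 0} : Finset κ)) := by
            refine card_le_card fun i hi ↦ ?_
            by_cases hij : i = j
            · simp [hij]
            · simpa [hij] using hi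
        _ ≤ k + 1 := (card_insert_le _ _).trans (Nat.succ_le_succ hcard)
    · rw [hsum]
      convert h3 using 3
      push_cast
      ring
    · rw [hsum]
      convert h4 using 3
      push_cast
      ring

end Potential

end BarrierPotential

/-- Batson–Spielman–Srivastava: if unit vectors `vⱼ` and weights `aⱼ > 0` satisfy
`I_n = Σ aⱼ vⱼ ⊗ vⱼ`, then for every `d > 1` there are a subset `σ` with `|σ| ≤ dn` and
scalars `bⱼ > 0` (`j ∈ σ`) with `I_n ⪯ Σ_{j∈σ} bⱼ aⱼ vⱼ ⊗ vⱼ ⪯ γ_d I_n`,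
where `γ_d = ((√d + 1)/(√d − 1))²`. -/
theorem batson_spielman_srivastava (n m : ℕ)
    (v : Fin m → Fin n → ℝ) (hv : ∀ j, v j ⬝ᵥ v j = 1)
    (a : Fin m → ℝ) (ha : ∀ j, 0 < a j)
    (hid : (1 : Matrix (Fin n) (Fin n) ℝ) = ∑ j, a j • Matrix.vecMulVec (v j) (v j))
    (d : ℝ) (hd : 1 < d) :
    ∃ (σ : Finset (Fin m)) (b : Fin m → ℝ),
      (σ.card : ℝ) ≤ d * n ∧ (∀ j ∈ σ, 0 < b j) ∧
      (∀ x : Fin n → ℝ,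
        x ⬝ᵥ x ≤ x ⬝ᵥ (∑ j ∈ σ, (b j * a j) • Matrix.vecMulVec (v j) (v j)).mulVec x) ∧
      (∀ x : Fin n → ℝ,
        x ⬝ᵥ (∑ j ∈ σ, (b j * a j) • Matrix.vecMulVec (v j) (v j)).mulVec x ≤
          ((Real.sqrt d + 1) / (Real.sqrt d - 1)) ^ 2 * (x ⬝ᵥ x)) := by
  rcases Nat.eq_zero_or_pos n with rfl | hn
  · exact ⟨∅, 1, by simp, by simp, by simp, by simp⟩
  have : Nonempty (Fin n) := ⟨⟨0, hn⟩⟩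
  obtain ⟨r, hr⟩ : ∃ r, r = Real.sqrt d := ⟨_, rfl⟩
  have hr1 : 1 < r := by rw [hr]; exact Real.lt_sqrt_of_sq_lt (by simpa using hd)
  have hdr : d = r ^ 2 := by rw [hr, Real.sq_sqrt (by linarith)]
  rw [← hr]
  clear hr
  subst hdr
  have hr0 : 0 < r := by linarith
  have hr2 : 0 < r - 1 := by linarith
  have hn' : (1 : ℝ) ≤ n := by exact_mod_cast hn
  have hw0 : ∀ j, √(a j) • v j ≠ 0 := fun j h ↦ by
    have hvj : v j = 0 := (smul_eq_zero.1 h).resolve_left (Real.sqrt_pos.2 (ha j)).ne'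
    simpa [hvj] using hv j
  have hvec (j : Fin m) : Matrix.vecMulVec (√(a j) • v j) (√(a j) • v j) =
      a j • Matrix.vecMulVec (v j) (v j) := by
    rw [Matrix.smul_vecMulVec, Matrix.vecMulVec_smul, smul_smul, Real.mul_self_sqrt (ha j).le]
  obtain ⟨s, hs0, hcard, hU, hL⟩ := BarrierPotential.exists_sparse_weights (ι := Fin n)
    (u := n * (r * (r + 1) / (r - 1))) (l := -(n * r)) (εU := (r - 1) / (r * (r + 1)))
    (εL := 1 / r) (δ := (r + 1) / (r - 1)) (η := 1)
    (BarrierPotential.potentialLE_smul_one (by positivity)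
      (le_of_eq (by rw [Fintype.card_fin]; field_simp)))
    (BarrierPotential.potentialLE_smul_one (by rw [neg_neg]; positivity)
      (le_of_eq (by rw [Fintype.card_fin]; field_simp)))
    (by positivity) one_pos (le_of_eq (by field_simp)) hw0
    (by simp only [hvec]; exact hid.symm) ⌊r ^ 2 * n⌋₊
  simp only [hvec, smul_smul] at hU hL
  have hT1 : (⌊r ^ 2 * n⌋₊ : ℝ) ≤ r ^ 2 * n := Nat.floor_le (by positivity)
  have hT2 : r ^ 2 * (n - 1) < (⌊r ^ 2 * n⌋₊ : ℝ) := by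
    have := Nat.lt_floor_add_one (r ^ 2 * (n : ℝ))
    nlinarith
  have hcard' : (({j | s j ≠ 0} : Finset (Fin m)).card : ℝ) ≤ (⌊r ^ 2 * n⌋₊ : ℝ) := by
    exact_mod_cast hcard
  generalize (⌊r ^ 2 * n⌋₊ : ℝ) = T at *
  obtain ⟨c, hc⟩ : ∃ c, c = T - (n - 1) * r := ⟨_, rfl⟩
  have hc0 : 0 < c := by nlinarith [mul_nonneg (sub_nonneg.2 hn') hr0.le]
  have hsum : ∑ j ∈ ({j | s j ≠ 0} : Finset (Fin m)),
      (s j / c * a j) • Matrix.vecMulVec (v j) (v j) =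
      c⁻¹ • ∑ j, (s j * a j) • Matrix.vecMulVec (v j) (v j) := by
    rw [Finset.smul_sum, Finset.sum_filter]
    refine Finset.sum_congr rfl fun j _ ↦ ?_
    rw [smul_smul]
    split_ifs with h
    · congr 1
      ring
    · simp [not_not.1 h]
  refine ⟨({j | s j ≠ 0} : Finset (Fin m)), fun j ↦ s j / c, hcard'.trans hT1, fun j hj ↦ ?_,
    fun x ↦ ?_, fun x ↦ ?_⟩
  · exact div_pos ((hs0 j).lt_of_ne' (Finset.mem_filter.1 hj).2) hc0
  · rw [hsum, Matrix.smul_mulVec, dotProduct_smul, smul_eq_mul]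
    have h := hL.dotProduct_self_le x
    rw [Matrix.sub_mulVec, Matrix.smul_mulVec, Matrix.one_mulVec, dotProduct_sub, dotProduct_smul,
      smul_eq_mul, one_div, le_inv_mul_iff₀ hr0] at h
    rw [le_inv_mul_iff₀ hc0, hc]
    linarith
  · rw [hsum, Matrix.smul_mulVec, dotProduct_smul, smul_eq_mul]
    have h := hU.dotProduct_self_le x
    have hx : 0 ≤ x ⬝ᵥ x := by simpa using dotProduct_star_self_nonneg x
    rw [Matrix.sub_mulVec, Matrix.smul_mulVec, Matrix.one_mulVec, dotProduct_sub, dotProduct_smul,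
      smul_eq_mul, ← inv_div, le_inv_mul_iff₀ (by positivity)] at h
    have hbound : (n - 1) * (r * (r + 1) / (r - 1)) + T * ((r + 1) / (r - 1)) ≤
        c * ((r + 1) / (r - 1)) ^ 2 := by
      have : (n - 1) * (r * (r + 1) / (r - 1)) + T * ((r + 1) / (r - 1)) =
          (r + 1) / (r - 1) * (T + (n - 1) * r) := by ring
      rw [this, sq, mul_comm c, mul_assoc]
      gcongr
      rw [div_mul_eq_mul_div, le_div_iff₀ hr2, hc]
      linarith
    rw [inv_mul_le_iff₀ hc0]
    have := mul_le_mul_of_nonneg_right hbound hx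
    linarith
end

section
/- (Srivastava) For every ε > 0 there exists a constant α(ε) > 0 with the following property: whenever v_1, …, v_m are unit vectors in ℝⁿ and a_1, …, a_m > 0 satisfy I_n = Σ_{j=1}^m a_j v_j ⊗ v_j and Σ_{j=1}^m a_j v_j = 0, there exist a subset σ ⊆ {1, …, m} of cardinality |σ| ≤ α(ε)·n, positive scalars c_i (i ∈ σ), and a vector v ∈ ℝⁿ with ‖v‖² ≤ ε / (Σ_{i∈σ} c_i), such that I_n ⪯ Σ_{i∈σ} c_i (v_i + v) ⊗ (v_i + v) ⪯ (4 + ε) I_n and Σ_{i∈σ} c_i (v_i + v) = 0. -/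
open scoped Matrix

namespace BarrierSparsification

open Matrix

theorem sum_smul_centered {ι κ : Type*} (σ : Finset κ) (c : κ → ℝ) (v : κ → ι → ℝ)
    (hC : ∑ i ∈ σ, c i ≠ 0) :
    ∑ i ∈ σ, c i • (v i + -(∑ i ∈ σ, c i)⁻¹ • ∑ i ∈ σ, c i • v i) = 0 := by
  simp only [smul_add, Finset.sum_add_distrib, ← Finset.sum_smul, smul_smul]
  simp [← Finset.sum_mul, hC]

theorem PosDef.transpose_eq {ι : Type*} {X : Matrix ι ι ℝ} (hX : X.PosDef) : Xᵀ = X := by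
  simpa [IsHermitian, conjTranspose_eq_transpose_of_trivial] using hX.isHermitian

variable {ι : Type*} [Fintype ι]

theorem posSemidef_vecMulVec_self (v : ι → ℝ) : (vecMulVec v v).PosSemidef := by
  simpa using posSemidef_vecMulVec_self_star v

theorem dotProduct_vecMulVec_mulVec (v x : ι → ℝ) :
    x ⬝ᵥ vecMulVec v v *ᵥ x = (v ⬝ᵥ x) ^ 2 := by
  rw [vecMulVec_mulVec]
  simp [dotProduct_comm x v, sq]

theorem quadForm_mul_self_nonneg {Z : Matrix ι ι ℝ} (hZ : Z.IsHermitian) (x : ι → ℝ) :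
    0 ≤ x ⬝ᵥ (Z * Z) *ᵥ x := by
  have := (posSemidef_self_mul_conjTranspose Z).dotProduct_mulVec_nonneg x
  rwa [hZ] at this

theorem quadForm_sum_smul_vecMulVec {κ : Type*} (σ : Finset κ) (c : κ → ℝ) (v : κ → ι → ℝ)
    (x : ι → ℝ) :
    x ⬝ᵥ (∑ i ∈ σ, c i • vecMulVec (v i) (v i)) *ᵥ x = ∑ i ∈ σ, c i * (v i ⬝ᵥ x) ^ 2 := by
  simp [sum_mulVec, dotProduct_sum, smul_mulVec, dotProduct_vecMulVec_mulVec]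

/-- Centering a weighted family at its barycenter subtracts a rank-one term. -/
theorem sum_mul_centered_sq {κ : Type*} (σ : Finset κ) (c : κ → ℝ) (v : κ → ι → ℝ) (x : ι → ℝ)
    (hC : ∑ i ∈ σ, c i ≠ 0) :
    ∑ i ∈ σ, c i * ((v i + -(∑ i ∈ σ, c i)⁻¹ • ∑ i ∈ σ, c i • v i) ⬝ᵥ x) ^ 2 =
      ∑ i ∈ σ, c i * (v i ⬝ᵥ x) ^ 2 -
        ((∑ i ∈ σ, c i • v i) ⬝ᵥ x) ^ 2 / ∑ i ∈ σ, c i := by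
  set C := ∑ i ∈ σ, c i with hCdef
  set p := (∑ i ∈ σ, c i • v i) ⬝ᵥ x with hp
  have hpsum : ∑ i ∈ σ, c i * (v i ⬝ᵥ x) = p := by simp [hp, sum_dotProduct]
  have hterm : ∀ i, c i * ((v i + -C⁻¹ • ∑ i ∈ σ, c i • v i) ⬝ᵥ x) ^ 2 =
      c i * (v i ⬝ᵥ x) ^ 2 - 2 * C⁻¹ * p * (c i * (v i ⬝ᵥ x)) + (C⁻¹ * p) ^ 2 * c i := fun i => by
    rw [add_dotProduct, smul_dotProduct, ← hp, smul_eq_mul]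
    ring
  simp only [hterm, Finset.sum_add_distrib, Finset.sum_sub_distrib, ← Finset.mul_sum, hpsum,
    ← hCdef]
  field_simp
  ring

variable [DecidableEq ι]

/-- A rank-one downdate `X - t v ⊗ v` stays positive definite while `t ⟨v, X⁻¹ v⟩ < 1`. -/
theorem posDef_sub_smul_vecMulVec {X : Matrix ι ι ℝ} (hX : X.PosDef) (v : ι → ℝ) {t : ℝ}
    (ht : 0 < t) (htv : t * (v ⬝ᵥ X⁻¹ *ᵥ v) < 1) : (X - t • vecMulVec v v).PosDef := by
  refine PosDef.of_dotProduct_mulVec_pos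
    (hX.isHermitian.sub ((posSemidef_vecMulVec_self v).smul ht.le).isHermitian) fun {x} hx => ?_
  have hXX : X *ᵥ (X⁻¹ *ᵥ v) = v := by
    rw [mulVec_mulVec, mul_nonsing_inv _ ((isUnit_iff_isUnit_det _).1 hX.isUnit), one_mulVec]
  have hsymm : (X⁻¹ *ᵥ v) ⬝ᵥ X *ᵥ x = v ⬝ᵥ x := by
    rw [dotProduct_mulVec, ← mulVec_transpose, PosDef.transpose_eq hX, hXX]
  have hpos := hX.dotProduct_mulVec_pos hx
  have hsq := hX.posSemidef.dotProduct_mulVec_nonneg (x - (t * (v ⬝ᵥ x)) • X⁻¹ *ᵥ v)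
  simp only [star_trivial, mulVec_sub, mulVec_smul, hXX, sub_dotProduct, dotProduct_sub,
    smul_dotProduct, dotProduct_smul, hsymm, smul_eq_mul, dotProduct_comm x v,
    dotProduct_comm (X⁻¹ *ᵥ v) v] at hsq hpos ⊢
  rw [sub_mulVec, smul_mulVec, dotProduct_sub, dotProduct_smul, dotProduct_vecMulVec_mulVec,
    smul_eq_mul]
  rcases eq_or_ne (v ⬝ᵥ x) 0 with h0 | h0
  · simpa [h0] using hpos
  · have : 0 < t * (v ⬝ᵥ x) ^ 2 * (1 - t * (v ⬝ᵥ X⁻¹ *ᵥ v)) :=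
      mul_pos (by positivity) (by linarith)
    nlinarith

/-- The trace form of the Sherman–Morrison formula. -/
theorem trace_inv_add_smul_vecMulVec {X : Matrix ι ι ℝ} (hX : X.PosDef) (v : ι → ℝ) {t : ℝ}
    (ht : 1 + t * (v ⬝ᵥ X⁻¹ *ᵥ v) ≠ 0) :
    (X + t • vecMulVec v v)⁻¹.trace =
      X⁻¹.trace - t / (1 + t * (v ⬝ᵥ X⁻¹ *ᵥ v)) * (v ⬝ᵥ (X⁻¹ * X⁻¹) *ᵥ v) := by
  have hdet := (isUnit_iff_isUnit_det _).1 hX.isUnit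
  have hinv : (X + t • vecMulVec v v)⁻¹ = X⁻¹ -
      (t / (1 + t * (v ⬝ᵥ X⁻¹ *ᵥ v))) • vecMulVec (X⁻¹ *ᵥ v) (X⁻¹ *ᵥ v) := by
    apply inv_eq_right_inv
    have hvec : v ᵥ* X⁻¹ = X⁻¹ *ᵥ v := by
      rw [← mulVec_transpose, PosDef.transpose_eq hX.inv]
    rw [add_mul, mul_sub, mul_sub, mul_nonsing_inv _ hdet, mul_smul_comm, mul_vecMulVec,
      mulVec_mulVec, mul_nonsing_inv _ hdet, one_mulVec, smul_mul_assoc, smul_mul_assoc,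
      vecMulVec_mul, hvec, mul_smul_comm, vecMulVec_mul_vecMulVec, vecMulVec_smul]
    ext i j
    simp only [Matrix.add_apply, Matrix.sub_apply, Matrix.smul_apply, smul_eq_mul]
    field_simp
    ring
  rw [hinv, trace_sub, trace_smul, trace_vecMulVec, smul_eq_mul,
    ← mulVec_mulVec, dotProduct_mulVec v X⁻¹ (X⁻¹ *ᵥ v), ← mulVec_transpose,
    PosDef.transpose_eq hX.inv]

/-- Convexity of `δ ↦ tr (P + δ)⁻¹`, as a tangent inequality at `Q = P + δ`. -/
theorem trace_inv_add_mul_trace_le {P Q : Matrix ι ι ℝ} (hP : P.PosDef) (hQ : Q.PosDef) {δ : ℝ}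
    (hPQ : Q = P + δ • 1) : Q⁻¹.trace + δ * (Q⁻¹ * Q⁻¹).trace ≤ P⁻¹.trace := by
  have hdP := (isUnit_iff_isUnit_det _).1 hP.isUnit
  have hdQ := (isUnit_iff_isUnit_det _).1 hQ.isUnit
  have hleft : P⁻¹ = Q⁻¹ + δ • (Q⁻¹ * P⁻¹) := by
    have : Q⁻¹ * Q * P⁻¹ = Q⁻¹ * (P * P⁻¹) + δ • (Q⁻¹ * P⁻¹) := by
      rw [mul_assoc, show Q * P⁻¹ = P * P⁻¹ + δ • P⁻¹ by simp [hPQ, add_mul], mul_add,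
        mul_smul_comm]
    rwa [nonsing_inv_mul _ hdQ, mul_nonsing_inv _ hdP, one_mul, mul_one] at this
  have hright : P⁻¹ = Q⁻¹ + δ • (P⁻¹ * Q⁻¹) := by
    have : P⁻¹ * (Q * Q⁻¹) = P⁻¹ * P * Q⁻¹ + δ • (P⁻¹ * Q⁻¹) := by
      rw [← mul_assoc, show P⁻¹ * Q = P⁻¹ * P + δ • P⁻¹ by simp [hPQ, mul_add], add_mul,
        smul_mul_assoc]
    rwa [nonsing_inv_mul _ hdP, mul_nonsing_inv _ hdQ, one_mul, mul_one] at this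
  have hexp : P⁻¹ = Q⁻¹ + δ • (Q⁻¹ * Q⁻¹) + (δ * δ) • (Q⁻¹ * P⁻¹ * Q⁻¹) := by
    conv_lhs => rw [hleft, hright]
    rw [mul_add, mul_smul_comm, smul_add, smul_smul, mul_assoc, add_assoc]
  have hpsd : 0 ≤ (Q⁻¹ * P⁻¹ * Q⁻¹).trace := by
    have := (hP.inv.posSemidef.mul_mul_conjTranspose_same Q⁻¹).trace_nonneg
    rwa [hQ.inv.isHermitian] at this
  have htr := congrArg trace hexp
  simp only [trace_add, trace_smul, smul_eq_mul] at htr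
  nlinarith [mul_nonneg (mul_self_nonneg δ) hpsd]

open scoped MatrixOrder in
theorem quadForm_le_trace_mul {Z : Matrix ι ι ℝ} (hZ : Z.PosSemidef) (x : ι → ℝ) :
    x ⬝ᵥ Z *ᵥ x ≤ Z.trace * (x ⬝ᵥ x) := by
  obtain ⟨B, rfl⟩ := CStarAlgebra.nonneg_iff_eq_star_mul_self.mp hZ.nonneg
  rw [star_eq_conjTranspose, conjTranspose_eq_transpose_of_trivial]
  have htr : (Bᵀ * B).trace = ∑ i, B i ⬝ᵥ B i := by
    rw [trace_mul_comm]; rfl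
  have hq : x ⬝ᵥ (Bᵀ * B) *ᵥ x = ∑ i, (B i ⬝ᵥ x) ^ 2 := by
    rw [← mulVec_mulVec, dotProduct_mulVec, vecMul_transpose]
    simp [dotProduct, mulVec, sq]
  rw [htr, hq, Finset.sum_mul]
  refine Finset.sum_le_sum fun i _ => ?_
  simpa [dotProduct, sq] using Finset.sum_mul_sq_le_sq_mul_sq Finset.univ (B i) x

/-- A bound on `tr Y⁻¹` bounds `Y` from below. -/
theorem posSemidef_sub_smul_one {Y : Matrix ι ι ℝ} (hY : Y.PosDef) {r : ℝ} (hr : 0 ≤ r)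
    (htr : r * Y⁻¹.trace ≤ 1) : (Y - r • 1).PosSemidef := by
  refine PosSemidef.of_dotProduct_mulVec_nonneg
    (hY.isHermitian.sub (PosSemidef.one.smul hr).isHermitian) fun x => ?_
  rcases eq_or_ne x 0 with rfl | hx
  · simp
  have hYY : Y *ᵥ (Y⁻¹ *ᵥ x) = x := by
    rw [mulVec_mulVec, mul_nonsing_inv _ ((isUnit_iff_isUnit_det _).1 hY.isUnit), one_mulVec]
  have hsymm : (Y⁻¹ *ᵥ x) ⬝ᵥ Y *ᵥ x = x ⬝ᵥ x := by
    rw [dotProduct_mulVec, ← mulVec_transpose, PosDef.transpose_eq hY, hYY]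
  have hpos : 0 < x ⬝ᵥ x := by simpa using dotProduct_star_self_pos_iff.2 hx
  have hinv := quadForm_le_trace_mul hY.inv.posSemidef x
  have hsq := hY.posSemidef.dotProduct_mulVec_nonneg (x - r • Y⁻¹ *ᵥ x)
  simp only [star_trivial, mulVec_sub, mulVec_smul, hYY, sub_dotProduct, dotProduct_sub,
    smul_dotProduct, dotProduct_smul, hsymm, smul_eq_mul, dotProduct_comm (Y⁻¹ *ᵥ x) x] at hsq
  simp only [star_trivial, sub_mulVec, smul_mulVec, one_mulVec, dotProduct_sub, dotProduct_smul,
    smul_eq_mul]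
  nlinarith [mul_le_mul_of_nonneg_left hinv (mul_self_nonneg r),
    mul_le_mul_of_nonneg_right htr (mul_nonneg hr hpos.le)]

/-- Resolution of the identity turns weighted sums of quadratic forms into traces. -/
theorem sum_mul_quadForm {κ : Type*} [Fintype κ] {v : κ → ι → ℝ} {a : κ → ℝ}
    (hI : (1 : Matrix ι ι ℝ) = ∑ j, a j • vecMulVec (v j) (v j)) (Z : Matrix ι ι ℝ) :
    ∑ j, a j * (v j ⬝ᵥ Z *ᵥ v j) = Z.trace := by
  conv_rhs => rw [← mul_one Z, hI]
  simp [Finset.mul_sum, trace_sum, mul_vecMulVec, trace_vecMulVec, dotProduct_comm]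

theorem trace_inv_sub_smul_vecMulVec_le {X : Matrix ι ι ℝ} (hX : X.PosDef) (v : ι → ℝ) {t : ℝ}
    (ht : 0 ≤ t) (htv : t * (v ⬝ᵥ X⁻¹ *ᵥ v) ≤ 1 / 4) :
    (X - t • vecMulVec v v)⁻¹.trace ≤ X⁻¹.trace + 4 / 3 * t * (v ⬝ᵥ (X⁻¹ * X⁻¹) *ᵥ v) := by
  rw [sub_eq_add_neg, ← neg_smul, trace_inv_add_smul_vecMulVec hX _ (by linarith), neg_div,
    neg_mul, sub_neg_eq_add]
  gcongr
  · exact quadForm_mul_self_nonneg hX.inv.isHermitian v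
  · rw [div_le_iff₀ (by linarith)]
    linarith [mul_le_mul_of_nonneg_left htv ht]

theorem trace_inv_add_smul_vecMulVec_le {X : Matrix ι ι ℝ} (hX : X.PosDef) (v : ι → ℝ) {t : ℝ}
    (ht : 0 ≤ t) (htv : t * (v ⬝ᵥ X⁻¹ *ᵥ v) ≤ 1 / 4) :
    (X + t • vecMulVec v v)⁻¹.trace ≤ X⁻¹.trace - 3 / 4 * t * (v ⬝ᵥ (X⁻¹ * X⁻¹) *ᵥ v) := by
  have hpos : 0 ≤ v ⬝ᵥ X⁻¹ *ᵥ v := by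
    simpa using hX.inv.posSemidef.dotProduct_mulVec_nonneg v
  have hden : 0 < 1 + t * (v ⬝ᵥ X⁻¹ *ᵥ v) := by positivity
  rw [trace_inv_add_smul_vecMulVec hX _ hden.ne']
  gcongr
  · exact quadForm_mul_self_nonneg hX.inv.isHermitian v
  · rw [le_div_iff₀ hden]
    linarith [mul_le_mul_of_nonneg_left htv ht]

/-- One step of the two-barrier argument. With `X = u - A` and `Y = A - ℓ`, raising `u` by `1 / 12`
and `ℓ` by `1 / 24` leaves room for adding some `t v ⊗ v` to `A` without increasing the total
potential, while `‖s‖²` grows by at most `n² / 18` relative to its weight `β`. The index is found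
by averaging with weights `a j / t j`, for which the linear term in `s` vanishes. -/
theorem exists_barrier_step {κ : Type*} [Fintype κ] [Nonempty ι] {v : κ → ι → ℝ} {a : κ → ℝ}
    (hv : ∀ j, v j ⬝ᵥ v j = 1) (ha : ∀ j, 0 < a j)
    (hI : (1 : Matrix ι ι ℝ) = ∑ j, a j • vecMulVec (v j) (v j)) (h0 : ∑ j, a j • v j = 0)
    {X Y : Matrix ι ι ℝ} (hX : X.PosDef) (hY : Y.PosDef) (hXY : X⁻¹.trace + Y⁻¹.trace ≤ 3)
    (s : ι → ℝ) {β : ℝ} (hβ : 0 ≤ β) :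
    ∃ j, ∃ t : ℝ, 0 < t ∧ (X + (1 / 12 : ℝ) • 1 - t • vecMulVec (v j) (v j)).PosDef ∧
      (Y - (1 / 24 : ℝ) • 1 + t • vecMulVec (v j) (v j)).PosDef ∧
      (X + (1 / 12 : ℝ) • 1 - t • vecMulVec (v j) (v j))⁻¹.trace +
          (Y - (1 / 24 : ℝ) • 1 + t • vecMulVec (v j) (v j))⁻¹.trace +
          β * ((s + t • v j) ⬝ᵥ (s + t • v j)) ≤
        X⁻¹.trace + Y⁻¹.trace + β * (s ⬝ᵥ s) + β * Fintype.card ι ^ 2 / 18 := by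
  set n : ℝ := (Fintype.card ι : ℝ) with hn_def
  have hn : 0 < n := by simpa [n] using Fintype.card_pos (α := ι)
  have hX' : (X + (1 / 12 : ℝ) • (1 : Matrix ι ι ℝ)).PosDef :=
    hX.add_posSemidef (PosSemidef.one.smul (by norm_num))
  have hXpos := hX.inv.posSemidef.trace_nonneg
  have hYpos := hY.inv.posSemidef.trace_nonneg
  have hYlow : (Y - (1 / 3 : ℝ) • (1 : Matrix ι ι ℝ)).PosSemidef :=
    posSemidef_sub_smul_one hY (by norm_num) (by linarith)
  have hYsplit : Y - (1 / 24 : ℝ) • (1 : Matrix ι ι ℝ) =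
      (Y - (1 / 3 : ℝ) • 1) + (7 / 24 : ℝ) • 1 := by module
  have hY' : (Y - (1 / 24 : ℝ) • (1 : Matrix ι ι ℝ)).PosDef := by
    rw [hYsplit]
    exact PosDef.posSemidef_add hYlow (PosDef.one.smul (by norm_num))
  have hXshift := trace_inv_add_mul_trace_le hX hX' rfl
  have hYshift := trace_inv_add_mul_trace_le hY hY' (δ := -(1 / 24)) (by module)
  generalize X + (1 / 12 : ℝ) • (1 : Matrix ι ι ℝ) = P at *
  generalize Y - (1 / 24 : ℝ) • (1 : Matrix ι ι ℝ) = Q at *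
  have hQdet := (isUnit_iff_isUnit_det _).1 hY'.isUnit
  have hQsq : 7 / 24 * (Q⁻¹ * Q⁻¹).trace ≤ Q⁻¹.trace := by
    have := (hYlow.mul_mul_conjTranspose_same Q⁻¹).trace_nonneg
    rw [hY'.inv.isHermitian, eq_sub_of_add_eq hYsplit.symm, mul_sub, sub_mul,
      nonsing_inv_mul _ hQdet] at this
    simpa using this
  have hPsq : 0 ≤ (P⁻¹ * P⁻¹).trace := by
    have := (posSemidef_self_mul_conjTranspose P⁻¹).trace_nonneg
    rwa [hX'.inv.isHermitian] at this
  have hPpos := hX'.inv.posSemidef.trace_nonneg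
  have hQpos := hY'.inv.posSemidef.trace_nonneg
  have hsuma : ∑ j, a j = n := by simpa [hv, n] using sum_mul_quadForm hI 1
  have hκ : (Finset.univ : Finset κ).Nonempty := by
    by_contra hempty
    rw [Finset.not_nonempty_iff_eq_empty] at hempty
    simp [hempty] at hsuma
    linarith
  have hsums : ∑ j, a j * (s ⬝ᵥ v j) = 0 := by
    simpa [dotProduct_sum] using congrArg (s ⬝ᵥ ·) h0
  set r : ℝ := (18 - 4 * (P⁻¹.trace + Q⁻¹.trace)) / n with hr
  have hrn : 1 / n ≤ r := by
    rw [hr]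
    gcongr
    linarith
  have hgP : ∀ j, 0 ≤ v j ⬝ᵥ P⁻¹ *ᵥ v j := fun j => by
    simpa using hX'.inv.posSemidef.dotProduct_mulVec_nonneg (v j)
  have hgQ : ∀ j, 0 ≤ v j ⬝ᵥ Q⁻¹ *ᵥ v j := fun j => by
    simpa using hY'.inv.posSemidef.dotProduct_mulVec_nonneg (v j)
  set w : κ → ℝ := fun j => 4 * (v j ⬝ᵥ P⁻¹ *ᵥ v j + v j ⬝ᵥ Q⁻¹ *ᵥ v j) + r with hw
  have hwn : ∀ j, 1 / n ≤ w j := fun j => by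
    simp only [hw]
    linarith [hgP j, hgQ j]
  have hwpos : ∀ j, 0 < w j := fun j => (one_div_pos.2 hn).trans_le (hwn j)
  have hsumw : ∑ j, a j * w j = 18 := by
    have : ∀ j, a j * w j = 4 * (a j * (v j ⬝ᵥ P⁻¹ *ᵥ v j)) +
        4 * (a j * (v j ⬝ᵥ Q⁻¹ *ᵥ v j)) + r * a j := fun j => by simp only [hw]; ring
    simp only [this, Finset.sum_add_distrib, ← Finset.mul_sum, sum_mul_quadForm hI, hsuma]
    rw [hr]
    field_simp
    ring
  set F : κ → ℝ := fun j => P⁻¹.trace + Q⁻¹.trace + β * (s ⬝ᵥ s) + (w j)⁻¹ *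
    (4 / 3 * (v j ⬝ᵥ (P⁻¹ * P⁻¹) *ᵥ v j) - 3 / 4 * (v j ⬝ᵥ (Q⁻¹ * Q⁻¹) *ᵥ v j) +
      2 * β * (s ⬝ᵥ v j) + β * n) with hF
  set T : ℝ := X⁻¹.trace + Y⁻¹.trace + β * (s ⬝ᵥ s) + β * n ^ 2 / 18 with hT
  obtain ⟨j, -, hj⟩ : ∃ j ∈ Finset.univ, a j * w j * F j ≤ a j * w j * T := by
    refine Finset.exists_le_of_sum_le hκ ?_
    have : ∀ j, a j * w j * F j = (P⁻¹.trace + Q⁻¹.trace + β * (s ⬝ᵥ s)) * (a j * w j) +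
        4 / 3 * (a j * (v j ⬝ᵥ (P⁻¹ * P⁻¹) *ᵥ v j)) -
        3 / 4 * (a j * (v j ⬝ᵥ (Q⁻¹ * Q⁻¹) *ᵥ v j)) +
        2 * β * (a j * (s ⬝ᵥ v j)) + β * n * a j := fun j => by
      have := (hwpos j).ne'
      simp only [hF]
      field_simp
      ring
    simp only [this, Finset.sum_add_distrib, Finset.sum_sub_distrib, ← Finset.mul_sum,
      ← Finset.sum_mul, sum_mul_quadForm hI, hsuma, hsumw, hsums]
    rw [hT]
    linarith
  have hFT : F j ≤ T := le_of_mul_le_mul_left hj (mul_pos (ha j) (hwpos j))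
  have ht : 0 < (w j)⁻¹ := inv_pos.2 (hwpos j)
  have htw : (w j)⁻¹ * w j = 1 := inv_mul_cancel₀ (hwpos j).ne'
  have htn : (w j)⁻¹ ≤ n := by
    simpa using inv_anti₀ (one_div_pos.2 hn) (hwn j)
  have hr0 : 0 ≤ r := (one_div_pos.2 hn).le.trans hrn
  have htP : (w j)⁻¹ * (v j ⬝ᵥ P⁻¹ *ᵥ v j) ≤ 1 / 4 := by
    have : v j ⬝ᵥ P⁻¹ *ᵥ v j ≤ w j / 4 := by simp only [hw]; linarith [hgQ j]
    linarith [mul_le_mul_of_nonneg_left this ht.le]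
  have htQ : (w j)⁻¹ * (v j ⬝ᵥ Q⁻¹ *ᵥ v j) ≤ 1 / 4 := by
    have : v j ⬝ᵥ Q⁻¹ *ᵥ v j ≤ w j / 4 := by simp only [hw]; linarith [hgP j]
    linarith [mul_le_mul_of_nonneg_left this ht.le]
  refine ⟨j, (w j)⁻¹, ht, posDef_sub_smul_vecMulVec hX' _ ht (by linarith),
    hY'.add_posSemidef ((posSemidef_vecMulVec_self _).smul ht.le), le_trans ?_ hFT⟩
  have hup := trace_inv_sub_smul_vecMulVec_le hX' _ ht.le htP
  have hlow := trace_inv_add_smul_vecMulVec_le hY' _ ht.le htQ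
  have hnorm : (s + (w j)⁻¹ • v j) ⬝ᵥ (s + (w j)⁻¹ • v j) =
      s ⬝ᵥ s + 2 * (w j)⁻¹ * (s ⬝ᵥ v j) + (w j)⁻¹ * (w j)⁻¹ := by
    simp only [add_dotProduct, dotProduct_add, smul_dotProduct, dotProduct_smul, smul_eq_mul, hv,
      dotProduct_comm (v j) s]
    ring
  have htt := mul_le_mul_of_nonneg_left (mul_le_mul_of_nonneg_left htn ht.le) hβ
  rw [hnorm]
  simp only [hF]
  linarith

/-- Iterating `exists_barrier_step` from the barriers `-n ≺ 0 ≺ n`. -/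
theorem exists_barrier_weights {κ : Type*} [Fintype κ] [Nonempty ι] {v : κ → ι → ℝ} {a : κ → ℝ}
    (hv : ∀ j, v j ⬝ᵥ v j = 1) (ha : ∀ j, 0 < a j)
    (hI : (1 : Matrix ι ι ℝ) = ∑ j, a j • vecMulVec (v j) (v j)) (h0 : ∑ j, a j • v j = 0)
    {β : ℝ} (hβ : 0 ≤ β) {N : ℕ} (hN : N * (β * Fintype.card ι ^ 2 / 18) ≤ 1) (k : ℕ)
    (hk : k ≤ N) :
    ∃ c : κ → ℝ, (∀ j, 0 ≤ c j) ∧ (Finset.univ.filter fun j => c j ≠ 0).card ≤ k ∧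
      ((Fintype.card ι + k / 12 : ℝ) • 1 - ∑ j, c j • vecMulVec (v j) (v j)).PosDef ∧
      (∑ j, c j • vecMulVec (v j) (v j) - (k / 24 - Fintype.card ι : ℝ) • 1).PosDef ∧
      ((Fintype.card ι + k / 12 : ℝ) • 1 - ∑ j, c j • vecMulVec (v j) (v j))⁻¹.trace +
          (∑ j, c j • vecMulVec (v j) (v j) - (k / 24 - Fintype.card ι : ℝ) • 1)⁻¹.trace +
          β * ((∑ j, c j • v j) ⬝ᵥ ∑ j, c j • v j) ≤
        2 + k * (β * Fintype.card ι ^ 2 / 18) := by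
  classical
  set n : ℝ := (Fintype.card ι : ℝ) with hn_def
  have hn : 0 < n := by simpa [n] using Fintype.card_pos (α := ι)
  induction k with
  | zero =>
    have hpd : (n • (1 : Matrix ι ι ℝ)).PosDef := PosDef.one.smul hn
    have hinv : (n • (1 : Matrix ι ι ℝ))⁻¹.trace = 1 := by
      rw [inv_eq_right_inv (B := n⁻¹ • (1 : Matrix ι ι ℝ)) (by simp [smul_smul, hn.ne'])]
      simp [← hn_def, hn.ne']
    refine ⟨0, fun _ => le_rfl, by simp, by simpa using hpd, by simpa using hpd, ?_⟩
    simp [hinv]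
    norm_num
  | succ k ih =>
    obtain ⟨c, hc, hcard, hX, hY, hbound⟩ := ih (by omega)
    set A := ∑ j, c j • vecMulVec (v j) (v j) with hA
    set s := ∑ j, c j • v j with hs
    have hstep : 0 ≤ β * n ^ 2 / 18 := by positivity
    have hkN : (k : ℝ) * (β * n ^ 2 / 18) ≤ 1 :=
      le_trans (by gcongr; omega) hN
    have hss : 0 ≤ β * (s ⬝ᵥ s) := mul_nonneg hβ (by simpa using dotProduct_star_self_nonneg s)
    obtain ⟨j, t, ht, hX', hY', hle⟩ := exists_barrier_step hv ha hI h0 hX hY (by linarith) s hβ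
    have hA' : ∑ i, (c + Pi.single j t : κ → ℝ) i • vecMulVec (v i) (v i) =
        A + t • vecMulVec (v j) (v j) := by
      simp [add_smul, Finset.sum_add_distrib, Pi.single_apply, ite_smul, hA]
    have hs' : ∑ i, (c + Pi.single j t : κ → ℝ) i • v i = s + t • v j := by
      simp [add_smul, Finset.sum_add_distrib, Pi.single_apply, ite_smul, hs]
    have hXeq : (n + (k + 1 : ℕ) / 12 : ℝ) • 1 - (A + t • vecMulVec (v j) (v j)) =
        (n + k / 12 : ℝ) • 1 - A + (1 / 12 : ℝ) • 1 - t • vecMulVec (v j) (v j) := by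
      push_cast
      module
    have hYeq : A + t • vecMulVec (v j) (v j) - ((k + 1 : ℕ) / 24 - n : ℝ) • 1 =
        A - (k / 24 - n : ℝ) • 1 - (1 / 24 : ℝ) • 1 + t • vecMulVec (v j) (v j) := by
      push_cast
      module
    refine ⟨c + Pi.single j t, fun i => ?_, ?_, ?_, ?_, ?_⟩
    · have hsingle : (0 : κ → ℝ) ≤ Pi.single j t := Pi.single_nonneg.2 ht.le
      simpa using add_nonneg (hc i) (hsingle i)
    · have hsub : (Finset.univ.filter fun i => (c + Pi.single j t : κ → ℝ) i ≠ 0) ⊆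
          insert j (Finset.univ.filter fun i => c i ≠ 0) := fun i hi => by
        rcases eq_or_ne i j with rfl | hij
        · simp
        · simpa [hij] using hi
      exact (Finset.card_le_card hsub).trans ((Finset.card_insert_le _ _).trans (by omega))
    · rwa [hA', hXeq]
    · rwa [hA', hYeq]
    · rw [hA', hs', hXeq, hYeq]
      push_cast
      linarith

/-- With `24 D n` steps the barriers reach `(D - 1) n` and `(2 D + 1) n`. -/
theorem exists_sparse_weights {κ : Type*} [Fintype κ] [Nonempty ι] {v : κ → ι → ℝ} {a : κ → ℝ}
    (hv : ∀ j, v j ⬝ᵥ v j = 1) (ha : ∀ j, 0 < a j)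
    (hI : (1 : Matrix ι ι ℝ) = ∑ j, a j • vecMulVec (v j) (v j)) (h0 : ∑ j, a j • v j = 0)
    {D : ℕ} (hD : 0 < D) :
    ∃ c : κ → ℝ, (∀ j, 0 ≤ c j) ∧
      (Finset.univ.filter fun j => c j ≠ 0).card ≤ 24 * D * Fintype.card ι ∧
      (∀ x : ι → ℝ, (D - 1) * Fintype.card ι * (x ⬝ᵥ x) ≤ ∑ j, c j * (v j ⬝ᵥ x) ^ 2) ∧
      (∀ x : ι → ℝ, ∑ j, c j * (v j ⬝ᵥ x) ^ 2 ≤ (2 * D + 1) * Fintype.card ι * (x ⬝ᵥ x)) ∧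
      (D - 1) * (Fintype.card ι : ℝ) ^ 2 ≤ ∑ j, c j ∧
      (∑ j, c j • v j) ⬝ᵥ ∑ j, c j • v j ≤ 4 * D * (Fintype.card ι : ℝ) ^ 3 := by
  have hn : (0 : ℝ) < (Fintype.card ι : ℝ) := by simpa using Fintype.card_pos (α := ι)
  have hDpos : (0 : ℝ) < D := by exact_mod_cast hD
  obtain ⟨c, hc, hcard, hX, hY, hbound⟩ := exists_barrier_weights hv ha hI h0
    (β := 3 / (4 * D * (Fintype.card ι : ℝ) ^ 3)) (by positivity) (N := 24 * D * Fintype.card ι)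
    (by push_cast; field_simp; norm_num) _ le_rfl
  have hXtr := hX.inv.posSemidef.trace_nonneg
  have hYtr := hY.inv.posSemidef.trace_nonneg
  refine ⟨c, hc, hcard, fun x => ?_, fun x => ?_, ?_, ?_⟩
  · have := hY.posSemidef.dotProduct_mulVec_nonneg x
    simp only [star_trivial, sub_mulVec, smul_mulVec, one_mulVec, dotProduct_sub, dotProduct_smul,
      smul_eq_mul, quadForm_sum_smul_vecMulVec] at this
    push_cast at this
    linarith
  · have := hX.posSemidef.dotProduct_mulVec_nonneg x
    simp only [star_trivial, sub_mulVec, smul_mulVec, one_mulVec, dotProduct_sub, dotProduct_smul,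
      smul_eq_mul, quadForm_sum_smul_vecMulVec] at this
    push_cast at this
    linarith
  · have := hY.posSemidef.trace_nonneg
    simp only [trace_sub, trace_sum, trace_smul, trace_vecMulVec, hv, trace_one, smul_eq_mul,
      mul_one] at this
    push_cast at this
    linarith
  · have hlast : 3 / (4 * D * (Fintype.card ι : ℝ) ^ 3) *
        ((∑ j, c j • v j) ⬝ᵥ ∑ j, c j • v j) ≤ 3 := by
      have hone : ((24 * D * Fintype.card ι : ℕ) : ℝ) *
          (3 / (4 * D * (Fintype.card ι : ℝ) ^ 3) * (Fintype.card ι : ℝ) ^ 2 / 18) = 1 := by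
        push_cast
        field_simp
        norm_num
      linarith
    rw [div_mul_eq_mul_div, div_le_iff₀ (by positivity)] at hlast
    linarith

end BarrierSparsification

/-- Srivastava: for every `ε > 0` there is `α(ε) > 0` such that whenever unit vectors `vⱼ`
and weights `aⱼ > 0` satisfy `I_n = Σ aⱼ vⱼ ⊗ vⱼ` and `Σ aⱼ vⱼ = 0`, there are a subset `σ`
with `|σ| ≤ α(ε) n`, scalars `cᵢ > 0` (`i ∈ σ`) and a vector `v` with
`‖v‖² ≤ ε / Σ_{i∈σ} cᵢ`, such that
`I_n ⪯ Σ_{i∈σ} cᵢ (vᵢ + v) ⊗ (vᵢ + v) ⪯ (4 + ε) I_n` and `Σ_{i∈σ} cᵢ (vᵢ + v) = 0`. -/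
theorem srivastava_nonsymmetric :
    ∀ ε : ℝ, 0 < ε → ∃ α : ℝ, 0 < α ∧
      ∀ (n m : ℕ) (v : Fin m → Fin n → ℝ), (∀ j, v j ⬝ᵥ v j = 1) →
      ∀ a : Fin m → ℝ, (∀ j, 0 < a j) →
      (1 : Matrix (Fin n) (Fin n) ℝ) = ∑ j, a j • Matrix.vecMulVec (v j) (v j) →
      ∑ j, a j • v j = 0 →
      ∃ (σ : Finset (Fin m)) (c : Fin m → ℝ) (w : Fin n → ℝ),
        (σ.card : ℝ) ≤ α * n ∧ (∀ i ∈ σ, 0 < c i) ∧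
        w ⬝ᵥ w ≤ ε / (∑ i ∈ σ, c i) ∧
        (∀ x : Fin n → ℝ,
          x ⬝ᵥ x ≤ x ⬝ᵥ (∑ i ∈ σ, c i • Matrix.vecMulVec (v i + w) (v i + w)).mulVec x) ∧
        (∀ x : Fin n → ℝ,
          x ⬝ᵥ (∑ i ∈ σ, c i • Matrix.vecMulVec (v i + w) (v i + w)).mulVec x ≤
            (4 + ε) * (x ⬝ᵥ x)) ∧
        ∑ i ∈ σ, c i • (v i + w) = 0 := by
  intro ε hε
  set δ := min ε (1 / 3) with hδ_def
  have hδ : 0 < δ := lt_min hε (by norm_num)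
  have hδε : δ ≤ ε := min_le_left _ _
  have hδ3 : δ ≤ 1 / 3 := min_le_right _ _
  obtain ⟨D, hD⟩ := exists_nat_ge (22 / δ)
  rw [div_le_iff₀ hδ] at hD
  have hD66 : (66 : ℝ) ≤ D := by nlinarith [(Nat.cast_nonneg D : (0 : ℝ) ≤ D)]
  refine ⟨24 * D, by linarith, fun n m v hv a ha hI h0 => ?_⟩
  rcases Nat.eq_zero_or_pos n with rfl | hnpos
  · exact ⟨∅, 0, 0, by simp, by simp, by simp, by simp, by simp, by simp⟩
  have : Nonempty (Fin n) := ⟨⟨0, hnpos⟩⟩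
  have hn : (0 : ℝ) < n := by exact_mod_cast hnpos
  obtain ⟨c, hc, hcard, hlow, hup, hsum, hnorm⟩ :=
    BarrierSparsification.exists_sparse_weights hv ha hI h0 (D := D)
      (by exact_mod_cast (by linarith : (0 : ℝ) < D))
  rw [Fintype.card_fin] at hcard hlow hup hsum hnorm
  set ρ : ℝ := (1 + δ) / ((D - 1) * n) with hρ_def
  have hℓ : 0 < (D - 1) * (n : ℝ) := mul_pos (by linarith) hn
  have hρ : 0 < ρ := by positivity
  have hρℓ : ρ * ((D - 1) * n) = 1 + δ := div_mul_cancel₀ _ hℓ.ne'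
  set σ : Finset (Fin m) := Finset.univ.filter fun j => c j ≠ 0 with hσ
  have hσsum : ∀ {M : Type} [AddCommMonoid M] [Module ℝ M] (f : Fin m → M),
      ∑ i ∈ σ, (ρ * c i) • f i = ρ • ∑ i, c i • f i := fun f => by
    rw [Finset.smul_sum, hσ, Finset.sum_filter_of_ne]
    · simp [mul_smul]
    · intro i _ hi hci
      simp [hci] at hi
  have hCeq : ∑ i ∈ σ, ρ * c i = ρ * ∑ i, c i := by simpa using hσsum fun _ => (1 : ℝ)
  have hseq : ∑ i ∈ σ, (ρ * c i) • v i = ρ • ∑ i, c i • v i := hσsum v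
  have hqeq : ∀ x : Fin n → ℝ, ∑ i ∈ σ, ρ * c i * (v i ⬝ᵥ x) ^ 2 =
      ρ * ∑ i, c i * (v i ⬝ᵥ x) ^ 2 := fun x => by
    simpa using hσsum fun i => (v i ⬝ᵥ x) ^ 2
  set C := ∑ i ∈ σ, ρ * c i with hC_def
  set s := ∑ i ∈ σ, (ρ * c i) • v i with hs_def
  have hC : 0 < C := by
    rw [hCeq]
    exact mul_pos hρ (lt_of_lt_of_le (mul_pos (by linarith) (by positivity)) hsum)
  have hsC : s ⬝ᵥ s ≤ δ * C := by
    have hkey : (1 + δ) * (4 * D) ≤ δ * (D - 1) ^ 2 := by nlinarith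
    have hscaled : ρ * (4 * D * (n : ℝ) ^ 3) ≤ δ * ((D - 1) * (n : ℝ) ^ 2) := by
      rw [hρ_def, div_mul_eq_mul_div, div_le_iff₀ hℓ]
      nlinarith [mul_le_mul_of_nonneg_right hkey (pow_pos hn 3).le]
    rw [hseq, hCeq, smul_dotProduct, dotProduct_smul, smul_eq_mul, smul_eq_mul]
    nlinarith [mul_le_mul_of_nonneg_left hnorm hρ.le, mul_le_mul_of_nonneg_left hsum hδ.le]
  have hquad := fun x => (BarrierSparsification.quadForm_sum_smul_vecMulVec σ (fun i => ρ * c i)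
    (fun i => v i + -C⁻¹ • s) x).trans
      (BarrierSparsification.sum_mul_centered_sq σ (fun i => ρ * c i) v x hC.ne')
  refine ⟨σ, fun i => ρ * c i, -C⁻¹ • s, by exact_mod_cast hcard, fun i hi => ?_, ?_,
    fun x => ?_, fun x => ?_, BarrierSparsification.sum_smul_centered σ _ v hC.ne'⟩
  · exact mul_pos hρ ((hc i).lt_of_ne' (Finset.mem_filter.1 hi).2)
  · rw [smul_dotProduct, dotProduct_smul, smul_eq_mul, smul_eq_mul, ← hC_def, le_div_iff₀ hC]
    have : -C⁻¹ * (-C⁻¹ * s ⬝ᵥ s) * C = s ⬝ᵥ s / C := by field_simp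
    rw [this, div_le_iff₀ hC]
    exact hsC.trans (by gcongr)
  · rw [hquad, hqeq]
    have hcs : (s ⬝ᵥ x) ^ 2 ≤ (s ⬝ᵥ s) * (x ⬝ᵥ x) := by
      simpa [dotProduct, sq] using Finset.sum_mul_sq_le_sq_mul_sq Finset.univ s x
    have hxx : 0 ≤ x ⬝ᵥ x := by simpa using dotProduct_star_self_nonneg x
    have hdiv : (s ⬝ᵥ x) ^ 2 / C ≤ δ * (x ⬝ᵥ x) := by
      rw [div_le_iff₀ hC]
      nlinarith [mul_le_mul_of_nonneg_right hsC hxx]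
    have := mul_le_mul_of_nonneg_left (hlow x) hρ.le
    rw [← mul_assoc, hρℓ] at this
    change _ ≤ _ - (s ⬝ᵥ x) ^ 2 / C
    linarith
  · rw [hquad, hqeq]
    have hxx : 0 ≤ x ⬝ᵥ x := by simpa using dotProduct_star_self_nonneg x
    have hρu : ρ * ((2 * D + 1) * n) ≤ 4 + ε := by
      rw [hρ_def, div_mul_eq_mul_div, div_le_iff₀ hℓ]
      have : (1 + δ) * (2 * D + 1) ≤ 4 * (D - 1) := by nlinarith
      nlinarith [mul_le_mul_of_nonneg_right this hn.le, mul_pos hε hℓ]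
    have := mul_le_mul_of_nonneg_left (hup x) hρ.le
    have := mul_le_mul_of_nonneg_right hρu hxx
    have : 0 ≤ (s ⬝ᵥ x) ^ 2 / C := by positivity
    change _ - (s ⬝ᵥ x) ^ 2 / C ≤ _
    linarith
end
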